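/- There exists a constant C > 0 such that for every natural number m ≥ 1 and every finite field F of odd order, writing G = Sp_{2m}(F), there exists an element x ∈ G such that the number of y ∈ G for which {x, y} invariably generates G is at least (1 − C·m^{−1/200}) · |G|. -/

import Mathlib

/-- `{x, y}` invariably generates `G`: for all `g, h`, the conjugates
`g * x * g⁻¹` and `h * y * h⁻¹` generate `G`. -/
def InvGen {G : Type*} [Group G] (x y : G) : Prop :=
  ∀ g h : G, Subgroup.closure {g * x * g⁻¹, h * y * h⁻¹} = ⊤

set_option autoImplicit false
set_option linter.unusedSectionVars false
set_option linter.unusedSimpArgs false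
set_option linter.unusedVariables false

set_option linter.style.longLine false
namespace SpGen
open Module

theorem alt_nondeg {F V : Type*} [Field F] [AddCommGroup V] [Module F V]
    {B : LinearMap.BilinForm F V} (hB : B.IsAlt) (h : ∀ v, (∀ w, B v w = 0) → v = 0) : B.Nondegenerate :=
  ⟨h, fun v hv => h v fun w => by rw [← neg_eq_zero, hB.neg_eq]; exact hv w⟩

theorem iso_inj {F U V : Type*} [Field F] [AddCommGroup V] [Module F V]
    [AddCommGroup U] [Module F U] {BU : LinearMap.BilinForm F U} {B : LinearMap.BilinForm F V} (hU : BU.Nondegenerate)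
    (g : U →ₗ[F] V) (hg : ∀ a b, B (g a) (g b) = BU a b) : Function.Injective g := by
  rw [← LinearMap.ker_eq_bot, LinearMap.ker_eq_bot']
  intro u hu
  apply hU.1
  intro w
  rw [← hg, hu]; simp

section witt
variable {F U V : Type*} [Field F] [AddCommGroup V] [Module F V]
    [AddCommGroup U] [Module F U] [FiniteDimensional F U] [FiniteDimensional F V]
    {BU : LinearMap.BilinForm F U} {B : LinearMap.BilinForm F V}

theorem witt_step (hUa : BU.IsAlt) (hU : BU.Nondegenerate) (hVa : B.IsAlt) (hV : B.Nondegenerate)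
    (hd : finrank F U ≤ finrank F V) (P : Submodule F U) (f : P →ₗ[F] V)
    (hf : Function.Injective f) (hi : ∀ a b, B (f a) (f b) = BU a b) (u : U) (hu : u ∉ P) :
    ∃ v', v' ∉ LinearMap.range f ∧ ∀ p : P, B v' (f p) = BU u p := by
  obtain ⟨g, hg⟩ := LinearMap.exists_leftInverse_of_injective f (LinearMap.ker_eq_bot.2 hf)
  have hg' : ∀ p, g (f p) = p := fun p => by
    rw [← LinearMap.comp_apply, hg]; rfl
  set v0 := (B.toDual hV).symm ((BU u).comp (P.subtype.comp g)) with hv0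
  have hv0' : ∀ p : P, B v0 (f p) = BU u p := fun p => by
    rw [hv0, LinearMap.BilinForm.apply_toDual_symm_apply]
    simp [hg']
  by_contra hcon
  push Not at hcon
  have h1 : v0 ∈ LinearMap.range f := by
    by_contra h
    obtain ⟨p, hp⟩ := hcon _ h
    exact hp (hv0' p)
  have h2 : ∀ z, (∀ p, B z (f p) = 0) → z ∈ LinearMap.range f := by
    intro z hz
    by_contra h
    have : v0 + z ∉ LinearMap.range f := fun h' => h (by simpa using sub_mem h' h1)
    obtain ⟨p, hp⟩ := hcon _ this
    exact hp (by simp [hz, hv0'])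
  obtain ⟨p0, hp0⟩ := h1
  -- P^⊥ ≤ P
  have e1 := LinearMap.BilinForm.finrank_orthogonal hU P
  have e2 := LinearMap.BilinForm.finrank_orthogonal hV (LinearMap.range f)
  have e3 : finrank F (LinearMap.range f) = finrank F P := LinearMap.finrank_range_of_inj hf
  have e4 : B.orthogonal (LinearMap.range f) ≤
      ((BU.orthogonal P ⊓ P).comap P.subtype).map f := by
    intro z hz
    rw [LinearMap.BilinForm.mem_orthogonal_iff] at hz
    have hz' : ∀ p, B z (f p) = 0 := fun p => by
      rw [← neg_eq_zero, hVa.neg_eq]; exact hz _ ⟨p, rfl⟩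
    obtain ⟨p, rfl⟩ := h2 z hz'
    refine ⟨p, ⟨?_, p.2⟩, rfl⟩
    rw [SetLike.mem_coe, LinearMap.BilinForm.mem_orthogonal_iff]
    intro n hn
    have := hz' ⟨n, hn⟩
    rw [hi] at this
    show BU n p = 0
    rw [← neg_eq_zero, hUa.neg_eq]; exact this
  have e5 := Submodule.finrank_mono e4
  have e6 := Submodule.finrank_map_le f ((BU.orthogonal P ⊓ P).comap P.subtype)
  have e7 : finrank F ((BU.orthogonal P ⊓ P).comap P.subtype) = finrank F (BU.orthogonal P ⊓ P : Submodule F U) :=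
    (Submodule.comapSubtypeEquivOfLe inf_le_right).finrank_eq
  have e8 : BU.orthogonal P ⊓ P = BU.orthogonal P := by
    apply Submodule.eq_of_le_of_finrank_le inf_le_left
    omega
  have e9 : u - p0 ∈ BU.orthogonal P := by
    rw [LinearMap.BilinForm.mem_orthogonal_iff]
    intro n hn
    show BU n _ = 0
    rw [← neg_eq_zero, hUa.neg_eq]
    have := hv0' ⟨n, hn⟩
    rw [← hp0, hi] at this
    simp [this]
  rw [← e8] at e9
  exact hu (by simpa using add_mem e9.2 p0.2)

theorem witt_aux (hUa : BU.IsAlt) (hU : BU.Nondegenerate) (hVa : B.IsAlt) (hV : B.Nondegenerate)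
    (hd : finrank F U ≤ finrank F V) (n : ℕ) : ∀ (f : U →ₗ.[F] V),
    finrank F U - finrank F f.domain = n → 
    (Function.Injective f) → (∀ a b : f.domain, B (f a) (f b) = BU a b) →
    ∃ g : U →ₗ[F] V, (∀ a b, B (g a) (g b) = BU a b) ∧ ∀ p : f.domain, g p = f p := by
  induction n using Nat.strong_induction_on with
  | _ n ih =>
  intro f hn hf hi
  by_cases htop : f.domain = ⊤
  · refine ⟨f.toFun.comp (LinearMap.codRestrict f.domain LinearMap.id (fun x => by rw [htop]; trivial)), ?_, ?_⟩
    · intro a b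
      exact hi _ _
    · intro p
      rfl
  · obtain ⟨u, hu⟩ : ∃ u, u ∉ f.domain := by
      by_contra h; push Not at h
      exact htop (eq_top_iff.2 fun x _ => h x)
    obtain ⟨v', hv', hv⟩ := witt_step hUa hU hVa hV hd f.domain f.toFun hf hi u hu
    have hlt : f.domain < (f.supSpanSingleton u v' hu).domain := by
      rw [LinearPMap.domain_supSpanSingleton]
      refine lt_of_le_of_ne le_sup_left fun h => hu ?_
      rw [h]
      exact Submodule.mem_sup_right (Submodule.mem_span_singleton_self u)
    have hrep : ∀ a : (f.supSpanSingleton u v' hu).domain, ∃ p : f.domain, ∃ c : F,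
        (a : U) = p + c • u ∧ f.supSpanSingleton u v' hu a = f p + c • v' := by
      rintro ⟨a, ha⟩
      have ha' := ha
      rw [LinearPMap.domain_supSpanSingleton, Submodule.mem_sup] at ha'
      obtain ⟨p, hp, y, hy, rfl⟩ := ha'
      obtain ⟨c, rfl⟩ := Submodule.mem_span_singleton.1 hy
      exact ⟨⟨p, hp⟩, c, rfl, LinearPMap.supSpanSingleton_apply_mk f u v' hu p hp c⟩
    have hfu : ∀ p : f.domain, B (f p) v' = BU p u := fun p => by
      rw [← hVa.neg_eq, ← hUa.neg_eq]; exact congrArg _ (hv p)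
    have hvf : ∀ p : f.domain, B v' (f p) = BU u p := hv
    have lt2 := Submodule.finrank_lt_finrank_of_lt hlt
    have le3 := Submodule.finrank_le (f.supSpanSingleton u v' hu).domain
    have hinj : Function.Injective (f.supSpanSingleton u v' hu) := by
      show Function.Injective (f.supSpanSingleton u v' hu).toFun
      rw [← LinearMap.ker_eq_bot, LinearMap.ker_eq_bot']
      intro a ha
      obtain ⟨p, c, h1, h2⟩ := hrep a
      have h3 : f p + c • v' = 0 := h2.symm.trans ha
      have hc : c = 0 := by
        by_contra hc
        apply hv'
        refine ⟨-(c⁻¹ • p), ?_⟩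
        have : f p = - (c • v') := eq_neg_of_add_eq_zero_left h3
        rw [map_neg, map_smul]
        show -(c⁻¹ • f p) = v'
        rw [this]; simp [smul_smul, hc]
      subst hc
      have : p = 0 := hf (by 
        have h4 : f p = 0 := by simpa using h3
        rw [h4]; exact (map_zero f.toFun).symm)
      ext
      simp [h1, this]
    have hiso : ∀ a b, B (f.supSpanSingleton u v' hu a) (f.supSpanSingleton u v' hu b) = BU a b := by
      intro a b
      obtain ⟨p, c, h1, h2⟩ := hrep a
      obtain ⟨p', c', h1', h2'⟩ := hrep b
      rw [h1, h1', h2, h2']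
      simp [hi, hfu, hvf, hVa v', hUa u]
    obtain ⟨g, hg1, hg2⟩ := ih (finrank F U - finrank F (f.supSpanSingleton u v' hu).domain)
      (by omega) (f.supSpanSingleton u v' hu) rfl hinj hiso
    refine ⟨g, hg1, fun p => ?_⟩
    rw [← LinearPMap.supSpanSingleton_apply_mk_of_mem f v' hu p.2]
    exact hg2 ⟨p, _⟩

theorem witt (hUa : BU.IsAlt) (hU : BU.Nondegenerate) (hVa : B.IsAlt) (hV : B.Nondegenerate)
    (hd : finrank F U ≤ finrank F V) (P : Submodule F U) (f : P →ₗ[F] V)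
    (hf : Function.Injective f) (hi : ∀ a b, B (f a) (f b) = BU a b) :
    ∃ g : U →ₗ[F] V, (∀ a b, B (g a) (g b) = BU a b) ∧ ∀ p : P, g p = f p :=
  witt_aux hUa hU hVa hV hd _ ⟨P, f⟩ rfl hf hi

theorem exists_embed (hUa : BU.IsAlt) (hU : BU.Nondegenerate) (hVa : B.IsAlt) (hV : B.Nondegenerate)
    (hd : finrank F U ≤ finrank F V) : ∃ g : U →ₗ[F] V, (∀ a b, B (g a) (g b) = BU a b) := by
  obtain ⟨g, h, -⟩ := witt hUa hU hVa hV hd ⊥ 0 (fun a b _ => Subsingleton.elim _ _) (by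
    rintro ⟨a, ha⟩ ⟨b, hb⟩
    rw [Submodule.mem_bot] at ha hb
    simp [ha])
  exact ⟨g, h⟩
end witt

/-- isometry group -/
def Sp {F V : Type*} [Field F] [AddCommGroup V] [Module F V] (B : LinearMap.BilinForm F V) :
    Subgroup (V ≃ₗ[F] V) where
  carrier := {g | ∀ a b, B (g a) (g b) = B a b}
  mul_mem' := by
    intro g h hg hh a b
    rw [LinearEquiv.mul_apply, LinearEquiv.mul_apply, hg, hh]
  one_mem' := fun a b => rfl
  inv_mem' := by
    intro g hg a b
    rw [← hg (g⁻¹ a), ← LinearEquiv.mul_apply, ← LinearEquiv.mul_apply, mul_inv_cancel]; rfl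

theorem mem_Sp {F V : Type*} [Field F] [AddCommGroup V] [Module F V] {B : LinearMap.BilinForm F V}
    {g : V ≃ₗ[F] V} : g ∈ Sp B ↔ ∀ a b, B (g a) (g b) = B a b := Iff.rfl

theorem Sp_transitive {F U V : Type*} [Field F] [AddCommGroup V] [Module F V]
    [AddCommGroup U] [Module F U] [FiniteDimensional F V]
    {B : LinearMap.BilinForm F V} (hVa : B.IsAlt) (hV : B.Nondegenerate) (f g : U →ₗ[F] V)
    (hf : Function.Injective f) (hg : Function.Injective g) (h : ∀ a b, B (f a) (f b) = B (g a) (g b)) :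
    ∃ y ∈ Sp B, ∀ a, y (f a) = g a := by
  let e := LinearEquiv.ofInjective f hf
  obtain ⟨k, hk, hk2⟩ := witt hVa hV hVa hV le_rfl (LinearMap.range f) (g.comp e.symm.toLinearMap)
    (hg.comp e.symm.injective) (fun a b => by
      obtain ⟨a, rfl⟩ := e.surjective a
      obtain ⟨b, rfl⟩ := e.surjective b
      simp [e, ← h])
  refine ⟨LinearEquiv.ofInjectiveEndo k (iso_inj hV k hk), hk, fun a => ?_⟩
  have := hk2 (e a)
  simpa [e] using this

section mass
variable {F U V : Type*} [Field F] [Finite F] [AddCommGroup V] [Module F V]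
    [AddCommGroup U] [Module F U] [FiniteDimensional F V] [FiniteDimensional F U]
    {B : LinearMap.BilinForm F V}

/-- embeddings with given pullback form -/
def Emb (β : LinearMap.BilinForm F U) (B : LinearMap.BilinForm F V) : Type _ :=
  {f : U →ₗ[F] V // Function.Injective f ∧ ∀ a b, B (f a) (f b) = β a b}

/-- equivariant embeddings -/
def EEmb (β : LinearMap.BilinForm F U) (B : LinearMap.BilinForm F V) (l : U →ₗ[F] U) (y : Sp B) : Type _ :=
  {f : Emb β B // ∀ a, y.1 (f.1 a) = f.1 (l a)}

theorem finite_of_fd (F V : Type*) [Field F] [Finite F] [AddCommGroup V] [Module F V]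
    [FiniteDimensional F V] : Finite V := Module.finite_of_finite F

instance : Finite (U →ₗ[F] V) := by

  exact Module.finite_of_finite F

instance : Finite (V ≃ₗ[F] V) := 
  Finite.of_injective (fun f => (f : V →ₗ[F] V)) LinearEquiv.toLinearMap_injective

instance (β : LinearMap.BilinForm F U) : Finite (Emb β B) := Subtype.finite
instance (β : LinearMap.BilinForm F U) (l : U →ₗ[F] U) (y : Sp B) : Finite (EEmb β B l y) := Subtype.finite

theorem mass_aux (hVa : B.IsAlt) (hV : B.Nondegenerate) (β : LinearMap.BilinForm F U) (l : U ≃ₗ[F] U)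
   (hl : ∀ a b, β (l a) (l b) = β a b) [Nonempty (Emb β B)] :
    Nat.card (Σ y : Sp B, EEmb β B l.toLinearMap y) = Nat.card (Sp B) := by
  have tr : ∀ f g : Emb β B, ∃ y : Sp B, ∀ a, y.1 (f.1 a) = g.1 a := fun f g => by
    obtain ⟨y, hy, h⟩ := Sp_transitive hVa hV f.1 g.1 f.2.1 g.2.1 (fun a b => by rw [f.2.2, g.2.2])
    exact ⟨⟨y, hy⟩, h⟩
  let X := Emb β B
  let f0 : X := Classical.arbitrary _
  let tw : X → X := fun f => ⟨f.1.comp l.toLinearMap, f.2.1.comp l.injective, fun a b => by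
    simp [f.2.2, hl]⟩
  choose k hk using tr
  have hkinv : ∀ f g : X, ∀ a, (k f g)⁻¹.1 (g.1 a) = f.1 a := fun f g a => by
    rw [← hk f g]
    show ((k f g)⁻¹ * (k f g)).1 _ = _
    simp
  have mulapp : ∀ (a b : Sp B) v, (a * b).1 v = a.1 (b.1 v) := fun a b v => rfl
  -- Both are equivalent to X × Stab f0
  let S := {y : Sp B // ∀ a, y.1 (f0.1 a) = f0.1 a}
  have invS : ∀ s : S, ∀ a, (s.1⁻¹).1 (f0.1 a) = f0.1 a := fun s a => by
    conv_lhs => rw [← s.2]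
    rw [← mulapp]; simp
  let act : Sp B → X → X := fun y f => ⟨y.1.toLinearMap.comp f.1, y.1.injective.comp f.2.1,
    fun a b => by simp [y.2 _ _, f.2.2]⟩
  let e1 : Sp B ≃ X × S :=
    { toFun := fun y => (act y f0, ⟨(k f0 (act y f0))⁻¹ * y, fun a => by
        rw [mulapp]; exact hkinv f0 (act y f0) a⟩)
      invFun := fun p => k f0 p.1 * p.2.1
      left_inv := fun y => by simp
      right_inv := fun p => by
        have : act (k f0 p.1 * p.2.1) f0 = p.1 := by
          apply Subtype.ext; ext a
          show (k f0 p.1 * p.2.1).1 (f0.1 a) = _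
          rw [mulapp, p.2.2, hk]
        apply Prod.ext
        · exact this
        · apply Subtype.ext
          show (k f0 (act (k f0 p.1 * p.2.1) f0))⁻¹ * (k f0 p.1 * p.2.1) = p.2.1
          rw [this]; simp }
  let e2 : (Σ y : Sp B, EEmb β B l.toLinearMap y) ≃ X × S :=
    { toFun := fun p => (p.2.1, ⟨(k f0 (tw p.2.1))⁻¹ * p.1 * k f0 p.2.1, fun a => by
        rw [mulapp, mulapp, hk, p.2.2]; exact hkinv f0 (tw p.2.1) a⟩)
      invFun := fun p => ⟨k f0 (tw p.1) * p.2.1 * (k f0 p.1)⁻¹, p.1, fun a => by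
        rw [mulapp, mulapp, hkinv, p.2.2, hk]; rfl⟩
      left_inv := fun p => by
        obtain ⟨y, f, hf⟩ := p
        have : k f0 (tw f) * ((k f0 (tw f))⁻¹ * y * k f0 f) * (k f0 f)⁻¹ = y := by group
        exact Sigma.subtype_ext this rfl
      right_inv := fun p => by
        apply Prod.ext
        · rfl
        · apply Subtype.ext
          show (k f0 (tw p.1))⁻¹ * (k f0 (tw p.1) * p.2.1 * (k f0 p.1)⁻¹) * k f0 p.1 = p.2.1
          group }
  rw [Nat.card_congr e1, Nat.card_congr e2]

theorem mass_eq (hVa : B.IsAlt) (hV : B.Nondegenerate) (β : LinearMap.BilinForm F U) (l : U ≃ₗ[F] U)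
   (hl : ∀ a b, β (l a) (l b) = β a b) (h : Nonempty (Emb β B)) [Fintype (Sp B)] :
    ∑ y : Sp B, Nat.card (EEmb β B l.toLinearMap y) = Nat.card (Sp B) := by
  rw [← mass_aux hVa hV β l hl, Nat.card_sigma]

theorem mass_le (hVa : B.IsAlt) (hV : B.Nondegenerate) (β : LinearMap.BilinForm F U) (l : U ≃ₗ[F] U)
    [Fintype (Sp B)] :
    ∑ y : Sp B, Nat.card (EEmb β B l.toLinearMap y) ≤ Nat.card (Sp B) := by
  by_cases h : Nonempty (Emb β B) ∧ ∀ a b, β (l a) (l b) = β a b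
  · have := h.1
    exact (mass_eq hVa hV β l h.2 h.1).le
  · have : ∀ y, IsEmpty (EEmb β B l.toLinearMap y) := fun y => ⟨fun f => h ⟨⟨f.1⟩, fun a b => by
      have h1 := f.1.2.2 (l a) (l b)
      have h2 := f.2 a
      have h3 := f.2 b
      simp only [LinearEquiv.coe_coe] at h2 h3
      rw [← h1, ← h2, ← h3, y.2, f.1.2.2]⟩⟩
    simp [Nat.card_of_isEmpty]
end mass

end SpGen

namespace SpGen
open Module

theorem symp_equiv {F V : Type*} [Field F] [AddCommGroup V] [Module F V] [FiniteDimensional F V]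
    {B : LinearMap.BilinForm F V} (hVa : B.IsAlt) (hV : B.Nondegenerate) (m : ℕ)
    (hm : finrank F V = 2 * m) : Nonempty (Matrix.symplecticGroup (Fin m) F ≃* Sp B) := by
  classical
  let J := Matrix.J (Fin m) F
  let BJ : LinearMap.BilinForm F (Fin m ⊕ Fin m → F) := Matrix.toBilin' J
  have hJ : ∀ v w, BJ v w = v ⬝ᵥ (J.mulVec w) := fun v w => Matrix.toBilin'_apply' _ _ _
  have hJa : BJ.IsAlt := by
    intro v
    rw [hJ]
    simp [J, Matrix.J, dotProduct, Matrix.mulVec, Matrix.fromBlocks, Matrix.neg_apply, Matrix.one_apply, Finset.sum_ite_eq, mul_comm]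
  have hJJ : J * J = -1 := Matrix.J_squared _ _
  have hJn : BJ.Nondegenerate := by
    apply alt_nondeg hJa
    intro v hv
    have h2 : ∀ w, v ⬝ᵥ w = 0 := fun w => by
      have := hv (J.mulVec (-w))
      rw [hJ, Matrix.mulVec_mulVec, hJJ] at this
      simpa [Matrix.neg_mulVec] using this
    exact dotProduct_eq_zero v h2
  obtain ⟨g, hg⟩ := exists_embed hVa hV hJa hJn (by rw [hm]; simp [two_mul])
  let e : V ≃ₗ[F] (Fin m ⊕ Fin m → F) := LinearEquiv.ofInjectiveOfFinrankEq g (iso_inj hV g hg) (by rw [hm]; simp [two_mul])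
  have he : ∀ a b, BJ (e a) (e b) = B a b := hg
  have key : ∀ A : Matrix (Fin m ⊕ Fin m) (Fin m ⊕ Fin m) F, A ∈ Matrix.symplecticGroup (Fin m) F ↔
      ∀ v w, BJ (A.mulVec v) (A.mulVec w) = BJ v w := by
    intro A
    rw [SymplecticGroup.mem_iff']
    have : ∀ v w, BJ (A.mulVec v) (A.mulVec w) = Matrix.toBilin' (A.transpose * J * A) v w := by
      intro v w
      rw [hJ, Matrix.toBilin'_apply', Matrix.dotProduct_mulVec _ J,
        ← Matrix.mulVec_mulVec, Matrix.dotProduct_mulVec v, ← Matrix.vecMul_vecMul, Matrix.vecMul_transpose]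
    constructor
    · intro h v w
      rw [this, h]
    · intro h
      apply Matrix.toBilin'.injective
      ext v w
      simp only [LinearMap.comp_apply]
      rw [← this, h]
  have h1 : ∀ A : Matrix.symplecticGroup (Fin m) F, Matrix.toLin' A.1 ∘ₗ Matrix.toLin' (A⁻¹).1 = LinearMap.id := fun A => by
    rw [← Matrix.toLin'_mul, ← Matrix.toLin'_one]
    exact congrArg _ (congrArg Subtype.val (mul_inv_cancel A))
  have h2 : ∀ A : Matrix.symplecticGroup (Fin m) F, Matrix.toLin' (A⁻¹).1 ∘ₗ Matrix.toLin' A.1 = LinearMap.id := fun A => by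
    rw [← Matrix.toLin'_mul, ← Matrix.toLin'_one]
    exact congrArg _ (congrArg Subtype.val (inv_mul_cancel A))
  let toE : Matrix.symplecticGroup (Fin m) F →* (V ≃ₗ[F] V) :=
    { toFun := fun A => e.trans (((LinearEquiv.ofLinearMap (Matrix.toLin' A.1) (Matrix.toLin' (A⁻¹).1)
         (h1 A) (h2 A) : (Fin m ⊕ Fin m → F) ≃ₗ[F] (Fin m ⊕ Fin m → F))).trans e.symm)
      map_one' := by ext; simp
      map_mul' := by intro A A'; ext; simp }
  have hto : ∀ A v, e (toE A v) = A.1.mulVec (e v) := by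
    intro A v; simp [toE]
  refine ⟨MulEquiv.ofBijective (toE.codRestrict (Sp B) ?_) ⟨?_, ?_⟩⟩
  · intro A a b
    rw [← he, hto, hto, (key A.1).1 A.2, he]
  · intro A A' h
    apply Subtype.ext
    apply Matrix.toLin'.injective
    ext1 v
    have h1 : toE A = toE A' := congrArg Subtype.val h
    ext1
    simp only [LinearMap.comp_apply, Matrix.toLin'_apply]
    obtain ⟨u, hu⟩ := e.surjective (LinearMap.single F _ v 1)
    rw [← hu, ← hto, ← hto, h1]
  · intro y
    let A := LinearMap.toMatrix' (e.toLinearMap.comp (y.1.toLinearMap.comp e.symm.toLinearMap))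
    have hA : ∀ v, A.mulVec v = e (y.1 (e.symm v)) := by
      intro v; rw [← Matrix.toLin'_apply]; simp [A]
    refine ⟨⟨A, (key A).2 ?_⟩, ?_⟩
    · intro v w
      rw [hA, hA, he, y.2, ← he]; simp
    · apply Subtype.ext
      ext v
      apply e.injective
      show e (toE _ v) = _
      rw [hto]
      simp [hA]
end SpGen

namespace SpGen
open Module

section tv
variable {F V : Type*} [Field F] [AddCommGroup V] [Module F V] {B : LinearMap.BilinForm F V}

/-- transvection as a linear map -/
def tvL (B : LinearMap.BilinForm F V) (u : V) (a : F) : V →ₗ[F] V :=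
  LinearMap.id + a • (B.flip u).smulRight u

theorem tvL_apply (u : V) (a : F) (x : V) : tvL B u a x = x + (a * B x u) • u := by
  simp [tvL, smul_smul]

theorem tvL_comp (hB : B.IsAlt) (u : V) (a b : F) :
    (tvL B u a).comp (tvL B u b) = tvL B u (a + b) := by
  ext x
  simp only [LinearMap.comp_apply, tvL_apply, map_add, map_smul, LinearMap.add_apply,
    LinearMap.smul_apply, hB u]
  module

theorem tvL_zero (u : V) : tvL B u 0 = LinearMap.id := by
  ext x; simp [tvL_apply]

/-- transvection -/
def tv (hB : B.IsAlt) (u : V) (a : F) : V ≃ₗ[F] V :=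
  LinearEquiv.ofLinearMap (tvL B u a) (tvL B u (-a))
    (by rw [tvL_comp hB]; simp [tvL_zero]) (by rw [tvL_comp hB]; simp [tvL_zero])

theorem tv_apply (hB : B.IsAlt) (u : V) (a : F) (x : V) :
    tv hB u a x = x + (a * B x u) • u := tvL_apply u a x

theorem tv_mul (hB : B.IsAlt) (u : V) (a b : F) : tv hB u a * tv hB u b = tv hB u (a + b) := by
  ext x
  exact LinearMap.congr_fun (tvL_comp hB u a b) x

theorem tv_zero (hB : B.IsAlt) (u : V) : tv hB u 0 = 1 := by
  ext x; simp [tv_apply]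

theorem tv_inv (hB : B.IsAlt) (u : V) (a : F) : (tv hB u a)⁻¹ = tv hB u (-a) := by
  rw [inv_eq_iff_mul_eq_one, tv_mul]; simp [tv_zero]

theorem tv_smul (hB : B.IsAlt) (u : V) (a c : F) : tv hB (c • u) a = tv hB u (c ^ 2 * a) := by
  ext x; simp only [tv_apply, map_smul, smul_eq_mul]; module

theorem tv_mem (hB : B.IsAlt) (u : V) (a : F) : tv hB u a ∈ Sp B := by
  intro x y
  simp only [tv_apply, map_add, map_smul, LinearMap.add_apply, LinearMap.smul_apply, hB u, smul_eq_mul]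
  rw [← hB.neg_eq u y]
  ring

theorem tv_conj (hB : B.IsAlt) (u : V) (a : F) (g : V ≃ₗ[F] V) (hg : g ∈ Sp B) :
    g * tv hB u a * g⁻¹ = tv hB (g u) a := by
  rw [mul_inv_eq_iff_eq_mul]
  ext x
  simp only [LinearEquiv.mul_apply, tv_apply, map_add, map_smul, hg x u]

theorem tv_gen [FiniteDimensional F V] (hB : B.IsAlt) (hn : B.Nondegenerate) (H : Subgroup (V ≃ₗ[F] V))
    (hH : ∀ u a, tv hB u a ∈ H) : Sp B ≤ H := by
  -- case A
  have fixB : ∀ g ∈ Sp B, ∀ v, ∀ x, g x = x → B x (g v - v) = 0 := by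
    intro g hg v x hx
    have := hg x v
    rw [hx] at this
    simp [this]
  let K : (V ≃ₗ[F] V) → Submodule F V := fun g => LinearMap.ker (g.toLinearMap - LinearMap.id)
  have memK : ∀ g x, x ∈ K g ↔ g x = x := fun g x => by simp [K, sub_eq_zero]
  have caseA : ∀ g ∈ Sp B, ∀ v, B v (g v) ≠ 0 → ∃ t ∈ H, t ∈ Sp B ∧ K g < K (t * g) := by
    intro g hg v hv
    have hu : B v (g v - v) = B v (g v) := by simp [hB v]
    refine ⟨(tv hB (g v - v) (B v (g v))⁻¹)⁻¹, H.inv_mem (hH _ _), (Sp B).inv_mem (tv_mem hB _ _), ?_⟩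
    refine SetLike.lt_iff_le_and_exists.2 ⟨fun x hx => ?_, v, ?_, ?_⟩
    · rw [memK] at hx ⊢
      rw [LinearEquiv.mul_apply, hx, tv_inv, tv_apply, fixB g hg v x hx]; simp
    · rw [memK, LinearEquiv.mul_apply]
      have : g v = tv hB (g v - v) (B v (g v))⁻¹ v := by
        rw [tv_apply, hu, inv_mul_cancel₀ hv]; simp
      conv_lhs => rw [this]
      rw [← LinearEquiv.mul_apply, ← this]; simp
    · rw [memK]
      intro h
      rw [h] at hv
      exact hv (hB v)
  have main : ∀ n, ∀ g ∈ Sp B, finrank F V - finrank F (K g) = n → g ∈ H := by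
    intro n
    induction n using Nat.strong_induction_on with
    | _ n ih =>
    intro g hg hgn
    by_cases h1 : g = 1
    · rw [h1]; exact H.one_mem
    have fin : ∀ t ∈ H, t ∈ Sp B → K g < K (t * g) → g ∈ H := by
      intro t ht ht' hlt
      have := ih _ (by
        have := Submodule.finrank_lt_finrank_of_lt hlt
        have := Submodule.finrank_le (K (t * g))
        omega) (t * g) ((Sp B).mul_mem ht' hg) rfl
      simpa using H.mul_mem (H.inv_mem ht) this
    by_cases h2 : ∃ v, B v (g v) ≠ 0
    · obtain ⟨v, hv⟩ := h2
      obtain ⟨t, ht, ht', hlt⟩ := caseA g hg v hv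
      exact fin t ht ht' hlt
    · push Not at h2
      obtain ⟨w, hw⟩ : ∃ w, g w ≠ w := by
        by_contra h; push Not at h; exact h1 (LinearEquiv.ext h)
      set u := g w - w with hu
      have hu0 : u ≠ 0 := sub_ne_zero.2 hw
      obtain ⟨v1, hv1⟩ : ∃ v, B v u ≠ 0 := by
        by_contra h; push Not at h; exact hu0 (hn.2 u h)
      have hv2 : B (g (g⁻¹ v1)) u ≠ 0 := by
        rw [← LinearEquiv.mul_apply]; simpa using hv1
      set v2 := g⁻¹ v1
      obtain ⟨v, hva, hvb⟩ : ∃ v, B v u ≠ 0 ∧ B (g v) u ≠ 0 := by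
        by_cases c1 : B (g v1) u = 0
        · by_cases c2 : B v2 u = 0
          · exact ⟨v1 + v2, by simpa [c2] using hv1, by simpa [c1] using hv2⟩
          · exact ⟨v2, c2, hv2⟩
        · exact ⟨v1, hv1, c1⟩
      obtain ⟨t, ht, ht', hlt⟩ := caseA (tv hB u 1 * g) ((Sp B).mul_mem (tv_mem hB _ _) hg) v (by
        rw [LinearEquiv.mul_apply, tv_apply]
        simp [h2, hva, hvb])
      refine fin (t * tv hB u 1) (H.mul_mem ht (hH _ _)) ((Sp B).mul_mem ht' (tv_mem hB _ _)) ?_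
      rw [mul_assoc]
      refine lt_of_le_of_lt (fun x hx => ?_) hlt
      rw [memK] at hx ⊢
      rw [LinearEquiv.mul_apply, hx, tv_apply, fixB g hg w x hx]; simp
  intro g hg
  exact main _ g hg rfl
end tv
end SpGen

namespace SpGen
open Module

section model
variable (F : Type*) {E : Type*} [Field F] [Fintype F] [Field E] [Algebra F E]

/-- the map `x ↦ x^(q^d)` -/
noncomputable def bar (d : ℕ) : E →ₐ[F] E := (FiniteField.frobeniusAlgHom F E) ^ d

theorem bar_apply (d : ℕ) (x : E) : bar F d x = x ^ (Fintype.card F ^ d) := by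
  rw [bar, AlgHom.coe_pow, FiniteField.coe_frobeniusAlgHom, pow_iterate]

variable {F}
variable [FiniteDimensional F E] {d : ℕ}

theorem card_E (hd : finrank F E = 2 * d) : Nat.card E = Fintype.card F ^ (2 * d) := by
  rw [← hd, Module.natCard_eq_pow_finrank (K := F), Nat.card_eq_fintype_card]

theorem bar_bar (hd : finrank F E = 2 * d) (x : E) : bar F d (bar F d x) = x := by
  have := finite_of_fd F E
  have := Fintype.ofFinite E
  rw [bar_apply, bar_apply, ← pow_mul, ← pow_add, ← two_mul, ← card_E hd, Nat.card_eq_fintype_card,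
    FiniteField.pow_card]

theorem trace_bar (hd : finrank F E = 2 * d) (x : E) :
    Algebra.trace F E (bar F d x) = Algebra.trace F E x := by
  let e : E ≃ₐ[F] E := AlgEquiv.ofAlgHom (bar F d) (bar F d) (by ext; simp [bar_bar hd]) (by ext; simp [bar_bar hd])
  exact Algebra.trace_eq_of_algEquiv e x

theorem trace_nd {x : E} (h : ∀ y, Algebra.trace F E (x * y) = 0) : x = 0 := by
  have := finite_of_fd F E
  exact (traceForm_nondegenerate F E).1 x h

/-- the form -/
noncomputable def hform (d : ℕ) (γ : E) : LinearMap.BilinForm F E :=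
  LinearMap.mk₂ F (fun a b => Algebra.trace F E (γ * a * bar F d b))
    (by intros; simp [mul_add, add_mul]) (by intros; simp)
    (by intros; simp [mul_add]) (by intros; simp)

theorem hform_apply (γ a b : E) : hform (F := F) d γ a b = Algebra.trace F E (γ * a * bar F d b) := rfl

theorem two_ne (hodd : Odd (Fintype.card F)) : (2 : F) ≠ 0 := by
  intro h
  have h1 : ringChar F ∣ 2 := by
    rw [← ringChar.spec]; exact_mod_cast h
  have h2 : ringChar F = 2 := ((Nat.dvd_prime Nat.prime_two).1 h1).resolve_left (by
    exact CharP.ringChar_ne_one)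
  have := FiniteField.even_card_of_char_two h2
  rw [Nat.odd_iff] at hodd
  omega

theorem hform_alt (hd : finrank F E = 2 * d) (hodd : Odd (Fintype.card F)) {γ : E}
    (hγ : bar F d γ = -γ) : (hform (F := F) d γ).IsAlt := by
  intro a
  rw [hform_apply]
  have := trace_bar hd (γ * a * bar F d a)
  rw [map_mul (bar F d), map_mul (bar F d), bar_bar hd, hγ] at this
  have h2 : Algebra.trace F E (γ * a * bar F d a) = - Algebra.trace F E (γ * a * bar F d a) := by
    conv_lhs => rw [← this]
    rw [← map_neg]; congr 1; ring
  have h3 : (2 : F) * Algebra.trace F E (γ * a * bar F d a) = 0 := by linear_combination h2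
  exact (mul_eq_zero.1 h3).resolve_left (two_ne hodd)

theorem hform_nd (hd : finrank F E = 2 * d) (hodd : Odd (Fintype.card F)) {γ : E}
    (hγ : bar F d γ = -γ) (hγ0 : γ ≠ 0) : (hform (F := F) d γ).Nondegenerate := by
  apply alt_nondeg (hform_alt hd hodd hγ)
  intro v hv
  have : γ * v = 0 := trace_nd (F := F) fun y => by
    have := hv (bar F d y)
    rwa [hform_apply, bar_bar hd] at this
  exact (mul_eq_zero.1 this).resolve_left hγ0

theorem exists_gamma (hd : finrank F E = 2 * d) (hd1 : 1 ≤ d) : ∃ γ : E, bar F d γ = -γ ∧ γ ≠ 0 := by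
  have := finite_of_fd F E
  have h : ∃ x : E, bar F d x ≠ x := by
    by_contra h
    push Not at h
    have h1 : bar F d = (1 : E →ₐ[F] E) := AlgHom.ext h
    have h2 := FiniteField.orderOf_frobeniusAlgHom F E
    rw [hd] at h2
    have h3 := orderOf_dvd_of_pow_eq_one h1
    rw [h2] at h3
    have := Nat.le_of_dvd (by omega) h3
    omega
  obtain ⟨x, hx⟩ := h
  exact ⟨bar F d x - x, by rw [map_sub, bar_bar hd]; ring, sub_ne_zero.2 hx⟩

theorem exists_primRoot (hd : finrank F E = 2 * d) : ∃ ζ : E, IsPrimitiveRoot ζ (Fintype.card F ^ d + 1) := by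
  have := finite_of_fd F E
  obtain ⟨g, hg⟩ := IsCyclic.exists_ofOrder_eq_natCard (α := Eˣ)
  have h1 : IsPrimitiveRoot (g : E) (Nat.card Eˣ) := by
    rw [IsPrimitiveRoot.coe_units_iff, ← hg]; exact IsPrimitiveRoot.orderOf g
  have hq : 1 ≤ Fintype.card F ^ d := Nat.one_le_pow _ _ Fintype.card_pos
  have h2 : Nat.card Eˣ = (Fintype.card F ^ d - 1) * (Fintype.card F ^ d + 1) := by
    rw [Nat.card_units, card_E hd, two_mul, pow_add]
    obtain ⟨k, hk⟩ := Nat.exists_eq_add_of_le hq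
    rw [hk]; simp; ring_nf; omega
  exact ⟨_, h1.pow Nat.card_pos h2⟩

theorem T_bar {t : E} (ht : t ^ (Fintype.card F ^ d + 1) = 1) : t * bar F d t = 1 := by
  rw [bar_apply, ← pow_succ', ht]

theorem T_iff {t : E} : t ^ (Fintype.card F ^ d + 1) = 1 ↔ t * bar F d t = 1 := by
  rw [bar_apply, ← pow_succ']
end model

section eq
variable {F E : Type*} [Field F] [Fintype F] [Field E] [Algebra F E] [FiniteDimensional F E] {d : ℕ}
open Finset

/-- the torus as finset -/
noncomputable def TT (F E : Type*) [Field F] [Fintype F] [Field E] (d : ℕ) : Finset E :=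
  Polynomial.nthRootsFinset (Fintype.card F ^ d + 1) (1 : E)

theorem mem_TT {t : E} : t ∈ TT F E d ↔ t ^ (Fintype.card F ^ d + 1) = 1 := by
  rw [TT, Polynomial.mem_nthRootsFinset (by positivity)]

theorem card_TT (hd : finrank F E = 2 * d) : (TT F E d).card = Fintype.card F ^ d + 1 := by
  obtain ⟨ζ, h⟩ := exists_primRoot hd
  exact h.card_nthRootsFinset

theorem TT_ne {t : E} (ht : t ∈ TT F E d) : t ≠ 0 := by
  rintro rfl
  rw [mem_TT, zero_pow (by positivity)] at ht
  exact zero_ne_one ht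

theorem TT_mul {t s : E} (ht : t ∈ TT F E d) (hs : s ∈ TT F E d) : t * s ∈ TT F E d := by
  rw [mem_TT] at *; rw [mul_pow, ht, hs, one_mul]

theorem quad_TT {a b c e : E} (ha : a ∈ TT F E d) (hb : b ∈ TT F E d) (hc : c ∈ TT F E d)
    (he : e ∈ TT F E d) (h : a + b = c + e) : (c = a ∧ e = b) ∨ (c = b ∧ e = a) ∨ (b = -a ∧ e = -c) := by
  have ha' := TT_ne ha
  have hb' := TT_ne hb
  have hc' := TT_ne hc
  have he' := TT_ne he
  rw [mem_TT] at ha hb hc he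
  have ka := T_bar ha
  have kb := T_bar hb
  have kc := T_bar hc
  have ke := T_bar he
  have h1 := congrArg (bar F d) h
  rw [map_add, map_add] at h1
  by_cases h0 : a + b = 0
  · right; right
    exact ⟨eq_neg_of_add_eq_zero_right h0, eq_neg_of_add_eq_zero_right (h ▸ h0)⟩
  · have e1 : (a + b) = a * b * (bar F d a + bar F d b) := by linear_combination (-b) * ka - a * kb
    have e2 : (c + e) = c * e * (bar F d c + bar F d e) := by linear_combination (-e) * kc - c * ke
    have e3 : a * b = c * e := by
      rw [← h1, ← h] at e2
      have hne : (bar F d a + bar F d b) ≠ 0 := fun h' => h0 (by rw [e1, h', mul_zero])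
      exact mul_right_cancel₀ hne (by rw [← e1, ← e2])
    have e4 : (c - a) * (c - b) = 0 := by linear_combination (-c) * h + e3
    rcases mul_eq_zero.1 e4 with h' | h'
    · left
      have := sub_eq_zero.1 h'
      exact ⟨this, by linear_combination (-1) * h - this⟩
    · right; left
      have := sub_eq_zero.1 h'
      exact ⟨this, by linear_combination (-1) * h - this⟩

variable [Fintype E] [DecidableEq E]

theorem card_quad : (((TT F E d ×ˢ TT F E d) ×ˢ (TT F E d ×ˢ TT F E d)).filter
    fun p => p.1.1 + p.1.2 = p.2.1 + p.2.2).card ≤ 3 * (TT F E d).card ^ 2 := by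
  have hsub : (((TT F E d ×ˢ TT F E d) ×ˢ (TT F E d ×ˢ TT F E d)).filter
    fun p => p.1.1 + p.1.2 = p.2.1 + p.2.2) ⊆ 
      (TT F E d ×ˢ TT F E d).image (fun p => ((p.1, p.2), (p.1, p.2))) ∪
      ((TT F E d ×ˢ TT F E d).image (fun p => ((p.1, p.2), (p.2, p.1))) ∪
      (TT F E d ×ˢ TT F E d).image (fun p => ((p.1, -p.1), (p.2, -p.2)))) := by
    rintro ⟨⟨a, b⟩, c, e⟩ h
    simp only [mem_filter, mem_product] at h
    obtain ⟨⟨⟨ha, hb⟩, hc, he⟩, h⟩ := h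
    simp only [mem_union, mem_image, mem_product, Prod.mk.injEq, Prod.exists]
    rcases quad_TT ha hb hc he h with ⟨rfl, rfl⟩ | ⟨rfl, rfl⟩ | ⟨rfl, rfl⟩
    · left; exact ⟨_, _, ⟨ha, hb⟩, by simp⟩
    · right; left; exact ⟨_, _, ⟨ha, hb⟩, by simp⟩
    · right; right; exact ⟨_, _, ⟨ha, hc⟩, by simp⟩
  refine (card_le_card hsub).trans ?_
  refine (card_union_le _ _).trans ?_
  have h2 := card_union_le ((TT F E d ×ˢ TT F E d).image (fun p => ((p.1, p.2), (p.2, p.1))))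
      ((TT F E d ×ˢ TT F E d).image (fun p => ((p.1, -p.1), (p.2, -p.2))))
  have c1 := card_image_le (s := TT F E d ×ˢ TT F E d) (f := fun p => ((p.1, p.2), (p.1, p.2)))
  have c2 := card_image_le (s := TT F E d ×ˢ TT F E d) (f := fun p => ((p.1, p.2), (p.2, p.1)))
  have c3 := card_image_le (s := TT F E d ×ˢ TT F E d) (f := fun p => ((p.1, -p.1), (p.2, -p.2)))
  rw [card_product] at c1 c2 c3
  nlinarith

/-- character sum over the torus -/
noncomputable def SS (F : Type*) {E : Type*} [Field F] [Fintype F] [Field E] (d : ℕ) (ψ : AddChar E ℂ) (c : E) : ℂ := ∑ t ∈ TT F E d, ψ (c * t)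

theorem SS_bound (hd : finrank F E = 2 * d) (ψ : AddChar E ℂ) (hψ : ψ.IsPrimitive) (c : E) (hc : c ≠ 0) :
    ‖SS F d ψ c‖ ^ 4 ≤ 3 * Fintype.card E * (Fintype.card F ^ d + 1) := by
  have hconj : ∀ x, (starRingEnd ℂ) (ψ x) = ψ (-x) := fun x => by
    rw [AddChar.map_neg_eq_conj]
  have h1 : ∀ c, ((‖SS F d ψ c‖ ^ 4 : ℝ) : ℂ) = ∑ p ∈ (TT F E d ×ˢ TT F E d) ×ˢ (TT F E d ×ˢ TT F E d),
      ψ (c * (p.1.1 + p.1.2 - (p.2.1 + p.2.2))) := by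
    intro c
    have : ((‖SS F d ψ c‖ ^ 4 : ℝ) : ℂ) = (SS F d ψ c * SS F d ψ c) * 
      (starRingEnd ℂ (SS F d ψ c) * starRingEnd ℂ (SS F d ψ c)) := by
      have : SS F d ψ c * starRingEnd ℂ (SS F d ψ c) = ((‖SS F d ψ c‖ ^ 2 : ℝ) : ℂ) := by
        rw [Complex.mul_conj, Complex.normSq_eq_norm_sq]
      push_cast at this ⊢
      linear_combination (-(‖SS F d ψ c‖ ^ 2 : ℂ) - SS F d ψ c * starRingEnd ℂ (SS F d ψ c)) * this
    rw [this, SS, map_sum, sum_mul_sum, sum_mul_sum, ← sum_product', ← sum_product', sum_mul_sum,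
      ← sum_product']
    refine sum_congr rfl fun p _ => ?_
    rw [hconj, hconj, ← AddChar.map_add_eq_mul, ← AddChar.map_add_eq_mul, ← AddChar.map_add_eq_mul]
    congr 1; ring
  have h2 : ((∑ c, ‖SS F d ψ c‖ ^ 4 : ℝ) : ℂ) = Fintype.card E * (((TT F E d ×ˢ TT F E d) ×ˢ (TT F E d ×ˢ TT F E d)).filter
    fun p => p.1.1 + p.1.2 = p.2.1 + p.2.2).card := by
    rw [Complex.ofReal_sum]
    simp_rw [h1]
    rw [sum_comm]
    simp_rw [AddChar.sum_mulShift _ hψ, sub_eq_zero]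
    push_cast
    rw [← sum_filter, sum_const, nsmul_eq_mul, mul_comm]
  have h3 : (∑ c, ‖SS F d ψ c‖ ^ 4 : ℝ) ≤ Fintype.card E * (3 * (TT F E d).card ^ 2) := by
    have : (∑ c, ‖SS F d ψ c‖ ^ 4 : ℝ) = Fintype.card E * (((TT F E d ×ˢ TT F E d) ×ˢ (TT F E d ×ˢ TT F E d)).filter
        fun p => p.1.1 + p.1.2 = p.2.1 + p.2.2).card := by exact_mod_cast h2
    rw [this]
    gcongr
    exact_mod_cast card_quad
  have h4 : ∀ t ∈ TT F E d, SS F d ψ (c * t) = SS F d ψ c := by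
    intro t ht
    unfold SS
    refine sum_bij (fun s _ => t * s) (fun s hs => TT_mul ht hs) (fun s _ s' _ h => mul_left_cancel₀ (TT_ne ht) h) ?_ ?_
    · intro s hs
      refine ⟨t⁻¹ * s, ?_, ?_⟩
      · refine TT_mul ?_ hs
        rw [mem_TT] at *
        rw [inv_pow, ht, inv_one]
      · rw [mul_inv_cancel_left₀ (TT_ne ht)]
    · intro s _; rw [mul_assoc]
  have h5 : ((TT F E d).card : ℝ) * ‖SS F d ψ c‖ ^ 4 ≤ ∑ c, ‖SS F d ψ c‖ ^ 4 := by
    calc _ = ∑ t ∈ TT F E d, ‖SS F d ψ (c * t)‖ ^ 4 := by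
            rw [sum_congr rfl fun t ht => by rw [h4 t ht], sum_const, nsmul_eq_mul]
      _ = ∑ x ∈ (TT F E d).image (fun t => c * t), ‖SS F d ψ x‖ ^ 4 := by
            rw [sum_image]
            intro a _ b _ h
            exact mul_left_cancel₀ hc h
      _ ≤ _ := sum_le_univ_sum_of_nonneg fun _ => by positivity
  have h6 : (0 : ℝ) < (TT F E d).card := by rw [card_TT hd]; positivity
  have h7 : ((TT F E d).card : ℝ) = Fintype.card F ^ d + 1 := by rw [card_TT hd]; push_cast; rfl
  rw [← h7]
  refine le_of_mul_le_mul_left ?_ h6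
  calc _ ≤ _ := h5
    _ ≤ _ := h3
    _ = _ := by ring
end eq
end SpGen

namespace SpGen
open Module Finset

section eq
variable {F E : Type*} [Field F] [Fintype F] [Field E] [Algebra F E] [FiniteDimensional F E] {d : ℕ}

theorem EQ0 (hd : finrank F E = 2 * d) (hodd : Odd (Fintype.card F)) (M : Submodule F E) (a0 : E) (Z : Finset E)
    (h1 : 4 * finrank F M + 4 ≤ d) (hZ : Z.card * Fintype.card F ^ (finrank F M + 1) ≤ Fintype.card F ^ d) :
    ∃ t ∈ TT F E d, t ∉ Z ∧ ∀ c ∈ M, Algebra.trace F E (c * (t - a0)) = 0 := by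
  classical
  have := finite_of_fd F E
  have := Fintype.ofFinite E
  have : Fintype M := Fintype.ofFinite M
  set k := finrank F M with hk
  set q := Fintype.card F with hq
  have hq3 : 3 ≤ q := by
    have : 1 < q := Fintype.one_lt_card
    rcases hodd with ⟨r, hr⟩
    omega
  have hpM : (Fintype.card M) = q ^ k := by
    rw [← Nat.card_eq_fintype_card, Module.natCard_eq_pow_finrank (K := F), Nat.card_eq_fintype_card]
  -- the additive character
  obtain ⟨ψ0, hψ0⟩ : ∃ ψ : AddChar F ℂ, ψ ≠ 1 := by
    obtain ⟨ψ, hψ⟩ := AddChar.exists_apply_ne_zero (a := (1 : F)) |>.2 one_ne_zero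
    exact ⟨ψ, fun h => hψ (by rw [h]; rfl)⟩
  obtain ⟨f0, hf0⟩ : ∃ f, ψ0 f ≠ 1 := by
    by_contra h; push Not at h
    exact hψ0 (DFunLike.ext _ _ h)
  let ψ : AddChar E ℂ := ψ0.compAddMonoidHom (Algebra.trace F E).toAddMonoidHom
  have hψa : ∀ x, ψ x = ψ0 (Algebra.trace F E x) := fun x => rfl
  have hψ : ψ.IsPrimitive := by
    apply AddChar.IsPrimitive.of_ne_one
    intro h
    obtain ⟨x, hx⟩ := Algebra.trace_surjective F E f0
    apply hf0
    rw [← hx, ← hψa, h]; rfl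
  have hnorm : ∀ x, ‖ψ x‖ = 1 := fun x => AddChar.norm_apply _ _
  have ind : ∀ u : E, ∑ c : M, ψ (c * u) = if (∀ c ∈ M, Algebra.trace F E (c * u) = 0) then (q ^ k : ℂ) else 0 := by
    intro u
    split_ifs with h
    · have : ∀ c : M, ψ (c * u) = 1 := fun c => by rw [hψa, h c c.2]; simp
      simp_rw [this]
      rw [sum_const, card_univ, hpM]; simp
    · push Not at h
      obtain ⟨c, hc, hcu⟩ := h
      let lam : M →ₗ[F] F := (Algebra.trace F E).comp ((LinearMap.mulRight F u).comp M.subtype)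
      let χ : AddChar M ℂ := ψ0.compAddMonoidHom lam.toAddMonoidHom
      have hχ : χ ≠ 0 := by
        intro h0
        have : χ ((f0 / Algebra.trace F E (c * u)) • ⟨c, hc⟩) = 1 := by rw [h0]; rfl
        apply hf0
        rw [← this]
        show ψ0 _ = ψ0 (lam _)
        rw [map_smul]
        congr 1
        show _ = f0 / _ * Algebra.trace F E (c * u)
        field_simp
      have := (AddChar.sum_eq_zero_iff_ne_zero (ψ := χ)).2 hχ
      exact this
  let G := (TT F E d).filter (fun t => ∀ c ∈ M, Algebra.trace F E (c * (t - a0)) = 0)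
  have hcount : (q ^ k : ℂ) * G.card = ∑ c : M, ψ (-(c * a0)) * SS F d ψ c := by
    calc (q ^ k : ℂ) * G.card = ∑ t ∈ TT F E d, ∑ c : M, ψ (c * (t - a0)) := by
          simp_rw [ind]
          rw [← sum_filter, sum_const, nsmul_eq_mul, mul_comm]
      _ = _ := by
          rw [sum_comm]
          refine sum_congr rfl fun c _ => ?_
          rw [SS, mul_sum]
          refine sum_congr rfl fun t _ => ?_
          rw [← AddChar.map_add_eq_mul]; congr 1; ring
  -- bound
  set R : ℝ := (q : ℝ) ^ d / (2 * q ^ k) with hR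
  have hqR : (3 : ℝ) ≤ q := by exact_mod_cast hq3
  have hSR : ∀ c : E, c ≠ 0 → ‖SS F d ψ c‖ ≤ R := by
    intro c hc
    have h2 := SS_bound hd ψ hψ c hc
    have hR0 : 0 ≤ R := by positivity
    refine le_of_pow_le_pow_left₀ (n := 4) (by norm_num) hR0 (h2.trans ?_)
    have hE : (Fintype.card E : ℝ) = (q : ℝ) ^ (2 * d) := by
      have := card_E hd
      rw [Nat.card_eq_fintype_card] at this
      exact_mod_cast this
    rw [hE, hR, div_pow, mul_pow, le_div_iff₀ (by positivity)]
    have hd1 : 1 ≤ d := by omega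
    have e1 : (1 : ℝ) ≤ (q : ℝ) ^ d / 3 := by
      rw [le_div_iff₀ (by norm_num), one_mul]
      exact hqR.trans (le_self_pow₀ (by linarith) (by omega))
    have e2 : (81 : ℝ) * (q ^ k) ^ 4 ≤ q ^ d := by
      calc (81 : ℝ) * (q ^ k) ^ 4 = (3:ℝ) ^ 4 * (q:ℝ) ^ (4 * k) := by rw [← pow_mul, mul_comm k]; norm_num
        _ ≤ (q:ℝ) ^ 4 * (q:ℝ) ^ (4 * k) := by gcongr
        _ = (q:ℝ) ^ (4 + 4 * k) := by rw [pow_add]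
        _ ≤ (q:ℝ) ^ d := pow_le_pow_right₀ (by linarith) (by omega)
    have e3 : (q : ℝ) ^ (2 * d) = (q ^ d) ^ 2 := by rw [← pow_mul, mul_comm]
    rw [e3]
    set x : ℝ := (q : ℝ) ^ d
    set y : ℝ := ((q : ℝ) ^ k) ^ 4
    have hx : 0 < x := by positivity
    have hy : 0 < y := by positivity
    calc 3 * x ^ 2 * (x + 1) * (2 ^ 4 * y) ≤ 3 * x ^ 2 * (x + x / 3) * (2 ^ 4 * y) := by gcongr
      _ = x ^ 3 * (64 * y) := by ring
      _ ≤ x ^ 3 * x := by gcongr; linarith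
      _ = x ^ 4 := by ring
  have hS0 : SS F d ψ 0 = q ^ d + 1 := by
    simp only [SS, zero_mul, AddChar.map_zero_eq_one, sum_const, card_TT hd]; simp [hq]
  have hmain : (q ^ k : ℝ) * G.card ≥ q ^ d + 1 - (q ^ k - 1) * R := by
    have h0 : ∑ c : M, ψ (-(c * a0)) * SS F d ψ c = (q ^ d + 1) + ∑ c ∈ univ.erase (0 : M), ψ (-(c * a0)) * SS F d ψ c := by
      rw [← add_sum_erase _ _ (mem_univ (0 : M))]
      simp [hS0]
    have h3 : ‖∑ c ∈ univ.erase (0 : M), ψ (-(c * a0)) * SS F d ψ c‖ ≤ (q ^ k - 1) * R := by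
      refine (norm_sum_le_of_le _ (f := fun (c : M) => ψ (-(c * a0)) * SS F d ψ c) (n := fun _ => R) ?_).trans ?_
      · intro c hc
        rw [norm_mul, hnorm, one_mul]
        apply hSR
        simpa using (mem_erase.1 hc).1
      · rw [sum_const, card_erase_of_mem (mem_univ _), card_univ, hpM, nsmul_eq_mul, Nat.cast_sub (Nat.one_le_pow _ _ (by omega))]
        push_cast; rfl
    rw [h0] at hcount
    have h4 : ((q ^ d + 1 - q ^ k * G.card : ℝ) : ℂ) = - ∑ c ∈ univ.erase (0 : M), ψ (-(c * a0)) * SS F d ψ c := by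
      push_cast
      linear_combination (-1) * hcount
    have h5 : |(q ^ d + 1 - q ^ k * G.card : ℝ)| ≤ (q ^ k - 1) * R := by
      rw [← Real.norm_eq_abs, ← Complex.norm_real, h4, norm_neg]; exact h3
    have := (abs_le.1 h5).2
    linarith
  have hlt : Z.card < G.card := by
    have hZ' : (Z.card : ℝ) * (q ^ k * q) ≤ q ^ d := by rw [← pow_succ]; exact_mod_cast hZ
    have hqk : (1 : ℝ) ≤ q ^ k := one_le_pow₀ (by linarith)
    have hqkR : (q ^ k : ℝ) * R = q ^ d / 2 := by rw [hR]; field_simp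
    have hR0 : 0 ≤ R := by positivity
    have : (q ^ k : ℝ) * Z.card < q ^ k * G.card := by
      have : (0:ℝ) ≤ Z.card * q ^ k := by positivity
      nlinarith
    exact_mod_cast lt_of_mul_lt_mul_left this (by linarith)
  obtain ⟨t, ht, htZ⟩ := exists_mem_notMem_of_card_lt_card hlt
  rw [mem_filter] at ht
  exact ⟨t, ht.1, htZ, ht.2⟩

theorem EQ (hd : finrank F E = 2 * d) (hodd : Odd (Fintype.card F)) {γ : E} (hγ0 : γ ≠ 0)
    (L P Q : Submodule F E) (l : E →ₗ[F] F)
    (h1 : 4 * finrank F L + 4 ≤ d) (h2 : finrank F P + finrank F Q + finrank F L + 1 ≤ d) :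
    ∃ s : E, s ^ (Fintype.card F ^ d + 1) = 1 ∧
      (∀ a b, a * bar F d b ∈ L → hform (F := F) d γ a (s * b) = l (a * bar F d b)) ∧
      ∀ b ∈ Q, s * b ∈ P → b = 0 := by
  classical
  have := finite_of_fd F E
  have := Fintype.ofFinite E
  have : Fintype P := Fintype.ofFinite P
  have : Fintype Q := Fintype.ofFinite Q
  have hcard : ∀ X : Submodule F E, ∀ _ : Fintype X, Fintype.card X = Fintype.card F ^ finrank F X := by
    intro X _
    rw [← Nat.card_eq_fintype_card, Module.natCard_eq_pow_finrank (K := F), Nat.card_eq_fintype_card]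
  obtain ⟨a1, ha1⟩ : ∃ a1 : E, ∀ c, Algebra.trace F E (a1 * c) = l c := by
    refine ⟨((Algebra.traceForm F E).toDual (traceForm_nondegenerate F E)).symm l, fun c => ?_⟩
    exact LinearMap.BilinForm.apply_toDual_symm_apply (B := Algebra.traceForm F E) (hB := traceForm_nondegenerate F E) l c
  let Z : Finset E := (univ : Finset (P × Q)).image (fun p => (p.2 : E) / p.1)
  have hM : finrank F (L.map (LinearMap.mulLeft F γ)) = finrank F L :=
    (Submodule.equivMapOfInjective _ (mul_right_injective₀ hγ0) L).finrank_eq.symm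
  obtain ⟨t, ht, htZ, h⟩ := EQ0 hd hodd (L.map (LinearMap.mulLeft F γ)) (γ⁻¹ * a1) Z (by rw [hM]; exact h1) (by
    rw [hM]
    have : Z.card ≤ Fintype.card F ^ (finrank F P + finrank F Q) := by
      refine card_image_le.trans ?_
      rw [card_univ, Fintype.card_prod, hcard P, hcard Q, pow_add]
    calc _ ≤ Fintype.card F ^ (finrank F P + finrank F Q) * Fintype.card F ^ (finrank F L + 1) := by gcongr
      _ = Fintype.card F ^ (finrank F P + finrank F Q + (finrank F L + 1)) := by rw [← pow_add]
      _ ≤ _ := Nat.pow_le_pow_right Fintype.card_pos (by omega))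
  have ht' := mem_TT.1 ht
  have htb := T_bar ht'
  have ht0 : t ≠ 0 := TT_ne ht
  refine ⟨bar F d t, ?_, ?_, ?_⟩
  · rw [← map_pow, ht', map_one]
  · intro a b hab
    rw [hform_apply, map_mul (bar F d), bar_bar hd]
    have := h (γ * (a * bar F d b)) ⟨_, hab, rfl⟩
    rw [mul_sub, map_sub, sub_eq_zero] at this
    rw [← ha1]
    convert this using 2
    · ring
    · field_simp
  · intro b hb hb2
    by_contra hb0
    apply htZ
    have : bar F d t ≠ 0 := by intro h; rw [h, mul_zero] at htb; exact zero_ne_one htb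
    refine mem_image.2 ⟨(⟨_, hb2⟩, ⟨b, hb⟩), mem_univ _, ?_⟩
    show b / (bar F d t * b) = t
    rw [div_eq_iff (mul_ne_zero this hb0)]
    linear_combination (-b) * htb
end eq
end SpGen

namespace SpGen
open Module

theorem finrank_mul_le' {F E : Type*} [Field F] [Field E] [Algebra F E] [FiniteDimensional F E]
    (X Y : Submodule F E) : finrank F (X * Y : Submodule F E) ≤ finrank F X * finrank F Y := by
  rw [← Submodule.mulMap_range, ← finrank_tensorProduct]
  exact LinearMap.finrank_range_le _

theorem dual2 {F V : Type*} [Field F] [AddCommGroup V] [Module F V] {v w : V} (hv : v ≠ 0)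
    (hw : w ∉ Submodule.span F {v}) (a b : F) : ∃ f : V →ₗ[F] F, f v = a ∧ f w = b := by
  obtain ⟨f1, h1, h1'⟩ := Submodule.exists_le_ker_of_notMem hw
  obtain ⟨f2, h2, -⟩ := Submodule.exists_le_ker_of_notMem (p := (⊥ : Submodule F V)) (v := v) (by simpa using hv)
  have h3 : f1 v = 0 := h1' (Submodule.mem_span_singleton_self v)
  refine ⟨(a / f2 v) • f2 + ((b - (a / f2 v) * f2 w) / f1 w) • f1, ?_, ?_⟩
  · simp [h3, h2]
  · simp [h1]

/-- multiplication by a nonzero element -/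
def mulE (F : Type*) {E : Type*} [Field F] [Field E] [Algebra F E] (s : E) (hs : s ≠ 0) : E ≃ₗ[F] E :=
  LinearEquiv.ofLinearMap (LinearMap.mulLeft F s) (LinearMap.mulLeft F s⁻¹)
    (by ext; simp [hs]) (by ext; simp [hs])

theorem mulE_apply {F E : Type*} [Field F] [Field E] [Algebra F E] (s : E) (hs : s ≠ 0) (x : E) :
    mulE F s hs x = s * x := rfl

section
variable {F E : Type*} [Field F] [Fintype F] [Field E] [Algebra F E] [FiniteDimensional F E] {m : ℕ} {γ : E}

theorem T_ne {s : E} (hs : s ^ (Fintype.card F ^ m + 1) = 1) : s ≠ 0 := by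
  rintro rfl
  rw [zero_pow (by positivity)] at hs
  exact zero_ne_one hs

theorem hform_T {s : E} (hs : s ^ (Fintype.card F ^ m + 1) = 1) (a b : E) :
    hform (F := F) m γ (s * a) (s * b) = hform (F := F) m γ a b := by
  rw [hform_apply, hform_apply, map_mul (bar F m)]
  congr 1
  linear_combination (γ * a * bar F m b) * T_bar (F := F) (d := m) hs

theorem mulE_mem {s : E} (hs : s ^ (Fintype.card F ^ m + 1) = 1) : mulE F s (T_ne hs) ∈ Sp (hform (F := F) m γ) :=
  fun a b => hform_T hs a b

/-- image under bar -/
noncomputable def barS (m : ℕ) (W : Submodule F E) : Submodule F E := W.map (bar F m).toLinearMap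

theorem mem_barS {W : Submodule F E} {w : E} (hw : w ∈ W) : bar F m w ∈ barS m W := ⟨w, hw, rfl⟩

theorem finrank_barS_le (W : Submodule F E) : finrank F (barS m W) ≤ finrank F W := Submodule.finrank_map_le _ _

theorem EQs (hd : finrank F E = 2 * m) (hodd : Odd (Fintype.card F)) (hγ0 : γ ≠ 0)
    (X W P Q : Submodule F E) (l : E →ₗ[F] F)
    (h1 : 4 * (finrank F X * finrank F W) + 4 ≤ m)
    (h2 : finrank F P + finrank F Q + finrank F X * finrank F W + 1 ≤ m) :
    ∃ s : E, s ^ (Fintype.card F ^ m + 1) = 1 ∧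
      (∀ a ∈ X, ∀ b ∈ W, hform (F := F) m γ a (s * b) = l (a * bar F m b)) ∧
      ∀ b ∈ Q, s * b ∈ P → b = 0 := by
  have h3 : finrank F (X * barS m W : Submodule F E) ≤ finrank F X * finrank F W :=
    (finrank_mul_le' _ _).trans (Nat.mul_le_mul_left _ (finrank_barS_le W))
  obtain ⟨s, hs, hs1, hs2⟩ := EQ hd hodd hγ0 (X * barS m W) P Q l (by omega) (by omega)
  exact ⟨s, hs, fun a ha b hb => hs1 a b (Submodule.mul_mem_mul ha (mem_barS hb)), hs2⟩

theorem EQ2 (hd : finrank F E = 2 * m) (hodd : Odd (Fintype.card F)) (hγ0 : γ ≠ 0) (hm : 12 ≤ m)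
    {v w r : E} (hv : v ≠ 0) (hw : w ∉ Submodule.span F {v}) (hr : r ≠ 0) (a b : F) :
    ∃ s : E, s ^ (Fintype.card F ^ m + 1) = 1 ∧ hform (F := F) m γ v (s * r) = a ∧
      hform (F := F) m γ w (s * r) = b := by
  obtain ⟨f, hf1, hf2⟩ := dual2 hv hw a b
  have hX : finrank F (Submodule.span F {v, w}) ≤ 2 := by
    classical
    refine (finrank_span_le_card _).trans ?_
    rw [Set.toFinset_insert, Set.toFinset_singleton]
    exact Finset.card_le_two
  have hW : finrank F (Submodule.span F {r}) = 1 := finrank_span_singleton hr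
  have hr' : bar F m r ≠ 0 := by simpa using hr
  obtain ⟨s, hs, hs1, -⟩ := EQs hd hodd hγ0 (Submodule.span F {v, w}) (Submodule.span F {r}) ⊥ ⊥
    (f.comp (LinearMap.mulRight F (bar F m r)⁻¹)) (by rw [hW]; omega) (by rw [hW]; simp; omega)
  refine ⟨s, hs, ?_, ?_⟩
  · rw [hs1 v (Submodule.subset_span (by simp)) r (Submodule.subset_span (by simp))]
    simp [hr, hf1]
  · rw [hs1 w (Submodule.subset_span (by simp)) r (Submodule.subset_span (by simp))]
    simp [hr, hf2]

theorem EQ1 (hd : finrank F E = 2 * m) (hodd : Odd (Fintype.card F)) (hγ0 : γ ≠ 0) (hm : 12 ≤ m)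
    {v r : E} (hv : v ≠ 0) (hr : r ≠ 0) (a : F) :
    ∃ s : E, s ^ (Fintype.card F ^ m + 1) = 1 ∧ hform (F := F) m γ v (s * r) = a := by
  obtain ⟨w, hw⟩ : ∃ w, w ∉ Submodule.span F {v} := by
    by_contra h
    push Not at h
    have h1 : Submodule.span F {v} = ⊤ := eq_top_iff.2 fun x _ => h x
    have := finrank_span_singleton (K := F) hv
    rw [h1, finrank_top, hd] at this
    omega
  obtain ⟨s, hs, h1, -⟩ := EQ2 hd hodd hγ0 hm hv hw hr a 0
  exact ⟨s, hs, h1⟩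
end

section comm
variable {F V : Type*} [Field F] [AddCommGroup V] [Module F V] {B : LinearMap.BilinForm F V}

theorem tv_comm (hB : B.IsAlt) {u1 u2 u3 : V} {a σ : F} (h13 : B u1 u3 = 0) (h12 : B u1 u2 = σ)
    (h32 : B u3 u2 = σ) (G1 G2 : V ≃ₗ[F] V) (hG1 : G1 = tv hB u3 a * tv hB u1 (-a))
    (hG2 : G2 = tv hB u2 a * G1 * (tv hB u2 a)⁻¹) :
    G1 * G2 * G1⁻¹ * G2⁻¹ = tv hB (u3 - u1) (-2 * a ^ 3 * σ ^ 2) := by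
  have h31 : B u3 u1 = 0 := by rw [← hB.neg_eq, h13, neg_zero]
  have h21 : B u2 u1 = -σ := by rw [← hB.neg_eq, h12]
  have h23 : B u2 u3 = -σ := by rw [← hB.neg_eq, h32]
  have e2 : G2 = tv hB (u3 + (a * σ) • u2) a * tv hB (u1 + (a * σ) • u2) (-a) := by
    have : G2 = (tv hB u2 a * tv hB u3 a * (tv hB u2 a)⁻¹) * (tv hB u2 a * tv hB u1 (-a) * (tv hB u2 a)⁻¹) := by
      rw [hG2, hG1]; group
    rw [this, tv_conj hB _ _ _ (tv_mem hB _ _), tv_conj hB _ _ _ (tv_mem hB _ _), tv_apply, tv_apply, h12, h32]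
  rw [mul_inv_eq_iff_eq_mul, mul_inv_eq_iff_eq_mul, hG1, e2]
  ext x
  simp only [LinearEquiv.mul_apply, tv_apply, map_add, map_smul, map_sub, LinearMap.add_apply, LinearMap.smul_apply,
    LinearMap.sub_apply, smul_eq_mul, hB u1, hB u2, hB u3, h13, h12, h32, h31, h21, h23]
  module

theorem all_of_sq (hodd : (2 : F) ≠ 0) (hB : B.IsAlt) (H : Subgroup (V ≃ₗ[F] V)) {r : V} {c : F} (hc : c ≠ 0)
    (h : ∀ σ : F, tv hB r (c * σ ^ 2) ∈ H) (a : F) : tv hB r a ∈ H := by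
  have h1 := H.mul_mem (h ((a / c + 1) / 2)) (H.inv_mem (h ((a / c - 1) / 2)))
  rw [tv_inv, tv_mul] at h1
  convert h1 using 2
  field_simp
  ring
end comm

section
variable {F E : Type*} [Field F] [Fintype F] [Field E] [Algebra F E] [FiniteDimensional F E] {m : ℕ} {γ : E}

theorem gen_of_all (hd : finrank F E = 2 * m) (hodd : Odd (Fintype.card F)) (hγ0 : γ ≠ 0) (hm : 12 ≤ m)
    (hγ : bar F m γ = -γ) (H : Subgroup (E ≃ₗ[F] E))
    (hT : ∀ s : E, ∀ hs : s ^ (Fintype.card F ^ m + 1) = 1, mulE F s (T_ne hs) ∈ H) {r : E} (hr : r ≠ 0)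
    (h : ∀ a, tv (hform_alt hd hodd hγ) r a ∈ H) : Sp (hform (F := F) m γ) ≤ H := by
  have hB := hform_alt hd hodd hγ
  have hBn := hform_nd hd hodd hγ hγ0
  have h2 := two_ne hodd
  let Ω : Set E := {v | ∀ a, tv (hform_alt hd hodd hγ) v a ∈ H}
  have hsm : ∀ v ∈ Ω, ∀ c : F, c • v ∈ Ω := by
    intro v hv c a
    rw [tv_smul]; exact hv _
  have hTs : ∀ v ∈ Ω, ∀ s : E, s ^ (Fintype.card F ^ m + 1) = 1 → s * v ∈ Ω := by
    intro v hv s hs a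
    have := tv_conj (hform_alt hd hodd hγ) v a _ (mulE_mem (γ := γ) hs)
    rw [mulE_apply] at this
    rw [← this]
    exact H.mul_mem (H.mul_mem (hT s hs) (hv a)) (H.inv_mem (hT s hs))
  have hadd1 : ∀ v ∈ Ω, ∀ w ∈ Ω, hform (F := F) m γ v w ≠ 0 → v + w ∈ Ω := by
    intro v hv w hw hvw a
    have h3 := tv_conj (hform_alt hd hodd hγ) v a (tv (hform_alt hd hodd hγ) w (hform (F := F) m γ v w)⁻¹) (tv_mem _ _ _)
    rw [tv_apply, inv_mul_cancel₀ hvw, one_smul] at h3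
    rw [← h3]
    exact H.mul_mem (H.mul_mem (hw _) (hv a)) (H.inv_mem (hw _))
  have hadd : ∀ v ∈ Ω, ∀ w ∈ Ω, v + w ∈ Ω := by
    intro v hv w hw
    by_cases hvw : hform (F := F) m γ v w = 0
    swap
    · exact hadd1 v hv w hw hvw
    by_cases hv0 : v = 0
    · rw [hv0, zero_add]; exact hw
    by_cases hws : w ∈ Submodule.span F {v}
    · obtain ⟨c, rfl⟩ := Submodule.mem_span_singleton.1 hws
      have : v + c • v = (1 + c) • v := by rw [add_smul, one_smul]
      rw [this]; exact hsm v hv _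
    obtain ⟨s, hs, e1, e2⟩ := EQ2 (γ := γ) hd hodd hγ0 hm hv0 hws hr 1 1
    have hu := hTs r h s hs
    have k1 := hadd1 v hv _ hu (by rw [e1]; exact one_ne_zero)
    have k2 := hadd1 w hw _ (hsm _ hu (-1)) (by rw [map_smul, e2]; simp)
    have e3 := hadd1 _ k1 _ k2 (by
      have e2' : hform (F := F) m γ (s * r) w = -1 := by rw [← hB.neg_eq, e2]
      simp only [map_add, LinearMap.add_apply, map_smul, e1, hvw, hB (s * r), e2', smul_eq_mul]
      intro h
      apply h2
      linear_combination -h)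
    convert e3 using 1
    simp
    ring
  let Ωs : Submodule F E :=
    { carrier := Ω
      add_mem' := fun {a b} ha hb => hadd a ha b hb
      zero_mem' := by
        have := hsm r h 0
        rwa [zero_smul] at this
      smul_mem' := fun c v hv => hsm v hv c }
  have htop : Ωs = ⊤ := by
    by_contra hne
    have h4 := LinearMap.BilinForm.finrank_orthogonal hBn Ωs
    have h5 := Submodule.finrank_lt hne
    have h6 : (hform (F := F) m γ).orthogonal Ωs ≠ ⊥ := by
      intro h
      rw [h, finrank_bot] at h4
      omega
    obtain ⟨v, hv, hv0⟩ := Submodule.exists_mem_ne_zero_of_ne_bot h6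
    obtain ⟨s, hs, e1⟩ := EQ1 (γ := γ) hd hodd hγ0 hm hv0 hr 1
    rw [LinearMap.BilinForm.mem_orthogonal_iff] at hv
    have := hv (s * r) (hTs r h s hs)
    have e2 : hform (F := F) m γ (s * r) v = 0 := this
    rw [← hB.neg_eq, e1] at e2
    simp at e2
  apply tv_gen hB hBn
  intro u a
  have : u ∈ Ωs := by rw [htop]; trivial
  exact this a

theorem gen_of_tv (hd : finrank F E = 2 * m) (hodd : Odd (Fintype.card F)) (hγ0 : γ ≠ 0) (hm : 12 ≤ m)
    (hγ : bar F m γ = -γ) (H : Subgroup (E ≃ₗ[F] E))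
    (hT : ∀ s : E, ∀ hs : s ^ (Fintype.card F ^ m + 1) = 1, mulE F s (T_ne hs) ∈ H) {v : E} (hv : v ≠ 0)
    {a : F} (ha : a ≠ 0) (h : tv (hform_alt hd hodd hγ) v a ∈ H) : Sp (hform (F := F) m γ) ≤ H := by
  have hTs : ∀ s : E, s ^ (Fintype.card F ^ m + 1) = 1 → tv (hform_alt hd hodd hγ) (s * v) a ∈ H := by
    intro s hs
    have := tv_conj (hform_alt hd hodd hγ) v a _ (mulE_mem (γ := γ) hs)
    rw [mulE_apply] at this
    rw [← this]
    exact H.mul_mem (H.mul_mem (hT s hs) h) (H.inv_mem (hT s hs))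
  have hv1 := finrank_span_singleton (K := F) hv
  obtain ⟨s, hs, hs1, hs2⟩ := EQs (γ := γ) hd hodd hγ0 (Submodule.span F {v}) (Submodule.span F {v})
    (Submodule.span F {v}) (Submodule.span F {v}) 0 (by rw [hv1]; omega) (by rw [hv1]; omega)
  have hvv : v ∈ Submodule.span F {v} := Submodule.mem_span_singleton_self v
  have h13 := hs1 v hvv v hvv
  rw [LinearMap.zero_apply] at h13
  have hind : s * v ∉ Submodule.span F {v} := fun h' => hv (hs2 v hvv h')
  refine gen_of_all hd hodd hγ0 hm hγ H hT (r := s * v - v) ?_ ?_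
  · intro h0
    rw [sub_eq_zero] at h0
    rw [h0] at hind
    exact hind hvv
  · apply all_of_sq (two_ne hodd) (hform_alt hd hodd hγ) H (c := -2 * a ^ 3)
    · simp [two_ne hodd, ha]
    · intro σ
      obtain ⟨s2, hs2, k1, k2⟩ := EQ2 (γ := γ) hd hodd hγ0 hm hv hind hv σ σ
      rw [← tv_comm (hform_alt hd hodd hγ) h13 k1 k2 _ _ rfl rfl]
      have m1 : tv (hform_alt hd hodd hγ) v (-a) ∈ H := by rw [← tv_inv]; exact H.inv_mem h
      have m2 := H.mul_mem (hTs s hs) m1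
      have m3 := H.mul_mem (H.mul_mem (hTs s2 hs2) m2) (H.inv_mem (hTs s2 hs2))
      exact H.mul_mem (H.mul_mem (H.mul_mem m2 m3) (H.inv_mem m2)) (H.inv_mem m3)
end
end SpGen

namespace SpGen
open Module

theorem glue {F V : Type*} [Field F] [AddCommGroup V] [Module F V] {A B : Submodule F V} (h : Disjoint A B)
    (l1 l2 : V →ₗ[F] F) : ∃ l : V →ₗ[F] F, (∀ x ∈ A, l x = l1 x) ∧ ∀ x ∈ B, l x = l2 x := by
  obtain ⟨A', hA, hc⟩ := h.exists_isCompl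
  refine ⟨LinearMap.ofIsCompl hc (l1.comp A'.subtype) (l2.comp B.subtype), fun x hx => ?_, fun x hx => ?_⟩
  · exact LinearMap.ofIsCompl_apply_left hc ⟨x, hA hx⟩
  · exact LinearMap.ofIsCompl_apply_right hc ⟨x, hx⟩

section ec
variable {F V : Type*} [Field F] [AddCommGroup V] [Module F V] {B : LinearMap.BilinForm F V}

/-- `C - 1` -/
def Ec (C : V ≃ₗ[F] V) : V →ₗ[F] V := C.toLinearMap - LinearMap.id

theorem Ec_apply (C : V ≃ₗ[F] V) (x : V) : Ec C x = C x - x := rfl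

/-- range of `C - 1` -/
def Wc (C : V ≃ₗ[F] V) : Submodule F V := LinearMap.range (Ec C)

theorem Ec_mem (C : V ≃ₗ[F] V) (x : V) : Ec C x ∈ Wc C := ⟨x, rfl⟩

theorem alt_symm (hB : B.IsAlt) {x y : V} (h : B x y = 0) : B y x = 0 := by
  rw [← hB.neg_eq, h, neg_zero]

theorem Ec_zero (hB : B.IsAlt) (hn : B.Nondegenerate) {C : V ≃ₗ[F] V} (hC : C ∈ Sp B) {y : V}
    (h : ∀ w ∈ Wc C, B w y = 0) : Ec C y = 0 := by
  refine hn.2 _ fun z => ?_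
  obtain ⟨x, rfl⟩ : ∃ x, z = C x := ⟨C.symm z, by simp⟩
  have h1 := h _ (Ec_mem C x)
  rw [Ec_apply, map_sub, LinearMap.sub_apply, sub_eq_zero] at h1
  have h2 : B (C x) (C y) = B x y := hC x y
  rw [Ec_apply, map_sub, h2, h1, sub_self]

theorem Ec_zero_iff (hB : B.IsAlt) (hn : B.Nondegenerate) {C : V ≃ₗ[F] V} (hC : C ∈ Sp B) {y : V} :
    Ec C y = 0 ↔ ∀ w ∈ Wc C, B w y = 0 := by
  refine ⟨?_, Ec_zero hB hn hC⟩
  rintro h w ⟨z, rfl⟩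
  have h1 : C y = y := sub_eq_zero.1 h
  have := hC z y
  rw [h1] at this
  rw [Ec_apply, map_sub, LinearMap.sub_apply, this, sub_self]

theorem conj_mem {H : Subgroup (V ≃ₗ[F] V)} {s h : V ≃ₗ[F] V} (hs : s ∈ H) (hh : h ∈ H) : s * h * s⁻¹ ∈ H :=
  H.mul_mem (H.mul_mem hs hh) (H.inv_mem hs)

theorem comm_mem {H : Subgroup (V ≃ₗ[F] V)} {s h : V ≃ₗ[F] V} (hs : s ∈ H) (hh : h ∈ H) : s * h * s⁻¹ * h⁻¹ ∈ H :=
  H.mul_mem (conj_mem hs hh) (H.inv_mem hh)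

theorem Ec_conj (s h : V ≃ₗ[F] V) (x : V) : Ec (s * h * s⁻¹) x = s (Ec h (s.symm x)) := by
  simp only [Ec_apply, map_sub]
  congr 1
  exact (s.apply_symm_apply x).symm

theorem Wc_conj (s h : V ≃ₗ[F] V) : Wc (s * h * s⁻¹) = (Wc h).map s.toLinearMap := by
  ext x
  constructor
  · rintro ⟨y, rfl⟩
    rw [Ec_conj]; exact ⟨_, Ec_mem _ _, rfl⟩
  · rintro ⟨_, ⟨y, rfl⟩, rfl⟩
    refine ⟨s y, ?_⟩
    rw [Ec_conj, LinearEquiv.symm_apply_apply]; rfl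

theorem Ec_comm (C h : V ≃ₗ[F] V) (x : V) :
    Ec (C * h * C⁻¹ * h⁻¹) (h (C x)) = Ec C (Ec h x) - Ec h (Ec C x) := by
  have : (C * h * C⁻¹ * h⁻¹) (h (C x)) = C (h x) := by
    simp [LinearEquiv.mul_apply]
  rw [Ec_apply, this]
  simp only [Ec_apply, map_sub]
  abel

theorem Ec_comm_surj (C h : V ≃ₗ[F] V) {x : V} (hx : x ∈ Wc (C * h * C⁻¹ * h⁻¹)) :
    ∃ z, x = Ec C (Ec h z) - Ec h (Ec C z) := by
  obtain ⟨y, rfl⟩ := hx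
  refine ⟨C.symm (h.symm y), ?_⟩
  rw [← Ec_comm]; simp

theorem comm_formula (hB : B.IsAlt) (hn : B.Nondegenerate) {C h : V ≃ₗ[F] V} (hC : C ∈ Sp B) (hh : h ∈ Sp B)
    {X : Submodule F V} {β u e f : V} {c : F} (hW : Wc C ⊔ X = Submodule.span F {β} ⊔ X) (hu : B β u = 1)
    (hXu : ∀ x ∈ X, B x u = 0) (hXh : ∀ x ∈ X, ∀ w ∈ Wc h, B x w = 0) (hf : f = Ec h β) (hβf : B β f = 0)
    (he : e = Ec C u) (hc : c = B e u) :
    B e f = 0 ∧ e ≠ 0 ∧ ∀ x, (C * h * C⁻¹ * h⁻¹) x = x + B x f • e + B x e • f + (c * B x f) • f := by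
  have k1 : ∀ x ∈ X, Ec h x = 0 := fun x hx => Ec_zero hB hn hh fun w hw => alt_symm hB (hXh x hx w hw)
  have hfW : f ∈ Wc h := hf ▸ Ec_mem h β
  have k2 : ∀ w ∈ Wc C, Ec h w = B w u • f ∧ ∀ z ∈ Wc h, B w z = B w u * B β z := by
    intro w hw
    have : w ∈ Submodule.span F {β} ⊔ X := hW ▸ Submodule.mem_sup_left hw
    obtain ⟨b, hb, x, hx, rfl⟩ := Submodule.mem_sup.1 this
    obtain ⟨a, rfl⟩ := Submodule.mem_span_singleton.1 hb
    simp only [map_add, map_smul, k1 x hx, LinearMap.add_apply, LinearMap.smul_apply, hu, hXu x hx, ← hf, smul_eq_mul,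
      add_zero, mul_one, true_and]
    intro z hz
    rw [hXh x hx z hz, add_zero]
  have k3 : ∀ w ∈ Wc h, Ec C w = B β w • e := by
    intro w hw
    have : Ec C (w - B β w • u) = 0 := by
      apply Ec_zero hB hn hC
      intro z hz
      rw [map_sub, map_smul, (k2 z hz).2 w hw, smul_eq_mul]; ring
    rwa [map_sub, map_smul, ← he, sub_eq_zero] at this
  have heW : e ∈ Wc C := he ▸ Ec_mem C u
  have hef : B e f = 0 := by rw [(k2 e heW).2 f hfW, hβf, mul_zero]
  refine ⟨hef, ?_, ?_⟩
  · intro h0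
    have h1 := (Ec_zero_iff hB hn hC).1 (he ▸ h0 : Ec C u = 0)
    have : β ∈ Wc C ⊔ X := hW ▸ Submodule.mem_sup_left (Submodule.mem_span_singleton_self β)
    obtain ⟨b, hb, x, hx, rfl⟩ := Submodule.mem_sup.1 this
    rw [map_add, LinearMap.add_apply, h1 b hb, hXu x hx] at hu
    simp at hu
  · intro x
    obtain ⟨z, rfl⟩ : ∃ z, x = h (C z) := ⟨C.symm (h.symm x), by simp⟩
    have h1 := Ec_comm C h z
    rw [Ec_apply, sub_eq_iff_eq_add] at h1
    rw [h1, k3 _ (Ec_mem h z), (k2 _ (Ec_mem C z)).1]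
    -- B β (Ec h z) = B (h z) f
    have e1 : B β (Ec h z) = B (h z) f := by
      have t1 : B (h z) (h β) = B z β := hh z β
      have t2 : h β = β + f := by rw [hf, Ec_apply]; abel
      rw [t2, map_add] at t1
      rw [Ec_apply, map_sub, ← hB.neg_eq (h z) β, ← hB.neg_eq z β]
      linear_combination (-1) * t1
    have e2 : B (Ec C z) u = - B (C z) e := by
      have t1 : B (C z) (C u) = B z u := hC z u
      have t2 : C u = u + e := by rw [he, Ec_apply]; abel
      rw [t2, map_add] at t1
      rw [Ec_apply, map_sub, LinearMap.sub_apply]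
      linear_combination t1
    -- relate with x = h (C z)
    have e3 : h e = e + c • f := by
      have := (k2 e heW).1
      rw [Ec_apply, ← hc, sub_eq_iff_eq_add] at this
      rw [this]; abel
    have e4 : B (h (C z)) e = B (C z) e - c * B (h (C z)) f := by
      have t1 : B (h (C z)) (h e) = B (C z) e := hh _ _
      rw [e3, map_add, map_smul, smul_eq_mul] at t1
      linear_combination t1
    have e5 : B (h (C z)) f = B (h z) f := by
      have t1 : C z = z + Ec C z := by rw [Ec_apply]; abel
      have t2 : h (Ec C z) = Ec C z + B (Ec C z) u • f := by
        have := (k2 _ (Ec_mem C z)).1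
        rw [Ec_apply (C := h), sub_eq_iff_eq_add] at this
        rw [this]; abel
      rw [t1, map_add, t2, map_add, map_add, LinearMap.add_apply, LinearMap.add_apply, map_smul, LinearMap.smul_apply, hB f,
        (k2 _ (Ec_mem C z)).2 f hfW, hβf]
      simp
    rw [e1, e2, e4, e5]
    module

theorem comm_tv (hB : B.IsAlt) {D1 D2 : V ≃ₗ[F] V} {e f g : V} (hef : B e f = 0) (heg : B e g = 0)
    (h1 : ∀ x, D1 x = x + B x f • e + B x e • f) (h2 : ∀ x, D2 x = x + B x g • e + B x e • g) :
    D1 * D2 * D1⁻¹ * D2⁻¹ = tv hB e (2 * B g f) := by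
  have hfe := alt_symm hB hef
  have hge := alt_symm hB heg
  have hfg : B f g = - B g f := (hB.neg_eq g f).symm
  rw [mul_inv_eq_iff_eq_mul, mul_inv_eq_iff_eq_mul]
  ext x
  simp only [LinearEquiv.mul_apply, tv_apply, h1, h2, map_add, map_smul, LinearMap.add_apply, LinearMap.smul_apply,
    smul_eq_mul, hB e, hB f, hB g, hef, heg, hfe, hge, hfg]
  module

theorem exists_isotropic [Fintype F] (hc : Odd (Fintype.card F)) [FiniteDimensional F V] (Q : LinearMap.BilinForm F V) (W : Submodule F V)
    (hW : 3 ≤ finrank F W) : ∃ v ∈ W, v ≠ 0 ∧ Q v v = 0 := by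
  classical
  have h2 := two_ne hc
  have key : ∀ a b : V, ∃ v ∈ W, v ≠ 0 ∧ Q a v + Q v a = 0 ∧ Q b v + Q v b = 0 := by
    intro a b
    let L : W →ₗ[F] F × F := ((Q a + Q.flip a).prod (Q b + Q.flip b)).comp W.subtype
    have h1 : LinearMap.ker L ≠ ⊥ := LinearMap.ker_ne_bot_of_finrank_lt (by simp; omega)
    obtain ⟨v, hv, hv0⟩ := Submodule.exists_mem_ne_zero_of_ne_bot h1
    have h3 : L v = 0 := hv
    refine ⟨v, v.2, by simpa using hv0, congrArg Prod.fst h3, congrArg Prod.snd h3⟩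
  by_contra! hno
  obtain ⟨v1, m1, n1, -, -⟩ := key 0 0
  obtain ⟨v2, m2, n2, p2, -⟩ := key v1 v1
  obtain ⟨v3, m3, n3, p3, r3⟩ := key v1 v2
  have q1 := hno v1 m1 n1
  have q2 := hno v2 m2 n2
  have q3 := hno v3 m3 n3
  obtain ⟨x, y, hxy⟩ := FiniteField.exists_root_sum_quadratic (R := F)
    (f := Polynomial.C (Q v1 v1) * Polynomial.X ^ 2 + Polynomial.C 0 * Polynomial.X + Polynomial.C 0)
    (g := Polynomial.C (Q v2 v2) * Polynomial.X ^ 2 + Polynomial.C 0 * Polynomial.X + Polynomial.C (Q v3 v3)) (Polynomial.degree_quadratic q1)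
    (Polynomial.degree_quadratic q2) (by rw [Nat.odd_iff] at hc; exact hc)
  simp at hxy
  have hm : x • v1 + y • v2 + v3 ∈ W := W.add_mem (W.add_mem (W.smul_mem _ m1) (W.smul_mem _ m2)) m3
  have hz : x • v1 + y • v2 + v3 = 0 := by
    by_contra hne
    apply hno _ hm hne
    simp only [map_add, map_smul, LinearMap.add_apply, LinearMap.smul_apply, smul_eq_mul]
    linear_combination hxy + x * y * p2 + x * p3 + y * r3
  apply q3
  have h5 : Q (x • v1 + y • v2 + v3) v3 + Q v3 (x • v1 + y • v2 + v3) = 0 := by rw [hz]; simp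
  simp only [map_add, map_smul, LinearMap.add_apply, LinearMap.smul_apply, smul_eq_mul] at h5
  have h6 : 2 * Q v3 v3 = 0 := by linear_combination h5 - x * p3 - y * r3
  simpa [h2] using h6
end ec
end SpGen

namespace SpGen
open Module

section
variable {F E : Type*} [Field F] [Fintype F] [Field E] [Algebra F E] [FiniteDimensional F E] 

/-- standing assumptions -/
structure Ctx (m : ℕ) (γ : E) (H : Subgroup (E ≃ₗ[F] E)) (Y : Submodule F E) (N : ℕ) : Prop where
  hd : finrank F E = 2 * m
  hodd : Odd (Fintype.card F)
  hγ : bar F m γ = -γ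
  hγ0 : γ ≠ 0
  hT : ∀ s : E, ∀ hs : s ^ (Fintype.card F ^ m + 1) = 1, mulE F s (T_ne hs) ∈ H
  hYN : finrank F Y ≤ N
  hY0 : Y ≠ ⊥
  hN : 2 ≤ N
  hm : 40 * N ^ 2 + 40 ≤ m

/-- elements used for commutators -/
structure Good (m : ℕ) (γ : E) (H : Subgroup (E ≃ₗ[F] E)) (Y : Submodule F E) (h : E ≃ₗ[F] E) : Prop where
  mem : h ∈ H
  sp : h ∈ Sp (hform (F := F) m γ)
  inj : ∀ w ∈ Wc h, Ec h w = 0 → w = 0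
  le : barS m (Wc h) ≤ Y

/-- ends -/
def IsEnd (m : ℕ) (γ : E) (H : Subgroup (E ≃ₗ[F] E)) (Y : Submodule F E) (N : ℕ) (A : Submodule F E) : Prop :=
  ∃ (C : E ≃ₗ[F] E) (X : Submodule F E), C ∈ H ∧ C ∈ Sp (hform (F := F) m γ) ∧ finrank F (Wc C) ≤ 2 * N ∧
    finrank F X ≤ 2 * N ∧ finrank F A ≤ N ∧ Wc C ⊔ X = A ⊔ X ∧ Disjoint (X * Y) (A * Y)

variable {m N : ℕ} {γ : E} {H : Subgroup (E ≃ₗ[F] E)} {Y : Submodule F E}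

theorem Ctx.alt (c : Ctx m γ H Y N) : (hform (F := F) m γ).IsAlt := hform_alt c.hd c.hodd c.hγ
theorem Ctx.nd (c : Ctx m γ H Y N) : (hform (F := F) m γ).Nondegenerate := hform_nd c.hd c.hodd c.hγ c.hγ0

theorem Good.rank (c : Ctx m γ H Y N) {h : E ≃ₗ[F] E} (g : Good m γ H Y h) : finrank F (Wc h) ≤ N := by
  have : finrank F (barS m (Wc h)) = finrank F (Wc h) :=
    (Submodule.equivMapOfInjective (bar F m).toLinearMap (fun _ _ h => (bar F m).injective h) (Wc h)).finrank_eq.symm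
  rw [← this]
  exact (Submodule.finrank_mono g.le).trans c.hYN

theorem mulmono (Y : Submodule F E) {A X : Submodule F E} (h : A ≤ X) : A * Y ≤ X * Y := mul_le_mul_left h Y

theorem disj_of_mul (c : Ctx m γ H Y N) {A X : Submodule F E} (h : Disjoint (A * Y) (X * Y)) : Disjoint A X := by
  obtain ⟨y, hy, hy0⟩ := Submodule.exists_mem_ne_zero_of_ne_bot c.hY0
  rw [Submodule.disjoint_def] at h ⊢
  intro x h1 h2
  have := h _ (Submodule.mul_mem_mul h1 hy) (Submodule.mul_mem_mul h2 hy)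
  simpa [hy0] using this

/-- conjugate by multiplication by s -/
def cj (F : Type*) {E : Type*} [Field F] [Fintype F] [Field E] [Algebra F E] [FiniteDimensional F E] {m : ℕ} {s : E}
    (hs : s ^ (Fintype.card F ^ m + 1) = 1) (h : E ≃ₗ[F] E) : E ≃ₗ[F] E :=
  mulE F s (T_ne hs) * h * (mulE F s (T_ne hs))⁻¹

theorem mem_Wcj {s : E} (hs : s ^ (Fintype.card F ^ m + 1) = 1) (h : E ≃ₗ[F] E) {x : E} :
    x ∈ Wc (cj F hs h) ↔ ∃ w ∈ Wc h, s * w = x := by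
  rw [cj, Wc_conj]; rfl

theorem Good.conj_mem (c : Ctx m γ H Y N) {h : E ≃ₗ[F] E} (g : Good m γ H Y h) {s : E} (hs : s ^ (Fintype.card F ^ m + 1) = 1) :
    cj F hs h ∈ H := SpGen.conj_mem (c.hT s hs) g.mem

theorem Good.conj_sp {h : E ≃ₗ[F] E} (g : Good m γ H Y h) {s : E} (hs : s ^ (Fintype.card F ^ m + 1) = 1) :
    cj F hs h ∈ Sp (hform (F := F) m γ) := SpGen.conj_mem (mulE_mem hs) g.sp

theorem Ecj (c : Ctx m γ H Y N) {h : E ≃ₗ[F] E} (g : Good m γ H Y h) {s : E} (hs : s ^ (Fintype.card F ^ m + 1) = 1) {β v : E}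
    (hv : ∀ w ∈ Wc h, hform (F := F) m γ β (s * w) = hform (F := F) m γ v w) :
    Ec (cj F hs h) β = s * Ec h v := by
  rw [cj, Ec_conj]
  show s * _ = _
  congr 1
  rw [← sub_eq_zero, ← map_sub]
  apply Ec_zero c.alt c.nd g.sp
  intro w hw
  apply alt_symm c.alt
  rw [map_sub, LinearMap.sub_apply, ← hv w hw, sub_eq_zero, ← hform_T (γ := γ) hs]
  congr 2
  exact (mulE F s (T_ne hs)).apply_symm_apply β

theorem pick (c : Ctx m γ H Y N) {h : E ≃ₗ[F] E} (g : Good m γ H Y h) (l : E →ₗ[F] F) {X A P : Submodule F E}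
    (hX : finrank F X ≤ 2 * N) (hA : finrank F A ≤ N) (hP : finrank F P ≤ 2 * N) (hXA : Disjoint (X * Y) (A * Y)) :
    ∃ (s : E) (hs : s ^ (Fintype.card F ^ m + 1) = 1), (∀ x ∈ X, ∀ w ∈ Wc h, hform (F := F) m γ x (s * w) = 0) ∧
      (∀ x ∈ A, ∀ w ∈ Wc h, hform (F := F) m γ x (s * w) = l (x * bar F m w)) ∧
      Disjoint (P * Y) (Wc (cj F hs h) * Y) := by
  obtain ⟨l', hl1, hl2⟩ := glue hXA 0 l
  have hW := g.rank c
  have hm := c.hm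
  have r1 : finrank F (X ⊔ A : Submodule F E) ≤ 3 * N := (Submodule.finrank_add_le_finrank_add_finrank X A).trans (by omega)
  have r2 : finrank F (X ⊔ A : Submodule F E) * finrank F (Wc h) ≤ 3 * N ^ 2 :=
    (Nat.mul_le_mul r1 hW).trans (by nlinarith)
  have r3 : finrank F (P * Y : Submodule F E) ≤ 2 * N ^ 2 :=
    (finrank_mul_le' _ _).trans ((Nat.mul_le_mul hP c.hYN).trans (by nlinarith))
  have r4 : finrank F (Wc h * Y : Submodule F E) ≤ N ^ 2 :=
    (finrank_mul_le' _ _).trans ((Nat.mul_le_mul hW c.hYN).trans (by nlinarith))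
  obtain ⟨s, hs, hs1, hs2⟩ := EQs (γ := γ) c.hd c.hodd c.hγ0 (X ⊔ A) (Wc h) (P * Y) (Wc h * Y) l' (by omega) (by omega)
  refine ⟨s, hs, ?_, ?_, ?_⟩
  · intro x hx w hw
    rw [hs1 x (Submodule.mem_sup_left hx) w hw, hl1 _ (Submodule.mul_mem_mul hx (g.le (mem_barS hw)))]; rfl
  · intro x hx w hw
    rw [hs1 x (Submodule.mem_sup_right hx) w hw, hl2 _ (Submodule.mul_mem_mul hx (g.le (mem_barS hw)))]
  · have hle : (Wc (cj F hs h) * Y) ≤ (Wc h * Y).map (LinearMap.mulLeft F s) := by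
      rw [Submodule.mul_le]
      intro a ha y hy
      obtain ⟨w, hw, rfl⟩ := (mem_Wcj hs h).1 ha
      exact ⟨w * y, Submodule.mul_mem_mul hw hy, by simp [mul_assoc]⟩
    rw [Submodule.disjoint_def]
    intro x h1 h2
    obtain ⟨b, hb, rfl⟩ := hle h2
    rw [hs2 b hb h1, map_zero]

theorem step (c : Ctx m γ H Y N) {h : E ≃ₗ[F] E} (g : Good m γ H Y h) (l : E →ₗ[F] F) {A : Submodule F E}
    (hA : IsEnd m γ H Y N A) :
    ∃ (s : E) (hs : s ^ (Fintype.card F ^ m + 1) = 1),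
      (∀ x ∈ A, ∀ w ∈ Wc h, hform (F := F) m γ x (s * w) = l (x * bar F m w)) ∧
      IsEnd m γ H Y N (A.map (Ec (cj F hs h))) := by
  obtain ⟨C, X, hCH, hCS, rC, rX, rA, hCX, hdis⟩ := hA
  obtain ⟨s, hs, h1, h2, h3⟩ := pick c g l rX rA rC hdis
  refine ⟨s, hs, h2, ?_⟩
  have k1 : ∀ x ∈ X, Ec (cj F hs h) x = 0 := by
    intro x hx
    apply Ec_zero c.alt c.nd (g.conj_sp hs)
    intro w hw
    obtain ⟨w', hw', rfl⟩ := (mem_Wcj hs h).1 hw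
    exact alt_symm c.alt (h1 x hx w' hw')
  have hXb : X.map (Ec (cj F hs h)) = ⊥ := by
    rw [eq_bot_iff]
    rintro _ ⟨x, hx, rfl⟩
    rw [k1 x hx]; simp
  have hAm : A.map (Ec (cj F hs h)) = (Wc C).map (Ec (cj F hs h)) := by
    have := congrArg (Submodule.map (Ec (cj F hs h))) hCX
    rw [Submodule.map_sup, Submodule.map_sup, hXb, sup_bot_eq, sup_bot_eq] at this
    exact this.symm
  have hmle : A.map (Ec (cj F hs h)) ≤ Wc (cj F hs h) := LinearMap.map_le_range
  have rW : finrank F (Wc (cj F hs h)) ≤ N := by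
    rw [cj, Wc_conj]
    exact (Submodule.finrank_map_le _ _).trans (g.rank c)
  refine ⟨C * cj F hs h * C⁻¹ * (cj F hs h)⁻¹, Wc C, comm_mem hCH (g.conj_mem c hs), comm_mem hCS (g.conj_sp hs), ?_, rC, ?_, ?_, ?_⟩
  · have : Wc (C * cj F hs h * C⁻¹ * (cj F hs h)⁻¹) ≤ (Wc (cj F hs h)).map (Ec C) ⊔ Wc (cj F hs h) := by
      intro x hx
      obtain ⟨z, rfl⟩ := Ec_comm_surj _ _ hx
      exact Submodule.sub_mem _ (Submodule.mem_sup_left ⟨_, Ec_mem _ _, rfl⟩) (Submodule.mem_sup_right (Ec_mem _ _))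
    refine (Submodule.finrank_mono this).trans ((Submodule.finrank_add_le_finrank_add_finrank _ _).trans ?_)
    have := (Submodule.finrank_map_le (Ec C) (Wc (cj F hs h)))
    omega
  · exact (Submodule.finrank_mono hmle).trans rW
  · rw [hAm]
    apply le_antisymm
    · refine sup_le ?_ le_sup_right
      intro x hx
      obtain ⟨z, rfl⟩ := Ec_comm_surj _ _ hx
      exact Submodule.sub_mem _ (Submodule.mem_sup_right (Ec_mem _ _)) (Submodule.mem_sup_left ⟨_, Ec_mem _ _, rfl⟩)
    · refine sup_le ?_ le_sup_right
      rintro _ ⟨_, ⟨z, rfl⟩, rfl⟩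
      have : Ec (cj F hs h) (Ec C z) = Ec C (Ec (cj F hs h) z) - Ec (C * cj F hs h * C⁻¹ * (cj F hs h)⁻¹) (cj F hs h (C z)) := by
        rw [Ec_comm]; abel
      rw [this]
      exact Submodule.sub_mem _ (Submodule.mem_sup_right (Ec_mem _ _)) (Submodule.mem_sup_left (Ec_mem _ _))
  · exact h3.mono_right (mulmono Y hmle)

theorem end_of_good (c : Ctx m γ H Y N) {h : E ≃ₗ[F] E} (g : Good m γ H Y h) : IsEnd m γ H Y N (Wc h) := by
  have := g.rank c
  exact ⟨h, ⊥, g.mem, g.sp, by omega, by simp, this, rfl, by simp⟩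

theorem exists_u (c : Ctx m γ H Y N) {X : Submodule F E} {β : E} (h : β ∉ X) :
    ∃ u, hform (F := F) m γ β u = 1 ∧ ∀ x ∈ X, hform (F := F) m γ x u = 0 := by
  obtain ⟨f, h1, h2⟩ := Submodule.exists_le_ker_of_notMem h
  let u := ((hform (F := F) m γ).toDual c.nd).symm ((f β)⁻¹ • f)
  have hu : ∀ x, hform (F := F) m γ u x = ((f β)⁻¹ • f) x :=
    fun x => LinearMap.BilinForm.apply_toDual_symm_apply (B := hform (F := F) m γ) (hB := c.nd) _ x
  refine ⟨-u, ?_, fun x hx => ?_⟩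
  · rw [map_neg, c.alt.neg_eq, hu]; simp [h1]
  · rw [map_neg, c.alt.neg_eq, hu]
    have : f x = 0 := h2 hx
    simp [this]

/-- one round of the rank one case -/
theorem round1 (c : Ctx m γ H Y N) {h : E ≃ₗ[F] E} (g : Good m γ H Y h) {C : E ≃ₗ[F] E} {X : Submodule F E}
    (hCS : C ∈ Sp (hform (F := F) m γ)) {s : E} {β u v : E} (hs : s ^ (Fintype.card F ^ m + 1) = 1)
    (hCX : Wc C ⊔ X = Submodule.span F {β} ⊔ X)
    (hu : hform (F := F) m γ β u = 1) (hXu : ∀ x ∈ X, hform (F := F) m γ x u = 0)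
    (hv : hform (F := F) m γ v (h v) = 0)
    (h1 : ∀ x ∈ X, ∀ w ∈ Wc h, hform (F := F) m γ x (s * w) = 0)
    (h2 : ∀ w ∈ Wc h, hform (F := F) m γ β (s * w) = hform (F := F) m γ v w) :
    hform (F := F) m γ (Ec C u) (s * Ec h v) = 0 ∧ Ec C u ≠ 0 ∧ ∀ x, (C * cj F hs h * C⁻¹ * (cj F hs h)⁻¹) x =
      x + hform (F := F) m γ x (s * Ec h v) • Ec C u + hform (F := F) m γ x (Ec C u) • (s * Ec h v)
        + (hform (F := F) m γ (Ec C u) u * hform (F := F) m γ x (s * Ec h v)) • (s * Ec h v) := by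
  refine comm_formula c.alt c.nd hCS (g.conj_sp hs) hCX hu hXu ?_ (Ecj c g hs h2).symm ?_ rfl rfl
  · intro x hx w hw
    obtain ⟨w', hw', rfl⟩ := (mem_Wcj hs h).1 hw
    exact h1 x hx w' hw'
  · rw [h2 _ (Ec_mem h v), Ec_apply, map_sub, hv, c.alt v, sub_zero]

theorem rank_one (c : Ctx m γ H Y N) {h : E ≃ₗ[F] E} (g : Good m γ H Y h) (h3 : 3 ≤ finrank F (Wc h)) {β : E} (hβ : β ≠ 0)
    (hA : IsEnd m γ H Y N (Submodule.span F {β})) : Sp (hform (F := F) m γ) ≤ H := by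
  obtain ⟨C, X, hCH, hCS, rC, rX, rA, hCX, hdis⟩ := hA
  have hN := c.hN
  have sl : ∀ z : E, finrank F (Submodule.span F {z}) ≤ 1 := fun z => (finrank_span_le_card _).trans (by simp)
  have ss : ∀ z : E, z ∈ Submodule.span F {z} := Submodule.mem_span_singleton_self
  obtain ⟨v, hvW, hv0, hv⟩ := exists_isotropic c.hodd ((hform (F := F) m γ).compRight h.toLinearMap) (Wc h) h3
  have hv : hform (F := F) m γ v (h v) = 0 := hv
  have hr0 : Ec h v ≠ 0 := fun h0 => hv0 (g.inj v hvW h0)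
  -- functional
  have hl : ∀ b : E, b ≠ 0 → ∃ l : E →ₗ[F] F, ∀ w, l (b * bar F m w) = hform (F := F) m γ v w := by
    intro b hb
    refine ⟨(Algebra.trace F E).comp (LinearMap.mulLeft F (γ * v * b⁻¹)), fun w => ?_⟩
    rw [hform_apply]
    show Algebra.trace F E (γ * v * b⁻¹ * (b * bar F m w)) = _
    congr 1
    field_simp
  have notin : ∀ {z : E} {Z : Submodule F E}, z ≠ 0 → Disjoint Z (Submodule.span F {z}) → z ∉ Z := by
    intro z Z hz hd hzZ
    exact hz (Submodule.disjoint_def.1 hd z hzZ (ss z))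
  obtain ⟨u, hu, hXu⟩ := exists_u c (notin hβ (disj_of_mul c hdis))
  obtain ⟨l, hlb⟩ := hl β hβ
  obtain ⟨s, hs, p1, p2, p3⟩ := pick c g l rX rA rC hdis
  obtain ⟨hef, he0, hD⟩ := round1 c g hCS hs hCX hu hXu hv p1 (fun w hw => by rw [p2 β (ss β) w hw, hlb])
  set f := s * Ec h v with hf
  set e := Ec C u with he
  set D := C * cj F hs h * C⁻¹ * (cj F hs h)⁻¹ with hDd
  have hf0 : f ≠ 0 := mul_ne_zero (T_ne hs) hr0
  have hDH : D ∈ H := comm_mem hCH (g.conj_mem c hs)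
  have hDS : D ∈ Sp (hform (F := F) m γ) := comm_mem hCS (g.conj_sp hs)
  have hfW : f ∈ Wc (cj F hs h) := (mem_Wcj hs h).2 ⟨_, Ec_mem h v, rfl⟩
  have dfe : Disjoint (Submodule.span F {f} * Y) (Submodule.span F {e} * Y) := by
    refine (p3.mono (mulmono Y ?_) (mulmono Y ?_)).symm
    · rw [Submodule.span_singleton_le_iff_mem]; exact Ec_mem _ _
    · rw [Submodule.span_singleton_le_iff_mem]; exact hfW
  have hfe0 := alt_symm c.alt hef
  obtain ⟨u', hu', hXu'⟩ := exists_u c (notin he0 (disj_of_mul c dfe))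
  have hfu' := hXu' f (ss f)
  have hDX : Wc D ⊔ Submodule.span F {f} = Submodule.span F {e} ⊔ Submodule.span F {f} := by
    apply le_antisymm
    · refine sup_le ?_ le_sup_right
      rintro _ ⟨x, rfl⟩
      rw [Ec_apply, hD]
      have : x + hform (F := F) m γ x f • e + hform (F := F) m γ x e • f + (hform (F := F) m γ e u * hform (F := F) m γ x f) • f - x
        = hform (F := F) m γ x f • e + (hform (F := F) m γ x e + (hform (F := F) m γ e u * hform (F := F) m γ x f)) • f := by module
      rw [this]
      exact Submodule.add_mem _ (Submodule.mem_sup_left (Submodule.smul_mem _ _ (ss e))) (Submodule.mem_sup_right (Submodule.smul_mem _ _ (ss f)))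
    · refine sup_le ?_ le_sup_right
      rw [Submodule.span_singleton_le_iff_mem]
      obtain ⟨x, hx, -⟩ := exists_u c (X := ⊥) (β := f) (by simpa using hf0)
      have hx' : hform (F := F) m γ x f = -1 := by rw [← c.alt.neg_eq, hx]
      have hm := Ec_mem D x
      rw [Ec_apply, hD, hx'] at hm
      have : e = -(x + (-1 : F) • e + hform (F := F) m γ x e • f + (hform (F := F) m γ e u * (-1 : F)) • f - x)
        + (hform (F := F) m γ x e - hform (F := F) m γ e u) • f := by module
      rw [this]
      exact Submodule.add_mem _ (Submodule.mem_sup_left (Submodule.neg_mem _ hm)) (Submodule.mem_sup_right (Submodule.smul_mem _ _ (ss f)))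
  have he' : Ec D u' = -f := by
    have h5 : hform (F := F) m γ u' e = -1 := by rw [← c.alt.neg_eq, hu']
    rw [Ec_apply, hD, alt_symm c.alt hfu', h5]
    module
  -- second round, first copy
  obtain ⟨l1, hl1⟩ := hl e he0
  obtain ⟨s1, hs1, a1, a2, a3⟩ := pick c g l1 (X := Submodule.span F {f}) (A := Submodule.span F {e})
    (P := Submodule.span F {f} ⊔ Submodule.span F {e}) ((sl f).trans (by omega)) ((sl e).trans (by omega))
    ((Submodule.finrank_add_le_finrank_add_finrank _ _).trans (by have := sl f; have := sl e; omega)) dfe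
  obtain ⟨b1, -, b3⟩ := round1 c g hDS hs1 hDX hu' hXu' hv a1 (fun w hw => by rw [a2 e (ss e) w hw, hl1])
  -- second copy
  set f1 := s1 * Ec h v with hf1
  have hf10 : f1 ≠ 0 := mul_ne_zero (T_ne hs1) hr0
  have hf1W : Submodule.span F {f1} ≤ Wc (cj F hs1 h) := by
    rw [Submodule.span_singleton_le_iff_mem]
    exact (mem_Wcj hs1 h).2 ⟨_, Ec_mem h v, rfl⟩
  have a3' := a3.mono_right (mulmono Y hf1W)
  rw [Submodule.sup_mul] at a3'
  have d1 : Disjoint (Submodule.span F {f} * Y) ((Submodule.span F {e} ⊔ Submodule.span F {f1}) * Y) := by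
    rw [Submodule.sup_mul]
    exact dfe.disjoint_sup_right_of_disjoint_sup_left a3'
  have d2 : Disjoint (Submodule.span F {e} * Y) (Submodule.span F {f1} * Y) := a3'.mono_left le_sup_right
  obtain ⟨l3, hl3, -⟩ := Submodule.exists_le_ker_of_notMem (p := (⊥ : Submodule F E)) (v := f1 * bar F m (Ec h v)) (by
    simp [hf10, hr0])
  obtain ⟨l2, hl2, hl2'⟩ := glue d2 l1 l3
  obtain ⟨s2, hs2, q1, q2, -⟩ := pick c g l2 (X := Submodule.span F {f}) (A := Submodule.span F {e} ⊔ Submodule.span F {f1})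
    (P := ⊥) ((sl f).trans (by omega))
    ((Submodule.finrank_add_le_finrank_add_finrank _ _).trans (by have := sl f1; have := sl e; omega)) (by simp) d1
  obtain ⟨c1, -, c3⟩ := round1 c g hDS hs2 hDX hu' hXu' hv q1 (fun w hw => by
    rw [q2 e (Submodule.mem_sup_left (ss e)) w hw, hl2 _ (Submodule.mul_mem_mul (ss e) (g.le (mem_barS hw))), hl1])
  have hBf : hform (F := F) m γ f1 (s2 * Ec h v) ≠ 0 := by
    rw [q2 f1 (Submodule.mem_sup_right (ss f1)) _ (Ec_mem h v), hl2' _ (Submodule.mul_mem_mul (ss f1) (g.le (mem_barS (Ec_mem h v))))]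
    exact hl3
  have hc0 : hform (F := F) m γ (Ec D u') u' = 0 := by rw [he', map_neg, LinearMap.neg_apply, hfu', neg_zero]
  simp only [hc0, zero_mul, zero_smul, add_zero] at b3 c3
  have htv := comm_tv c.alt b1 c1 b3 c3
  have hm := c.hm
  refine gen_of_tv c.hd c.hodd c.hγ0 (by omega) c.hγ H c.hT (v := Ec D u') (a := 2 * hform (F := F) m γ (s2 * Ec h v) f1) ?_ ?_ ?_
  · rw [he']; exact neg_ne_zero.2 hf0
  · refine mul_ne_zero (two_ne c.hodd) ?_
    rw [← c.alt.neg_eq]; exact neg_ne_zero.2 hBf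
  · rw [← htv]
    exact comm_mem (comm_mem hDH (g.conj_mem c hs1)) (comm_mem hDH (g.conj_mem c hs2))
end
end SpGen

namespace SpGen
open Module IntermediateField

section
variable {F E : Type*} [Field F] [Fintype F] [Field E] [Algebra F E] [FiniteDimensional F E] 

theorem fixed_card (k : ℕ) (hk : 1 ≤ k) (S : Finset E) (hS : ∀ x ∈ S, bar F k x = x) : S.card ≤ Fintype.card F ^ k := by
  classical
  have hq : 1 < Fintype.card F ^ k := Nat.one_lt_pow (by omega) Fintype.one_lt_card
  have h0 : (Polynomial.X ^ (Fintype.card F ^ k) - Polynomial.X : Polynomial E) ≠ 0 := FiniteField.X_pow_card_sub_X_ne_zero E hq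
  rw [← FiniteField.X_pow_card_sub_X_natDegree_eq E hq]
  refine le_trans ?_ (Polynomial.card_roots' _)
  refine le_trans (Finset.card_le_card fun x hx => ?_) (Multiset.toFinset_card_le _)
  rw [Multiset.mem_toFinset, Polynomial.mem_roots h0]
  have := hS x hx
  rw [bar_apply] at this
  simp [this]

theorem fixed_mem {x : E} (hx : bar F 1 x = x) : ∃ a : F, algebraMap F E a = x := by
  classical
  by_contra! h
  have := fixed_card (F := F) 1 le_rfl (insert x (Finset.univ.image (algebraMap F E))) (by
    intro y hy
    rw [Finset.mem_insert, Finset.mem_image] at hy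
    rcases hy with rfl | ⟨a, -, rfl⟩
    · exact hx
    · exact (bar F 1).commutes a)
  rw [Finset.card_insert_of_notMem (by simpa using h), Finset.card_image_of_injective _ (algebraMap F E).injective, Finset.card_univ] at this
  simp at this

theorem dvd_of_stab {κ : E} {W : Submodule F E} (h : ∀ w ∈ W, κ * w ∈ W) : finrank F F⟮κ⟯ ∣ finrank F W := by
  have key : ∀ x ∈ F⟮κ⟯, ∀ w ∈ W, x * w ∈ W := by
    intro x hx
    have hx' : x ∈ (Algebra.adjoin F {κ}) := by
      rw [← IntermediateField.adjoin_simple_toSubalgebra_of_isAlgebraic (Algebra.IsAlgebraic.isAlgebraic κ)]; exact hx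
    clear hx
    induction hx' using Algebra.adjoin_induction with
    | mem x hx => rw [Set.mem_singleton_iff.1 hx]; exact h
    | algebraMap r => intro w hw; rw [← Algebra.smul_def]; exact W.smul_mem _ hw
    | add x y _ _ h1 h2 => intro w hw; rw [add_mul]; exact W.add_mem (h1 w hw) (h2 w hw)
    | mul x y _ _ h1 h2 => intro w hw; rw [mul_assoc]; exact h1 _ (h2 w hw)
  let W' : Submodule F⟮κ⟯ E :=
    { carrier := W
      add_mem' := fun ha hb => W.add_mem ha hb
      zero_mem' := W.zero_mem
      smul_mem' := fun c w hw => key c c.2 w hw }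
  have h1 := Module.finrank_mul_finrank F F⟮κ⟯ W'
  have h2 : finrank F W' = finrank F W := rfl
  rw [← h2, ← h1]
  exact Dvd.intro _ rfl

variable {m N : ℕ} {γ : E} {H : Subgroup (E ≃ₗ[F] E)} {Y : Submodule F E}

theorem min_stab (c : Ctx m γ H Y N) {h : E ≃ₗ[F] E} (g : Good m γ H Y h) {A : Submodule F E} (hA : IsEnd m γ H Y N A)
    (hmin : ∀ A', IsEnd m γ H Y N A' → A' ≠ ⊥ → finrank F A ≤ finrank F A') {β β1 : E} (hβ : β ∈ A) (hβ0 : β ≠ 0) (hβ1 : β1 ∈ A)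
    {w : E} (hw : w ∈ barS m (Wc h)) : β1 / β * w ∈ barS m (Wc h) := by
  obtain ⟨w, hw, rfl⟩ := hw
  change w ∈ Wc h at hw
  change β1 / β * bar F m w ∈ _
  by_contra hne
  let S := (barS m (Wc h)).map (LinearMap.mulLeft F β)
  have hS : β1 * bar F m w ∉ S := by
    rintro ⟨z, hz, hz2⟩
    apply hne
    have hz2 : β * z = β1 * bar F m w := hz2
    have : β1 / β * bar F m w = z := by field_simp; exact hz2.symm
    rw [this]; exact hz
  obtain ⟨l, hl1, hl2⟩ := Submodule.exists_le_ker_of_notMem hS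
  obtain ⟨s, hs, h1, h2⟩ := step c g l hA
  have e1 : Ec (cj F hs h) β = 0 := by
    apply Ec_zero c.alt c.nd (g.conj_sp hs)
    intro w'' hw''
    obtain ⟨w', hw', rfl⟩ := (mem_Wcj hs h).1 hw''
    apply alt_symm c.alt
    rw [h1 β hβ w' hw']
    exact hl2 ⟨_, mem_barS hw', rfl⟩
  have e2 : Ec (cj F hs h) β1 ≠ 0 := by
    intro h0
    rw [Ec_zero_iff c.alt c.nd (g.conj_sp hs)] at h0
    have := alt_symm c.alt (h0 (s * w) ((mem_Wcj hs h).2 ⟨w, hw, rfl⟩))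
    rw [h1 β1 hβ1 w hw] at this
    exact hl1 this
  have h3 := hmin _ h2 (by
    intro hb
    apply e2
    have : Ec (cj F hs h) β1 ∈ A.map (Ec (cj F hs h)) := ⟨_, hβ1, rfl⟩
    rw [hb] at this
    simpa using this)
  have h4 : finrank F (A.map (Ec (cj F hs h))) < finrank F A := by
    have := LinearMap.finrank_range_add_finrank_ker ((Ec (cj F hs h)).domRestrict A)
    rw [LinearMap.range_domRestrict] at this
    have h5 : LinearMap.ker ((Ec (cj F hs h)).domRestrict A) ≠ ⊥ := by
      intro hb
      have : (⟨β, hβ⟩ : A) ∈ LinearMap.ker ((Ec (cj F hs h)).domRestrict A) := e1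
      rw [hb] at this
      simp [hβ0] at this
    have := Submodule.one_le_finrank_iff.2 h5
    omega
  omega

theorem dvd_two {k : ℕ} (hk : 0 < k) (hm : k ∣ 2 * m) {D : ℕ → Prop} (hD : ∀ d, D d → k ∣ 2 * d)
    (h1 : ∀ p, p.Prime → p ≠ 2 → p ∣ m → ∃ d, D d ∧ ¬ p ∣ d) (h2 : ∃ d, D d ∧ d % 2 ≠ m % 2) : k ∣ 2 := by
  rcases Nat.eq_two_pow_or_exists_odd_prime_and_dvd k with ⟨a, ha⟩ | ⟨p, hp, hpk, hpo⟩
  · rcases Nat.lt_or_ge a 2 with h | h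
    · rw [ha]
      exact pow_dvd_pow 2 (show a ≤ 1 by omega)
    · exfalso
      obtain ⟨d, hd, hdm⟩ := h2
      have h4 : 4 ∣ k := by rw [ha]; exact pow_dvd_pow 2 h
      have := h4.trans hm
      have := h4.trans (hD d hd)
      omega
  · exfalso
    have hp2 : p ≠ 2 := by rintro rfl; exact absurd hpo (by decide)
    have hc : Nat.Coprime p 2 := (Nat.coprime_primes hp Nat.prime_two).2 hp2
    obtain ⟨d, hd, hpd⟩ := h1 p hp hp2 (hc.dvd_of_dvd_mul_left (hpk.trans hm))
    exact hpd (hc.dvd_of_dvd_mul_left (hpk.trans (hD d hd)))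

/-- the theta lemma or done -/
theorem theta_lem (c : Ctx m γ H Y N) {h0 : E ≃ₗ[F] E} (g0 : Good m γ H Y h0) (h3 : 3 ≤ finrank F (Wc h0))
    (h1 : ∀ p, p.Prime → p ≠ 2 → p ∣ m → ∃ d, (∃ h, Good m γ H Y h ∧ finrank F (Wc h) = 2 * d) ∧ ¬ p ∣ d)
    (h2 : ∃ d, (∃ h, Good m γ H Y h ∧ finrank F (Wc h) = 2 * d) ∧ d % 2 ≠ m % 2)
    (hH : ¬ Sp (hform (F := F) m γ) ≤ H) :
    ∃ θ : E, θ ≠ 0 ∧ bar F 1 θ = -θ ∧ (∀ h, Good m γ H Y h → ∀ w ∈ Wc h, θ * w ∈ Wc h) ∧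
      ∀ h, Good m γ H Y h → ∀ v, Ec h v ≠ 0 → ∃ x, bar F 2 x = x ∧ Ec h (θ * v) = x * Ec h v := by
  have ex : ∃ n, ∃ A, IsEnd m γ H Y N A ∧ A ≠ ⊥ ∧ finrank F A = n := by
    refine ⟨_, _, end_of_good c g0, ?_, rfl⟩
    intro hb
    rw [hb, finrank_bot] at h3
    omega
  classical
  obtain ⟨A, hA, hA0, hAn⟩ := Nat.find_spec ex
  have hmin' : ∀ A', IsEnd m γ H Y N A' → A' ≠ ⊥ → finrank F A ≤ finrank F A' := by
    intro A' h1 h2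
    rw [hAn]
    exact Nat.find_min' ex ⟨A', h1, h2, rfl⟩
  -- ratios
  have ratio : ∀ A', IsEnd m γ H Y N A' → finrank F A' ≤ finrank F A → ∀ β ∈ A', β ≠ 0 → ∀ β1 ∈ A', bar F 2 (β1 / β) = β1 / β := by
    intro A' hA' hle β hβ hβ0 β1 hβ1
    have hst := fun h (g : Good m γ H Y h) => dvd_of_stab (fun w hw => min_stab c g hA'
      (fun A'' q1 q2 => hle.trans (hmin' A'' q1 q2)) hβ hβ0 hβ1 (w := w) hw)
    have hk : finrank F F⟮β1 / β⟯ ∣ 2 := by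
      refine dvd_two finrank_pos ?_ (D := fun d => ∃ h, Good m γ H Y h ∧ finrank F (Wc h) = 2 * d) ?_ h1 h2
      · rw [← c.hd]
        exact Dvd.intro _ (Module.finrank_mul_finrank F F⟮β1 / β⟯ E)
      · rintro d ⟨h, g, hr⟩
        rw [← hr]
        have : finrank F (barS m (Wc h)) = finrank F (Wc h) :=
          (Submodule.equivMapOfInjective (bar F m).toLinearMap (fun _ _ h => (bar F m).injective h) (Wc h)).finrank_eq.symm
        rw [← this]
        exact hst h g
    have : Finite F⟮β1 / β⟯ := finite_of_fd F _
    have := Fintype.ofFinite F⟮β1 / β⟯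
    have hcard : Fintype.card F⟮β1 / β⟯ = Fintype.card F ^ finrank F F⟮β1 / β⟯ := Module.card_eq_pow_finrank
    have hp := FiniteField.pow_card (AdjoinSimple.gen F (β1 / β))
    have hp2 := congrArg (algebraMap F⟮β1 / β⟯ E) hp
    rw [map_pow, AdjoinSimple.algebraMap_gen, hcard, ← bar_apply] at hp2
    obtain ⟨j, hj⟩ := hk
    rcases (Nat.dvd_prime Nat.prime_two).1 ⟨j, hj⟩ with h | h
    · rw [h] at hp2
      have : bar F 2 (β1 / β) = bar F 1 (bar F 1 (β1 / β)) := rfl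
      rw [this, hp2, hp2]
    · rw [h] at hp2; exact hp2
  obtain ⟨β, hβ, hβ0⟩ := Submodule.exists_mem_ne_zero_of_ne_bot hA0
  have hβ1 : ∃ β1 ∈ A, ∀ a, algebraMap F E a ≠ β1 / β := by
    by_contra! hno
    apply hH
    refine rank_one c g0 h3 hβ0 ?_
    convert hA
    apply le_antisymm
    · rw [Submodule.span_singleton_le_iff_mem]; exact hβ
    · intro x hx
      obtain ⟨a, ha⟩ := hno x hx
      rw [Submodule.mem_span_singleton]
      refine ⟨a, ?_⟩
      rw [Algebra.smul_def, ha]; field_simp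
  obtain ⟨β1, hβ1, hκF⟩ := hβ1
  set κ := β1 / β with hκ
  have hκ2 : bar F 1 (bar F 1 κ) = κ := ratio A hA le_rfl β hβ hβ0 β1 hβ1
  have h20 : (2 : E) ≠ 0 := by
    have := (map_ne_zero (algebraMap F E)).2 (two_ne c.hodd)
    rwa [map_ofNat] at this
  obtain ⟨a, ha⟩ := fixed_mem (F := F) (x := (κ + bar F 1 κ) / 2) (by
    rw [map_div₀, map_add, hκ2, map_ofNat]; ring)
  refine ⟨κ - algebraMap F E a, fun h => hκF a (sub_eq_zero.1 h).symm, ?_, ?_, ?_⟩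
  · rw [map_sub, (bar F 1).commutes, ha]; field_simp; ring
  · intro h g w hw
    have e1 := min_stab c g hA hmin' hβ hβ0 hβ1 (w := bar F m w) (mem_barS hw)
    -- κ * bar w ∈ bar W → bar κ * w ∈ W
    obtain ⟨w1, hw1, e2⟩ := e1
    change bar F m w1 = κ * bar F m w at e2
    have e3 := congrArg (bar F m) e2
    rw [bar_bar c.hd, map_mul (bar F m), bar_bar c.hd] at e3
    have e4 : bar F m κ = κ ∨ bar F m κ = 2 * algebraMap F E a - κ := by
      have hb1 : bar F 1 κ = 2 * algebraMap F E a - κ := by rw [ha]; field_simp; ring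
      rw [← hb1]
      have : ∀ n, bar F n κ = κ ∨ bar F n κ = bar F 1 κ := by
        intro n
        induction n with
        | zero => left; rw [bar_apply]; simp
        | succ n ih =>
          have : bar F (n + 1) κ = bar F 1 (bar F n κ) := by
            rw [bar_apply, bar_apply, bar_apply, ← pow_mul, pow_one, pow_succ]
          rw [this]
          rcases ih with h | h
          · right; rw [h]
          · left; rw [h, hκ2]
      exact this m
    rw [sub_mul, ← Algebra.smul_def]
    have e5 := (Wc h).smul_mem a hw
    change w1 ∈ Wc h at hw1
    rcases e4 with h | h
    · rw [h] at e3
      exact Submodule.sub_mem _ (e3 ▸ hw1) e5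
    · have : κ * w - a • w = a • w - w1 := by
        rw [e3, h, Algebra.smul_def]; ring
      rw [this]
      exact Submodule.sub_mem _ e5 hw1
  · intro h g v hv
    obtain ⟨s, hs, k1, k2⟩ := step c g ((Algebra.trace F E).comp (LinearMap.mulLeft F (γ * v * β⁻¹))) hA
    have e1 : Ec (cj F hs h) β = s * Ec h v := by
      apply Ecj c g hs
      intro w hw
      rw [k1 β hβ w hw, hform_apply]
      show Algebra.trace F E (γ * v * β⁻¹ * (β * bar F m w)) = _
      congr 1; field_simp
    have e2 : Ec (cj F hs h) β1 = s * Ec h (κ * v) := by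
      apply Ecj c g hs
      intro w hw
      rw [k1 β1 hβ1 w hw, hform_apply]
      show Algebra.trace F E (γ * v * β⁻¹ * (β1 * bar F m w)) = _
      congr 1; rw [hκ]; field_simp
    have hs0 := T_ne hs
    have e3 := ratio _ k2 (Submodule.finrank_map_le _ _) (s * Ec h v) (e1 ▸ ⟨β, hβ, rfl⟩) (mul_ne_zero hs0 hv)
      (s * Ec h (κ * v)) (e2 ▸ ⟨β1, hβ1, rfl⟩)
    rw [mul_div_mul_left _ _ hs0] at e3
    refine ⟨Ec h (κ * v) / Ec h v - algebraMap F E a, ?_, ?_⟩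
    · rw [map_sub, e3, (bar F 2).commutes]
    · rw [sub_mul, sub_mul, map_sub, ← Algebra.smul_def, ← Algebra.smul_def, map_smul, div_mul_cancel₀ _ hv]
end
end SpGen

namespace SpGen
open Module IntermediateField

/-- block elements -/
structure Blk {F V K : Type*} [Field F] [Fintype F] [AddCommGroup V] [Module F V] [Field K] [Algebra F K]
    [FiniteDimensional F K] (B : LinearMap.BilinForm F V) (h : V ≃ₗ[F] V) (d : ℕ) (γd μ : K) (φ : K →ₗ[F] V) : Prop where
  hK : finrank F K = 2 * d
  hd2 : 2 ≤ d
  hγ : bar F d γd = -γd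
  hγ0 : γd ≠ 0
  hμ : μ ^ (Fintype.card F ^ d + 1) = 1
  hμ1 : μ ≠ 1
  iso : ∀ a b, B (φ a) (φ b) = hform (F := F) d γd a b
  eqv : ∀ a, h (φ a) = φ (μ * a)
  fix : ∀ x, (∀ a, B x (φ a) = 0) → h x = x

section
variable {F V K : Type*} [Field F] [Fintype F] [AddCommGroup V] [Module F V] [Field K] [Algebra F K]
    [FiniteDimensional F K] {B : LinearMap.BilinForm F V} {h : V ≃ₗ[F] V} {d : ℕ} {γd μ : K} {φ : K →ₗ[F] V}

theorem Blk.inj (b : Blk B h d γd μ φ) (hodd : Odd (Fintype.card F)) : Function.Injective φ :=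
  iso_inj (hform_nd b.hK hodd b.hγ b.hγ0) φ b.iso

theorem Blk.decomp (b : Blk B h d γd μ φ) (hodd : Odd (Fintype.card F)) (x : V) :
    ∃ a, ∀ c, B (x - φ a) (φ c) = 0 := by
  have nd := hform_nd b.hK hodd b.hγ b.hγ0
  refine ⟨((hform (F := F) d γd).toDual nd).symm ((B x).comp φ), fun c => ?_⟩
  have hu : ∀ y, hform (F := F) d γd (((hform (F := F) d γd).toDual nd).symm ((B x).comp φ)) y = ((B x).comp φ) y :=
    fun y => LinearMap.BilinForm.apply_toDual_symm_apply (B := hform (F := F) d γd) (hB := nd) _ y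
  rw [map_sub, LinearMap.sub_apply, b.iso, hu]; simp

theorem Blk.W (b : Blk B h d γd μ φ) (hodd : Odd (Fintype.card F)) : Wc h = LinearMap.range φ := by
  have hE : ∀ a, Ec h (φ a) = φ ((μ - 1) * a) := by
    intro a
    rw [Ec_apply, b.eqv, ← map_sub]; congr 1; ring
  apply le_antisymm
  · rintro _ ⟨x, rfl⟩
    obtain ⟨a, ha⟩ := b.decomp hodd x
    have h1 : Ec h (x - φ a) = 0 := by rw [Ec_apply, b.fix _ ha, sub_self]
    rw [map_sub, sub_eq_zero] at h1
    rw [h1, hE]; exact ⟨_, rfl⟩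
  · rintro _ ⟨a, rfl⟩
    have := Ec_mem h (φ ((μ - 1)⁻¹ * a))
    rwa [hE, mul_inv_cancel_left₀ (sub_ne_zero.2 b.hμ1)] at this

theorem Blk.Einj (b : Blk B h d γd μ φ) (hodd : Odd (Fintype.card F)) : ∀ w ∈ Wc h, Ec h w = 0 → w = 0 := by
  rw [b.W hodd]
  rintro _ ⟨a, rfl⟩ h0
  rw [Ec_apply, b.eqv, ← map_sub, map_eq_zero_iff _ (b.inj hodd)] at h0
  have : (μ - 1) * a = 0 := by linear_combination h0
  rcases mul_eq_zero.1 this with h | h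
  · exact absurd (sub_eq_zero.1 h) b.hμ1
  · rw [h, map_zero]

theorem Blk.rank (b : Blk B h d γd μ φ) (hodd : Odd (Fintype.card F)) : finrank F (Wc h) = 2 * d := by
  rw [b.W hodd, LinearMap.finrank_range_of_inj (b.inj hodd), b.hK]

theorem Blk.sq (b : Blk B h d γd μ φ) (h1 : μ * μ ≠ 1) : Blk B (h * h) d γd (μ * μ) φ :=
  ⟨b.hK, b.hd2, b.hγ, b.hγ0, by rw [mul_pow, b.hμ, one_mul], h1, b.iso, fun a => by
    rw [LinearEquiv.mul_apply, b.eqv, b.eqv, mul_assoc], fun x hx => by rw [LinearEquiv.mul_apply, b.fix x hx, b.fix x hx]⟩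

theorem Blk.sq_ne (b : Blk B h d γd μ φ) (hm : μ ≠ 1) (ht : Algebra.adjoin F {μ} = ⊤) : μ * μ ≠ 1 := by
  intro h1
  have h2 : μ = 1 ∨ μ = -1 := by
    have : (μ - 1) * (μ + 1) = 0 := by linear_combination h1
    rcases mul_eq_zero.1 this with h | h
    · left; linear_combination h
    · right; linear_combination h
  have h3 : μ ∈ (⊥ : Subalgebra F K) := by
    rcases h2 with h | h
    · rw [h]; exact one_mem _
    · rw [h]; exact neg_mem (one_mem _)
  have h4 : (⊤ : Subalgebra F K) ≤ ⊥ := by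
    rw [← ht, Algebra.adjoin_le_iff]
    exact Set.singleton_subset_iff.2 h3
  have h5 : finrank F K = 1 := by
    have := Subalgebra.bot_eq_top_iff_finrank_eq_one.1 (le_antisymm bot_le h4)
    exact this
  have := b.hK
  have := b.hd2
  omega
end

section
variable {F E : Type*} [Field F] [Fintype F] [Field E] [Algebra F E] [FiniteDimensional F E] 
variable {m N : ℕ} {γ : E} {H : Subgroup (E ≃ₗ[F] E)} {Y : Submodule F E}

theorem theta_sign (c : Ctx m γ H Y N) {h : E ≃ₗ[F] E} (g : Good m γ H Y h) (h4 : 4 ≤ finrank F (Wc h)) {θ : E} (hθ0 : θ ≠ 0)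
    {δ : F} (hδ : algebraMap F E δ = θ * θ)
    (hθW : ∀ w ∈ Wc h, θ * w ∈ Wc h)
    (hθ : ∀ v, Ec h v ≠ 0 → ∃ x, bar F 2 x = x ∧ Ec h (θ * v) = x * Ec h v) :
    (∀ w ∈ Wc h, Ec h (θ * w) = θ * Ec h w) ∨ (∀ w ∈ Wc h, Ec h (θ * w) = -θ * Ec h w) := by
  classical
  have inj : ∀ w ∈ Wc h, w ≠ 0 → Ec h w ≠ 0 := fun w hw h0 h1 => h0 (g.inj w hw h1)
  choose! x hx1 hx2 using hθ
  have ind : ∀ v1 ∈ Wc h, ∀ v2 ∈ Wc h, v1 ≠ 0 → v2 ≠ 0 → (∀ y, bar F 2 y = y → Ec h v2 ≠ y * Ec h v1) → x v1 = x v2 := by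
    intro v1 m1 v2 m2 n1 n2 hy
    have n12 : v1 + v2 ≠ 0 := by
      intro h0
      apply hy (-1) (by simp)
      rw [eq_neg_of_add_eq_zero_right h0, map_neg]; ring
    have e1 := hx2 v1 (inj _ m1 n1)
    have e2 := hx2 v2 (inj _ m2 n2)
    have i12 := inj _ ((Wc h).add_mem m1 m2) n12
    have e3 := hx2 (v1 + v2) i12
    rw [mul_add, map_add, map_add, e1, e2] at e3
    have f1 := hx1 v1 (inj _ m1 n1)
    have f2 := hx1 v2 (inj _ m2 n2)
    have f3 := hx1 _ i12
    have k2 : x v2 = x (v1 + v2) := by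
      by_contra hne
      have hne := sub_ne_zero.2 hne
      apply hy ((x (v1 + v2) - x v1) / (x v2 - x (v1 + v2)))
      · rw [map_div₀, map_sub, map_sub, f1, f2, f3]
      · field_simp; linear_combination e3
    have k1 : (x v1 - x (v1 + v2)) * Ec h v1 = 0 := by rw [← k2]; rw [← k2] at e3; linear_combination e3
    rcases mul_eq_zero.1 k1 with h | h
    · rw [k2]; linear_combination h
    · exact absurd h (inj _ m1 n1)
  have const : ∀ v1 ∈ Wc h, ∀ v2 ∈ Wc h, v1 ≠ 0 → v2 ≠ 0 → x v1 = x v2 := by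
    intro v1 m1 v2 m2 n1 n2
    by_cases hy : ∀ y, bar F 2 y = y → Ec h v2 ≠ y * Ec h v1
    · exact ind v1 m1 v2 m2 n1 n2 hy
    push Not at hy
    obtain ⟨y, hy, hy2⟩ := hy
    obtain ⟨v3, m3, n3, h3⟩ : ∃ v3 ∈ Wc h, v3 ≠ 0 ∧ ∀ y, bar F 2 y = y → Ec h v3 ≠ y * Ec h v1 := by
      by_contra! hno
      have hno' : ∀ v3 ∈ Wc h, ∃ y, bar F 2 y = y ∧ Ec h v3 = y * Ec h v1 := by
        intro v3 m3
        by_cases h0 : v3 = 0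
        · exact ⟨0, map_zero _, by rw [h0, map_zero, zero_mul]⟩
        · exact hno v3 m3 h0
      choose! z hz1 hz2 using hno'
      have := finite_of_fd F (Wc h)
      have := Fintype.ofFinite (Wc h)
      have hcard : Fintype.card (Wc h) = Fintype.card F ^ finrank F (Wc h) := Module.card_eq_pow_finrank
      have hinj : Function.Injective (fun w : Wc h => z w) := by
        intro w w' hww
        have hww : z w = z w' := hww
        have e1 := hz2 w w.2
        rw [hww, ← hz2 w' w'.2] at e1
        have := g.inj (w - w') ((Wc h).sub_mem w.2 w'.2) (by rw [map_sub, e1, sub_self])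
        exact Subtype.ext (sub_eq_zero.1 this)
      have hle := fixed_card (F := F) 2 (by norm_num) ((Finset.univ : Finset (Wc h)).image (fun w : Wc h => z (w : E))) (by
        intro a ha
        obtain ⟨w, -, rfl⟩ := Finset.mem_image.1 ha
        exact hz1 w w.2)
      rw [Finset.card_image_of_injective _ hinj, Finset.card_univ, hcard] at hle
      have := (Nat.pow_le_pow_iff_right (Fintype.one_lt_card (α := F))).1 hle
      omega
    rw [ind v1 m1 v3 m3 n1 n3 h3]
    symm
    refine ind v2 m2 v3 m3 n2 n3 ?_
    intro t ht ht2
    refine h3 (t * y) (by rw [map_mul (bar F 2), ht, hy]) ?_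
    rw [ht2, hy2]; ring
  obtain ⟨v0, m0, n0⟩ : ∃ v0 ∈ Wc h, v0 ≠ 0 := Submodule.exists_mem_ne_zero_of_ne_bot (by
    intro hb; rw [hb, finrank_bot] at h4; omega)
  have key : ∀ w ∈ Wc h, Ec h (θ * w) = x v0 * Ec h w := by
    intro w hw
    by_cases h0 : w = 0
    · rw [h0]; simp
    · rw [hx2 w (inj w hw h0), const w hw v0 m0 h0 n0]
  have e1 := key _ (hθW _ m0)
  rw [key _ m0, ← mul_assoc, ← hδ, ← Algebra.smul_def, map_smul, Algebra.smul_def, hδ] at e1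
  have e2 : (θ - x v0) * ((θ + x v0) * Ec h v0) = 0 := by linear_combination e1
  rcases mul_eq_zero.1 e2 with k | k
  · left; intro w hw; rw [key w hw, ← sub_eq_zero.1 k]
  · right; intro w hw
    rcases mul_eq_zero.1 k with k | k
    · rw [key w hw]; linear_combination (Ec h w) * k
    · exact absurd k (inj _ m0 n0)

theorem theta_comm (c : Ctx m γ H Y N) {h : E ≃ₗ[F] E} (g : Good m γ H Y h) (g2 : Good m γ H Y (h * h)) (hW : Wc (h * h) = Wc h)
    {θ : E} (hθ0 : θ ≠ 0) (hne : Wc h ≠ ⊥)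
    (hθW : ∀ w ∈ Wc h, θ * w ∈ Wc h)
    (h1 : (∀ w ∈ Wc h, Ec h (θ * w) = θ * Ec h w) ∨ (∀ w ∈ Wc h, Ec h (θ * w) = -θ * Ec h w))
    (h2 : (∀ w ∈ Wc h, Ec (h * h) (θ * w) = θ * Ec (h * h) w) ∨ (∀ w ∈ Wc h, Ec (h * h) (θ * w) = -θ * Ec (h * h) w)) :
    ∀ w ∈ Wc h, h (θ * w) = θ * h w := by
  have inj : ∀ w ∈ Wc h, w ≠ 0 → Ec h w ≠ 0 := fun w hw h0 h1 => h0 (g.inj w hw h1)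
  have h20 : (2 : E) ≠ 0 := by
    have := (map_ne_zero (algebraMap F E)).2 (two_ne c.hodd)
    rwa [map_ofNat] at this
  rcases h1 with h1 | h1
  · intro w hw
    have := h1 w hw
    rw [Ec_apply, Ec_apply] at this
    linear_combination this
  · exfalso
    obtain ⟨w, hw, hw0⟩ := Submodule.exists_mem_ne_zero_of_ne_bot hne
    have hE2 : ∀ z, Ec (h * h) z = Ec h (Ec h z) + 2 * Ec h z := by
      intro z
      simp only [Ec_apply, LinearEquiv.mul_apply, map_sub]; ring
    have e1 := h1 w hw
    have e2 := h1 _ (Ec_mem h w)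
    have e3 : Ec (h * h) (θ * w) = θ * Ec h (Ec h w) - 2 * (θ * Ec h w) := by
      rw [hE2, e1, neg_mul, map_neg, e2]; ring
    have n1 := inj w hw hw0
    have n2 := inj _ (Ec_mem h w) n1
    rcases h2 with h2 | h2
    · have := h2 w hw
      rw [e3, hE2] at this
      have h5 : 2 * 2 * (θ * Ec h w) = 0 := by linear_combination -this
      simp [h20, hθ0, n1] at h5
    · have := h2 w hw
      rw [e3, hE2] at this
      have h5 : 2 * (θ * Ec h (Ec h w)) = 0 := by linear_combination this
      simp [h20, hθ0, n2] at h5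

theorem bar_neg_pow {θ : E} (h : bar F 1 θ = -θ) (n : ℕ) : bar F n θ = (-1) ^ n * θ := by
  induction n with
  | zero => rw [bar_apply]; simp
  | succ n ih =>
    have : bar F (n + 1) θ = bar F n (bar F 1 θ) := by
      rw [bar_apply, bar_apply, bar_apply, ← pow_mul, pow_one, pow_succ, mul_comm]
    rw [this, h, map_neg, ih]; ring

theorem parity (c : Ctx m γ H Y N) {K : Type*} [Field K] [Algebra F K] [FiniteDimensional F K] {h : E ≃ₗ[F] E} {d : ℕ}
    {γd μ : K} {φ : K →ₗ[F] E} (b : Blk (hform (F := F) m γ) h d γd μ φ) (ht : Algebra.adjoin F {μ} = ⊤)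
    {θ : E} (hθ0 : θ ≠ 0) (hθb : bar F 1 θ = -θ) {δ : F} (hδ : algebraMap F E δ = θ * θ) (hθW : ∀ w ∈ Wc h, θ * w ∈ Wc h)
    (hcom : ∀ w ∈ Wc h, h (θ * w) = θ * h w) : d % 2 = m % 2 := by
  have hW := b.W c.hodd
  have hφW : ∀ a, φ a ∈ Wc h := fun a => hW ▸ ⟨a, rfl⟩
  have hφi := b.inj c.hodd
  have : ∀ a, ∃ a', φ a' = θ * φ a := by
    intro a
    have := hθW _ (hφW a)
    rw [hW] at this
    exact this
  choose L hL using this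
  have Ladd : ∀ a a', L (a + a') = L a + L a' := fun a a' => hφi (by rw [map_add, hL, hL, hL, map_add, mul_add])
  have Lsm : ∀ (r : F) a, L (r • a) = r • L a := fun r a => hφi (by rw [map_smul, hL, hL, map_smul, mul_smul_comm])
  have Lμ : ∀ a, L (μ * a) = μ * L a := fun a => hφi (by
    rw [hL, ← b.eqv, ← b.eqv, hL, hcom _ (hφW a)])
  have Lx : ∀ x : K, ∀ a, L (x * a) = x * L a := by
    intro x
    have hx : x ∈ Algebra.adjoin F {μ} := by rw [ht]; trivial
    induction hx using Algebra.adjoin_induction with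
    | mem x hx => rw [Set.mem_singleton_iff.1 hx]; exact Lμ
    | algebraMap r => intro a; rw [← Algebra.smul_def, ← Algebra.smul_def, Lsm]
    | add x y _ _ h1 h2 => intro a; rw [add_mul, Ladd, h1, h2, add_mul]
    | mul x y _ _ h1 h2 => intro a; rw [mul_assoc, h1, h2, mul_assoc]
  set c0 := L 1 with hc0
  have L1 : ∀ x, L x = x * c0 := fun x => by rw [← Lx, mul_one]
  have hc2 : c0 * c0 = algebraMap F K δ := by
    apply hφi
    rw [← L1, hL, hc0, hL, ← mul_assoc, ← hδ, ← Algebra.smul_def, Algebra.algebraMap_eq_smul_one, map_smul]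
  have hc00 : c0 ≠ 0 := by
    intro h0
    rw [h0, mul_zero] at hc2
    have := (map_eq_zero (algebraMap F K)).1 hc2.symm
    rw [this, map_zero] at hδ
    simp [hθ0] at hδ
  have h2F := two_ne c.hodd
  have h2E : (2 : E) ≠ 0 := by
    have := (map_ne_zero (algebraMap F E)).2 h2F
    rwa [map_ofNat] at this
  have h2K : (2 : K) ≠ 0 := by
    have := (map_ne_zero (algebraMap F K)).2 h2F
    rwa [map_ofNat] at this
  have hcb : bar F 1 c0 = -c0 := by
    have e1 := congrArg (bar F 1) hc2
    rw [map_mul (bar F 1), (bar F 1).commutes, ← hc2] at e1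
    have e2 : (bar F 1 c0 - c0) * (bar F 1 c0 + c0) = 0 := by linear_combination e1
    rcases mul_eq_zero.1 e2 with h | h
    · exfalso
      obtain ⟨a, ha⟩ := fixed_mem (F := F) (sub_eq_zero.1 h)
      rw [← ha, ← map_mul] at hc2
      have := (algebraMap F K).injective hc2
      rw [← this, map_mul] at hδ
      have e3 : (algebraMap F E a - θ) * (algebraMap F E a + θ) = 0 := by linear_combination hδ
      have e4 : bar F 1 θ = θ := by
        rcases mul_eq_zero.1 e3 with h | h
        · rw [← sub_eq_zero.1 h, (bar F 1).commutes]
        · rw [eq_neg_of_add_eq_zero_right h, map_neg, (bar F 1).commutes]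
      rw [hθb] at e4
      have : 2 * θ = 0 := by linear_combination -e4
      simp [h2E, hθ0] at this
    · linear_combination h
  -- adjoint
  have hadj : ∀ a b' : K, hform (F := F) d γd (L a) b' = (-1) ^ m * hform (F := F) d γd a (L b') := by
    intro a b'
    rw [← b.iso, ← b.iso, hL, hL, hform_apply, hform_apply, map_mul (bar F m), bar_neg_pow hθb]
    have e1 : ((-1 : F) ^ m) * (-1) ^ m = 1 := by rw [← mul_pow]; simp
    have e2 : γ * φ a * ((-1) ^ m * θ * bar F m (φ b')) = ((-1 : F) ^ m) • (γ * (θ * φ a) * bar F m (φ b')) := by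
      rw [Algebra.smul_def, map_pow, map_neg, map_one]; ring
    rw [e2, map_smul, smul_eq_mul, ← mul_assoc ((-1 : F) ^ m) ((-1) ^ m), e1, one_mul]
  have e1 : γd * c0 - (-1) ^ m * (γd * bar F d c0) = 0 := by
    apply trace_nd (F := F)
    intro y
    have := hadj y 1
    rw [hform_apply, hform_apply, L1, L1, one_mul, map_one, mul_one] at this
    have e2 : (γd * c0 - (-1) ^ m * (γd * bar F d c0)) * y = γd * (y * c0) - ((-1 : F) ^ m) • (γd * y * bar F d c0) := by
      rw [Algebra.smul_def, map_pow, map_neg, map_one]; ring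
    rw [e2, map_sub, map_smul, this, smul_eq_mul, sub_self]
  rw [bar_neg_pow hcb] at e1
  have e2 : (γd * c0) * (1 - (-1) ^ (m + d)) = 0 := by rw [pow_add]; linear_combination e1
  by_contra hpar
  have hodd : Odd (m + d) := by rw [Nat.odd_iff]; omega
  rw [hodd.neg_one_pow] at e2
  have e3 : (γd * c0) * 2 = 0 := by linear_combination e2
  simp [b.hγ0, hc00, h2K] at e3

theorem gen_main (c : Ctx m γ H Y N)
    (h1 : ∀ p, p.Prime → p ≠ 2 → p ∣ m → ∃ d, (∃ h, Good m γ H Y h ∧ finrank F (Wc h) = 2 * d) ∧ ¬ p ∣ d)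
    {K : Type*} [Field K] [Algebra F K] [FiniteDimensional F K] {h : E ≃ₗ[F] E} {d : ℕ}
    {γd μ : K} {φ : K →ₗ[F] E} (b : Blk (hform (F := F) m γ) h d γd μ φ) (ht : Algebra.adjoin F {μ} = ⊤)
    (hH : h ∈ H) (hS : h ∈ Sp (hform (F := F) m γ)) (hY : barS m (Wc h) ≤ Y) (hpar : d % 2 ≠ m % 2) :
    Sp (hform (F := F) m γ) ≤ H := by
  have hd2 := b.hd2
  have g : Good m γ H Y h := ⟨hH, hS, b.Einj c.hodd, hY⟩
  have b2 := b.sq (b.sq_ne b.hμ1 ht)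
  have hWW : Wc (h * h) = Wc h := by rw [b.W c.hodd, b2.W c.hodd]
  have g2 : Good m γ H Y (h * h) := ⟨H.mul_mem hH hH, Subgroup.mul_mem _ hS hS, b2.Einj c.hodd, hWW ▸ hY⟩
  have hr := b.rank c.hodd
  by_contra hno
  obtain ⟨θ, hθ0, hθb, t1, t2⟩ := theta_lem c g (by omega) h1 ⟨d, ⟨h, g, hr⟩, hpar⟩ hno
  obtain ⟨δ, hδ⟩ := fixed_mem (F := F) (x := θ * θ) (by rw [map_mul (bar F 1), hθb]; ring)
  have s1 := theta_sign c g (by omega) hθ0 hδ (t1 h g) (t2 h g)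
  have s2 := theta_sign c g2 (by rw [hWW]; omega) hθ0 hδ (t1 _ g2) (t2 _ g2)
  rw [hWW] at s2
  have s3 := theta_comm c g g2 hWW hθ0 (by intro hb; rw [hb, finrank_bot] at hr; omega) (t1 h g) s1 s2
  exact hpar (parity c b ht hθ0 hθb hδ (t1 h g) s3)
end
end SpGen

namespace SpGen
open Module

/-- isometric equivariant maps -/
def MM {F U V : Type*} [Field F] [AddCommGroup V] [Module F V] [AddCommGroup U] [Module F U]
    (β : LinearMap.BilinForm F U) (B : LinearMap.BilinForm F V) (l : U ≃ₗ[F] U) (y : V ≃ₗ[F] V) : Set (U →ₗ[F] V) :=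
  {f | (∀ a b, B (f a) (f b) = β a b) ∧ ∀ a, y (f a) = f (l a)}

section
variable {F U V : Type*} [Field F] [Finite F] [AddCommGroup V] [Module F V]
    [AddCommGroup U] [Module F U] [FiniteDimensional F V] [FiniteDimensional F U]
    {B : LinearMap.BilinForm F V}

theorem MM_mass (hVa : B.IsAlt) (hV : B.Nondegenerate) {β : LinearMap.BilinForm F U} (l : U ≃ₗ[F] U)
    (hl : ∀ a b, β (l a) (l b) = β a b) (ha : β.IsAlt) (hn : β.Nondegenerate) (hd : finrank F U ≤ finrank F V)
    [Fintype (Sp B)] : ∑ y : Sp B, Nat.card (MM β B l y.1) = Nat.card (Sp B) := by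
  obtain ⟨g, hg⟩ := exists_embed ha hn hVa hV hd
  rw [← mass_eq hVa hV β l hl ⟨⟨g, iso_inj hn g hg, hg⟩⟩]
  refine Finset.sum_congr rfl fun y _ => Nat.card_congr ?_
  exact ⟨fun f => ⟨⟨f.1, iso_inj hn f.1 f.2.1, f.2.1⟩, f.2.2⟩, fun f => ⟨f.1.1, f.1.2.2, f.2⟩, fun f => rfl, fun f => rfl⟩

/-- invariant alternating forms -/
def Inv {F K : Type*} [Field F] [Field K] [Algebra F K] (ν : K) : Set (LinearMap.BilinForm F K) :=
  {β | β.IsAlt ∧ ∀ a b, β (ν * a) (ν * b) = β a b}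

/-- pairs of an isometric embedding and an orthogonal equivariant map -/
def PP {K : Type*} [Field K] [Algebra F K] (β : LinearMap.BilinForm F U) (B : LinearMap.BilinForm F V) (l : U ≃ₗ[F] U)
    (ν : K) (y : V ≃ₗ[F] V) : Set ((U →ₗ[F] V) × (K →ₗ[F] V)) :=
  {p | p.1 ∈ MM β B l y ∧ p.2 ≠ 0 ∧ (∀ a, y (p.2 a) = p.2 (ν * a)) ∧ ∀ a b, B (p.2 a) (p.1 b) = 0}

theorem eqv_inj {K : Type*} [Field K] [Algebra F K] [FiniteDimensional F K] {y : V ≃ₗ[F] V} {ν : K} (hν : Algebra.adjoin F {ν} = ⊤) {ψ : K →ₗ[F] V} (h0 : ψ ≠ 0)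
    (he : ∀ a, y (ψ a) = ψ (ν * a)) : Function.Injective ψ := by
  have key : ∀ a : K, ψ a = 0 → ∀ c : K, ψ (c * a) = 0 := by
    intro a ha c
    have hc : c ∈ Algebra.adjoin F {ν} := by rw [hν]; trivial
    induction hc using Algebra.adjoin_induction generalizing a with
    | mem x hx => rw [Set.mem_singleton_iff.1 hx, ← he, ha, map_zero]
    | algebraMap r => rw [← Algebra.smul_def, map_smul, ha, smul_zero]
    | add x z _ _ h1 h2 => rw [add_mul, map_add, h1 a ha, h2 a ha, add_zero]
    | mul x z _ _ h1 h2 => rw [mul_assoc]; exact h1 _ (h2 a ha)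
  rw [← LinearMap.ker_eq_bot, LinearMap.ker_eq_bot']
  intro a ha
  by_contra hne
  apply h0
  ext c
  have := key a ha (c * a⁻¹)
  rwa [mul_assoc, inv_mul_cancel₀ hne, mul_one] at this

/-- orthogonal sum -/
def sform {F U K : Type*} [Field F] [AddCommGroup U] [Module F U] [AddCommGroup K] [Module F K]
    (β : LinearMap.BilinForm F U) (β' : LinearMap.BilinForm F K) : LinearMap.BilinForm F (U × K) :=
  β.compl₁₂ (LinearMap.fst F U K) (LinearMap.fst F U K) + β'.compl₁₂ (LinearMap.snd F U K) (LinearMap.snd F U K)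

theorem PP_mass (hVa : B.IsAlt) (hV : B.Nondegenerate) {β : LinearMap.BilinForm F U} (l : U ≃ₗ[F] U)
    (hn : β.Nondegenerate) {K : Type*} [Field K] [Algebra F K] [FiniteDimensional F K] {ν : K}
    (hν : Algebra.adjoin F {ν} = ⊤) (hν0 : ν ≠ 0) [Fintype (Sp B)] :
    ∑ y : Sp B, Nat.card (PP β B l ν y.1) ≤ Nat.card (Inv (F := F) ν) * Nat.card (Sp B) := by
  have := finite_of_fd F K
  have : Finite (LinearMap.BilinForm F K) := Finite.of_injective (fun β => (fun a b => β a b : K → K → F)) (by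
    intro β β' h
    ext a b
    exact congrFun (congrFun h a) b)
  have := Fintype.ofFinite (Inv (F := F) ν)
  have h1 : ∀ y : Sp B, Nat.card (PP β B l ν y.1) ≤
      ∑ β' : Inv (F := F) ν, Nat.card (EEmb (sform β β'.1) B (l.prodCongr (mulE F ν hν0)).toLinearMap y) := by
    intro y
    rw [← Nat.card_sigma]
    let G : PP β B l ν y.1 → Σ β' : Inv (F := F) ν, EEmb (sform β β'.1) B (l.prodCongr (mulE F ν hν0)).toLinearMap y := fun p =>
      ⟨⟨B.compl₁₂ p.1.2 p.1.2, fun a => hVa _, fun a b => by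
        simp only [LinearMap.compl₁₂_apply]
        rw [← p.2.2.2.1, ← p.2.2.2.1]; exact y.2 _ _⟩, ⟨⟨p.1.1.coprod p.1.2, by
          rw [← LinearMap.ker_eq_bot, LinearMap.ker_eq_bot']
          rintro ⟨u, k⟩ h
          rw [LinearMap.coprod_apply] at h
          simp only at h
          have hu : u = 0 := by
            apply hn.1 u
            intro w
            rw [← p.2.1.1, eq_neg_of_add_eq_zero_left h, map_neg, LinearMap.neg_apply, p.2.2.2.2, neg_zero]
          subst hu
          rw [map_zero, zero_add] at h
          rw [(map_eq_zero_iff _ (eqv_inj hν p.2.2.1 p.2.2.2.1)).1 h]; rfl, by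
          rintro ⟨u, k⟩ ⟨u', k'⟩
          have e1 : B (p.1.1 u) (p.1.2 k') = 0 := by rw [← hVa.neg_eq, p.2.2.2.2, neg_zero]
          simp [sform, p.2.2.2.2, p.2.1.1, e1]⟩, by
          rintro ⟨u, k⟩
          simp only [LinearMap.coprod_apply, map_add, p.2.1.2, p.2.2.2.1]
          rfl⟩⟩
    refine Nat.card_le_card_of_injective G ?_
    intro p p' h
    have h2 : ∀ u : U × K, (G p).2.1.1 u = (G p').2.1.1 u := by rw [h]; intro; rfl
    apply Subtype.ext
    refine Prod.ext ?_ ?_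
    · ext u
      have := h2 (u, 0)
      simpa [G] using this
    · ext u
      have := h2 (0, u)
      simpa [G] using this
  calc _ ≤ ∑ y : Sp B, ∑ β' : Inv (F := F) ν, Nat.card (EEmb (sform β β'.1) B (l.prodCongr (mulE F ν hν0)).toLinearMap y) :=
        Finset.sum_le_sum fun y _ => h1 y
    _ = ∑ β' : Inv (F := F) ν, ∑ y : Sp B, Nat.card (EEmb (sform β β'.1) B (l.prodCongr (mulE F ν hν0)).toLinearMap y) :=
        Finset.sum_comm
    _ ≤ ∑ β' : Inv (F := F) ν, Nat.card (Sp B) := Finset.sum_le_sum fun β' _ => mass_le hVa hV _ _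
    _ = _ := by rw [Finset.sum_const, smul_eq_mul, Finset.card_univ, Nat.card_eq_fintype_card (α := Inv (F := F) ν)]
end

section
variable {F V ι : Type*} [Field F] [Finite F] [AddCommGroup V] [Module F V] [FiniteDimensional F V]
    [Fintype ι] [DecidableEq ι] {K : ι → Type*} [∀ i, AddCommGroup (K i)] [∀ i, Module F (K i)]
    [∀ i, FiniteDimensional F (K i)] {B : LinearMap.BilinForm F V}

/-- orthogonal sum of a family -/
def pform (β : ∀ i, LinearMap.BilinForm F (K i)) : LinearMap.BilinForm F (∀ i, K i) :=
  ∑ i, (β i).compl₁₂ (LinearMap.proj i) (LinearMap.proj i)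

theorem pform_apply (β : ∀ i, LinearMap.BilinForm F (K i)) (a b : ∀ i, K i) :
    pform β a b = ∑ i, β i (a i) (b i) := by
  simp [pform, LinearMap.sum_apply]

theorem pform_alt {β : ∀ i, LinearMap.BilinForm F (K i)} (h : ∀ i, (β i).IsAlt) : (pform β).IsAlt := fun a => by
  rw [pform_apply]; exact Finset.sum_eq_zero fun i _ => h i _

theorem pform_nd {β : ∀ i, LinearMap.BilinForm F (K i)} (ha : ∀ i, (β i).IsAlt) (h : ∀ i, (β i).Nondegenerate) :
    (pform β).Nondegenerate := by
  apply alt_nondeg (pform_alt ha)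
  intro v hv
  funext i
  apply (h i).1
  intro w
  have := hv (Pi.single i w)
  rw [pform_apply, Finset.sum_eq_single i] at this
  · simpa using this
  · intro j _ hj; rw [Pi.single_eq_of_ne hj, map_zero]
  · simp

theorem MM_pi (β : ∀ i, LinearMap.BilinForm F (K i)) (l : ∀ i, K i ≃ₗ[F] K i) (y : V ≃ₗ[F] V)
    (ho : ∀ i j, i ≠ j → ∀ f ∈ MM (β i) B (l i) y, ∀ g ∈ MM (β j) B (l j) y, ∀ a b, B (f a) (g b) = 0) :
    Nat.card (MM (pform β) B (LinearEquiv.piCongrRight l) y) = ∏ i, Nat.card (MM (β i) B (l i) y) := by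
  rw [← Nat.card_pi]
  refine Nat.card_congr (Equiv.trans ?_ (Equiv.subtypePiEquivPi (p := fun i f => f ∈ MM (β i) B (l i) y)))
  refine (Equiv.subtypeEquiv (LinearMap.lsum F K F).toEquiv ?_).symm
  intro g
  have e : ∀ a, (LinearMap.lsum F K F) g a = ∑ i, g i (a i) := fun a => by simp [LinearMap.sum_apply]
  have e1 : ∀ i (a : K i), (LinearMap.lsum F K F) g (Pi.single i a) = g i a := fun i a => by
    rw [e, Finset.sum_eq_single i]
    · simp
    · intro j _ hj; rw [Pi.single_eq_of_ne hj, map_zero]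
    · simp
  change _ ↔ (LinearMap.lsum F K F) g ∈ _
  constructor
  · intro h
    refine ⟨fun a b => ?_, fun a => ?_⟩
    · rw [e, e, pform_apply, map_sum]
      refine Finset.sum_congr rfl fun i _ => ?_
      rw [map_sum, LinearMap.sum_apply, Finset.sum_eq_single i, (h i).1]
      · intro j _ hj; exact ho j i hj _ (h j) _ (h i) _ _
      · simp
    · rw [e, e, map_sum]
      exact Finset.sum_congr rfl fun i _ => (h i).2 _
  · intro h i
    refine ⟨fun a b => ?_, fun a => ?_⟩
    · rw [← e1, ← e1, h.1, pform_apply, Finset.sum_eq_single i]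
      · simp
      · intro j _ hj; rw [Pi.single_eq_of_ne hj, map_zero]; rfl
      · simp
    · rw [← e1, ← e1, h.2]
      congr 1
      funext j
      by_cases hj : j = i
      · subst hj; simp
      · simp [Pi.single_eq_of_ne hj]
end
end SpGen

namespace SpGen
open Module

section
variable {F K : Type*} [Field F] [Fintype F] [Field K] [Algebra F K] [FiniteDimensional F K]

theorem bar_eq_gen {i j : ℕ} {ν : K} (hν : Algebra.adjoin F {ν} = ⊤) (h : bar F i ν = bar F j ν) : bar F i = (bar F j : K →ₐ[F] K) :=
  AlgHom.ext_of_adjoin_eq_top hν (by intro x hx; rw [Set.mem_singleton_iff.1 hx, h])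

theorem bar_order {i j : ℕ} {ν : K} (hν : Algebra.adjoin F {ν} = ⊤) (h : bar F i ν = bar F j ν) : i ≡ j [MOD finrank F K] := by
  have := finite_of_fd F K
  have h1 := bar_eq_gen hν h
  have hf : IsOfFinOrder (FiniteField.frobeniusAlgHom F K) := by
    rw [← orderOf_pos_iff, FiniteField.orderOf_frobeniusAlgHom]; exact finrank_pos
  rw [bar, bar, hf.pow_eq_pow_iff_modEq, FiniteField.orderOf_frobeniusAlgHom] at h1
  exact h1

theorem bar_add (i j : ℕ) (x : K) : bar F (i + j) x = bar F i (bar F j x) := by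
  rw [bar, pow_add]; rfl

theorem bar_zero (x : K) : bar F 0 x = x := by rw [bar, pow_zero]; rfl

theorem conj_pow {ν ν' : K} (h : Polynomial.aeval ν' (minpoly F ν) = 0) : ∃ i, i < finrank F K ∧ ν' = bar F i ν := by
  have := finite_of_fd F K
  obtain ⟨σ, hσ⟩ := (isConjRoot_of_aeval_eq_zero (Algebra.IsIntegral.isIntegral ν) h : IsConjRoot F ν ν').exists_algEquiv
  obtain ⟨⟨i, hi⟩, hi'⟩ := (FiniteField.bijective_frobeniusAlgHom_pow F K).2 (σ.symm : K →ₐ[F] K)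
  refine ⟨i, hi, ?_⟩
  rw [bar]
  simp only at hi'
  rw [hi']
  simp [← hσ]

theorem poly_inv {K' : Type*} [Field K'] [Algebra F K'] {β : K →ₗ[F] K' →ₗ[F] F} {μ : K} {ν : K'} (hμ : μ ≠ 0)
    (h : ∀ a b, β (μ * a) (ν * b) = β a b) (g : Polynomial F) (a : K) (b : K') :
    β a (Polynomial.aeval ν g * b) = β (Polynomial.aeval μ⁻¹ g * a) b := by
  induction g using Polynomial.induction_on generalizing a b with
  | C r => simp [← Algebra.smul_def]
  | add p q hp hq => simp [add_mul, hp, hq]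
  | monomial n r hn =>
    rw [pow_succ, ← mul_assoc, map_mul (Polynomial.aeval ν), map_mul (Polynomial.aeval μ⁻¹), Polynomial.aeval_X, Polynomial.aeval_X, mul_assoc, mul_assoc, hn, ← h (_ * (μ⁻¹ * a))]
    congr 2
    field_simp

theorem orth_of_minpoly {K' : Type*} [Field K'] [Algebra F K'] [FiniteDimensional F K'] {d : ℕ} {β : K →ₗ[F] K' →ₗ[F] F} {μ : K} {ν : K'} 
    (hμ : μ ^ (Fintype.card F ^ d + 1) = 1)
    (h : ∀ a b, β (μ * a) (ν * b) = β a b) (hne : minpoly F μ ≠ minpoly F ν) (a : K) (b : K') : β a b = 0 := by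
  have hb : bar F d μ = μ⁻¹ := eq_inv_of_mul_eq_one_right (T_bar hμ)
  have h1 : Polynomial.aeval μ⁻¹ (minpoly F ν) ≠ 0 := by
    rw [← hb, Polynomial.aeval_algHom_apply, Ne, map_eq_zero]
    intro h2
    exact hne (minpoly.eq_of_irreducible_of_monic (minpoly.irreducible (Algebra.IsIntegral.isIntegral ν)) h2
      (minpoly.monic (Algebra.IsIntegral.isIntegral ν))).symm
  have h2 := poly_inv (T_ne hμ) h (minpoly F ν) ((Polynomial.aeval μ⁻¹ (minpoly F ν))⁻¹ * a) b
  rw [minpoly.aeval, zero_mul, map_zero, ← mul_assoc, mul_inv_cancel₀ h1, one_mul] at h2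
  exact h2.symm

theorem gen_aeval {ν : K} (hν : Algebra.adjoin F {ν} = ⊤) (a : K) : ∃ g : Polynomial F, Polynomial.aeval ν g = a := by
  have : a ∈ Algebra.adjoin F {ν} := by rw [hν]; trivial
  rwa [Algebra.adjoin_singleton_eq_range_aeval] at this

theorem gen_sq_ne {ν : K} (hν : Algebra.adjoin F {ν} = ⊤) (h2 : 2 ≤ finrank F K) : ν * ν ≠ 1 := by
  intro h1
  have h3 : ν ∈ (⊥ : Subalgebra F K) := by
    rcases mul_self_eq_one_iff.1 h1 with h | h
    · rw [h]; exact one_mem _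
    · rw [h]; exact neg_mem (one_mem _)
  have h4 : (⊤ : Subalgebra F K) ≤ ⊥ := by
    rw [← hν, Algebra.adjoin_le_iff]
    exact Set.singleton_subset_iff.2 h3
  have := Subalgebra.bot_eq_top_iff_finrank_eq_one.1 (le_antisymm bot_le h4)
  omega

theorem trace_rep (f : K →ₗ[F] F) : ∃ c : K, ∀ b, f b = Algebra.trace F K (c * b) := by
  have := finite_of_fd F K
  have nd := traceForm_nondegenerate F K
  refine ⟨((Algebra.traceForm F K).toDual nd).symm f, fun b => ?_⟩
  exact (LinearMap.BilinForm.apply_toDual_symm_apply (B := Algebra.traceForm F K) (hB := nd) f b).symm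

theorem anti_card {e : ℕ} (he : finrank F K = 2 * e) (he1 : 1 ≤ e) : Nat.card {c : K // bar F e c = -c} ≤ Fintype.card F ^ e := by
  classical
  have := finite_of_fd F K
  have := Fintype.ofFinite K
  obtain ⟨γ, hγ, hγ0⟩ := exists_gamma he he1
  rw [Nat.card_eq_fintype_card, ← Finset.card_univ]
  have hinj : Function.Injective (fun c : {c : K // bar F e c = -c} => c.1 / γ) := by
    intro c c' h
    have h : c.1 / γ = c'.1 / γ := h
    exact Subtype.ext ((div_left_inj' hγ0).1 h)
  rw [← Finset.card_image_of_injective _ hinj]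
  apply fixed_card _ he1
  intro x hx
  obtain ⟨c, -, rfl⟩ := Finset.mem_image.1 hx
  rw [map_div₀, c.2, hγ, neg_div_neg_eq]

theorem Inv_card_T {e : ℕ} (he : finrank F K = 2 * e) (he1 : 1 ≤ e) {ν : K} (hν : Algebra.adjoin F {ν} = ⊤)
    (hT : ν ^ (Fintype.card F ^ e + 1) = 1) : Nat.card (Inv (F := F) ν) ≤ Fintype.card F ^ e := by
  have := finite_of_fd F K
  refine le_trans ?_ (anti_card he he1)
  have key : ∀ β : Inv (F := F) ν, ∃ c : {c : K // bar F e c = -c}, ∀ a b, β.1 a b = Algebra.trace F K (c.1 * bar F e a * b) := by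
    rintro ⟨β, ha, hi⟩
    obtain ⟨c, hc⟩ := trace_rep (β 1)
    have hb : bar F e ν = ν⁻¹ := eq_inv_of_mul_eq_one_right (T_bar hT)
    have h1 : ∀ a b, β a b = Algebra.trace F K (c * bar F e a * b) := by
      intro a b
      obtain ⟨g, hg⟩ := gen_aeval hν (bar F e a)
      have h2 : Polynomial.aeval ν⁻¹ g = a := by
        rw [← hb, Polynomial.aeval_algHom_apply, hg, bar_bar he]
      have := poly_inv (β := β) (T_ne hT) hi g 1 b
      rw [h2, mul_one, hg, hc] at this
      rw [← this, mul_assoc]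
    refine ⟨⟨c, ?_⟩, h1⟩
    rw [eq_neg_iff_add_eq_zero]
    apply trace_nd (F := F)
    intro y
    have h2 : β y 1 = - β 1 y := by rw [ha.neg_eq]
    rw [h1, hc, mul_one, ← trace_bar he, map_mul (bar F e), bar_bar he] at h2
    rw [add_mul, map_add, h2, neg_add_cancel]
  choose C hC using key
  refine Nat.card_le_card_of_injective C ?_
  intro β β' h
  apply Subtype.ext
  ext a b
  rw [hC, hC, h]

theorem Inv_card_nT {e : ℕ} (he : finrank F K = 2 * e) (he1 : 1 ≤ e) {ν : K} (hν : Algebra.adjoin F {ν} = ⊤) (hν0 : ν ≠ 0)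
    (hT : ν ^ (Fintype.card F ^ e + 1) ≠ 1) : Nat.card (Inv (F := F) ν) ≤ 1 := by
  have key : ∀ β : Inv (F := F) ν, β.1 = 0 := by
    rintro ⟨β, ha, hi⟩
    change β = 0
    obtain ⟨c, hc⟩ := trace_rep (β 1)
    have h1 : ∀ (g : Polynomial F) b, β (Polynomial.aeval ν g) b = Algebra.trace F K (c * Polynomial.aeval ν⁻¹ g * b) := by
      intro g b
      have h2 : ∀ a b, LinearMap.flip β (ν * a) (ν * b) = LinearMap.flip β a b := fun a b => hi b a
      have := poly_inv (β := LinearMap.flip β) hν0 h2 g b 1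
      rw [mul_one, LinearMap.flip_apply, LinearMap.flip_apply, hc] at this
      rw [this, mul_assoc]
    by_cases hc0 : c = 0
    · ext a b
      obtain ⟨g, hg⟩ := gen_aeval hν a
      rw [← hg, h1, hc0, zero_mul, zero_mul, map_zero]; rfl
    exfalso
    have h3 : c * Polynomial.aeval ν⁻¹ (minpoly F ν) = 0 := by
      apply trace_nd (F := F)
      intro y
      rw [← h1, minpoly.aeval, map_zero]; rfl
    obtain ⟨i, hi, hi'⟩ := conj_pow ((mul_eq_zero.1 h3).resolve_left hc0)
    have h4 : bar F (i + i) ν = bar F 0 ν := by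
      rw [bar_add, ← hi', map_inv₀, ← hi', inv_inv, bar_zero]
    have h5 := (Nat.modEq_zero_iff_dvd.1 (bar_order hν h4))
    rw [he] at hi h5
    obtain ⟨t, ht⟩ := h5
    have : t < 2 := by
      by_contra hlt
      have : 2 * e * 2 ≤ 2 * e * t := Nat.mul_le_mul_left _ (by omega)
      omega
    interval_cases t
    · have : i = 0 := by omega
      rw [this, bar_zero] at hi'
      apply gen_sq_ne hν (by omega)
      nth_rewrite 1 [← hi']
      exact inv_mul_cancel₀ hν0
    · have : i = e := by omega
      rw [this] at hi'
      apply hT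
      rw [T_iff, ← hi', mul_inv_cancel₀ hν0]
  have : Subsingleton (Inv (F := F) ν) := ⟨fun a b => Subtype.ext ((key a).trans (key b).symm)⟩
  exact Finite.card_le_one_iff_subsingleton.2 this
end
end SpGen

namespace SpGen
open Module

/-- block data -/
structure BD (F : Type*) {K : Type*} [Field F] [Fintype F] [Field K] [Algebra F K] (d : ℕ) (γ μ : K) : Prop where
  hK : finrank F K = 2 * d
  hd : 2 ≤ d
  hγ : bar F d γ = -γ
  hγ0 : γ ≠ 0
  hμ : μ ^ (Fintype.card F ^ d + 1) = 1
  gen : Algebra.adjoin F {μ} = ⊤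

/-- number of block embeddings -/
abbrev MB {F K V : Type*} [Field F] [Fintype F] [Field K] [Algebra F K] [FiniteDimensional F K] [AddCommGroup V] [Module F V]
    (B : LinearMap.BilinForm F V) (d : ℕ) (γ : K) {μ : K} (hμ : μ ^ (Fintype.card F ^ d + 1) = 1) (y : V ≃ₗ[F] V) : Set (K →ₗ[F] V) :=
  MM (hform (F := F) d γ) B (mulE F μ (T_ne hμ)) y

section
variable {F K V : Type*} [Field F] [Fintype F] [Field K] [Algebra F K] [FiniteDimensional F K] [AddCommGroup V] [Module F V]
  [FiniteDimensional F V] {B : LinearMap.BilinForm F V} {d : ℕ} {γ μ : K} {y : V ≃ₗ[F] V}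

theorem MB_T (b : BD F d γ μ) {φ : K →ₗ[F] V} (h : φ ∈ MB B d γ b.hμ y) {t : K} (ht : t ^ (Fintype.card F ^ d + 1) = 1) :
    φ ∘ₗ LinearMap.mulLeft F t ∈ MB B d γ b.hμ y := by
  refine ⟨fun a c => ?_, fun a => ?_⟩
  · simp only [LinearMap.comp_apply, LinearMap.mulLeft_apply]
    rw [h.1]; exact hform_T ht a c
  · simp only [LinearMap.comp_apply, LinearMap.mulLeft_apply, h.2, mulE_apply]
    congr 1; ring

theorem MB_card (b : BD F d γ μ) (hodd : Odd (Fintype.card F)) (h : Nat.card (MB B d γ b.hμ y) ≠ 0) :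
    Fintype.card F ^ d + 1 ≤ Nat.card (MB B d γ b.hμ y) := by
  have : Nonempty (MB B d γ b.hμ y) := (Nat.card_ne_zero.1 h).1
  obtain ⟨φ, hφ⟩ := this
  rw [← card_TT b.hK, ← Nat.card_eq_finsetCard]
  refine Nat.card_le_card_of_injective (fun t => ⟨_, MB_T b hφ (mem_TT.1 t.2)⟩) ?_
  intro t t' h
  have h1 := congrArg (fun f : K →ₗ[F] V => f 1) (Subtype.ext_iff.1 h)
  simp only [LinearMap.comp_apply, LinearMap.mulLeft_apply, mul_one] at h1
  exact Subtype.ext (iso_inj (hform_nd b.hK hodd b.hγ b.hγ0) φ hφ.1 h1)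

theorem MB_extra (b : BD F d γ μ) (hodd : Odd (Fintype.card F)) (hy : y ∈ Sp B) (h : Fintype.card F ^ d + 1 < Nat.card (MB B d γ b.hμ y))
    {φ : K →ₗ[F] V} (hφ : φ ∈ MB B d γ b.hμ y) :
    ∃ ψ : K →ₗ[F] V, ψ ≠ 0 ∧ (∀ a, y (ψ a) = ψ (μ * a)) ∧ ∀ a c, B (ψ a) (φ c) = 0 := by
  have nd := hform_nd b.hK hodd b.hγ b.hγ0
  by_contra! hno
  apply absurd h (not_lt.2 ?_)
  rw [← card_TT b.hK, ← Nat.card_eq_finsetCard]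
  have key : ∀ φ2 : MB B d γ b.hμ y, ∃ t : TT F K d, φ2.1 = φ ∘ₗ LinearMap.mulLeft F t.1 := by
    rintro ⟨φ2, hφ2⟩
    have hw : ∀ v : V, ∃ a, ∀ c, hform (F := F) d γ a c = B v (φ c) := fun v =>
      ⟨((hform (F := F) d γ).toDual nd).symm ((B v).comp φ), fun c =>
        LinearMap.BilinForm.apply_toDual_symm_apply (B := hform (F := F) d γ) (hB := nd) ((B v).comp φ) c⟩
    obtain ⟨t, ht⟩ := hw (φ2 1)
    have hinv : ∀ a c, B (φ2 (μ * a)) (φ (μ * c)) = B (φ2 a) (φ c) := by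
      intro a c
      have e1 := hφ2.2 a
      have e2 := hφ.2 c
      rw [mulE_apply] at e1 e2
      rw [← e1, ← e2]; exact hy _ _
    have hinv' : ∀ a c, hform (F := F) d γ (μ * a) (μ * c) = hform (F := F) d γ a c := fun a c => hform_T b.hμ a c
    have e : ∀ a c, B (φ2 a) (φ c) = hform (F := F) d γ (a * t) c := by
      intro a c
      obtain ⟨g, hg⟩ := gen_aeval b.gen a
      have h1 := poly_inv (β := LinearMap.flip (B.compl₁₂ φ2 φ)) (T_ne b.hμ) (fun a c => hinv c a) g c 1
      have h2 := poly_inv (β := LinearMap.flip (hform (F := F) d γ)) (T_ne b.hμ) (fun a c => hinv' c a) g c t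
      simp only [LinearMap.flip_apply, LinearMap.compl₁₂_apply, mul_one] at h1 h2
      rw [← hg, h1, h2, ht]
    have hz : φ2 - φ ∘ₗ LinearMap.mulLeft F t = 0 := by
      by_contra hne
      obtain ⟨a, c, hac⟩ := hno _ hne (fun a => by
        have e1 := hφ2.2 a
        have e2 := hφ.2 (t * a)
        rw [mulE_apply] at e1 e2
        simp only [LinearMap.sub_apply, LinearMap.comp_apply, LinearMap.mulLeft_apply, map_sub, e1, e2]
        congr 2; ring)
      apply hac
      simp only [LinearMap.sub_apply, LinearMap.comp_apply, LinearMap.mulLeft_apply, map_sub, e, hφ.1]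
      rw [mul_comm, sub_self]
    rw [sub_eq_zero] at hz
    refine ⟨⟨t, ?_⟩, hz⟩
    rw [mem_TT, T_iff]
    have h1 : γ * (t * bar F d t - 1) = 0 := by
      apply trace_nd (F := F)
      intro a
      have h2 := hφ2.1 a 1
      have h3 := e a (t * 1)
      rw [hz] at h2 h3
      simp only [LinearMap.comp_apply, LinearMap.mulLeft_apply, hφ.1] at h2
      rw [hform_apply, hform_apply, map_mul (bar F d), map_one] at h2
      rw [← sub_eq_zero, ← map_sub] at h2
      rw [← h2]; congr 1; ring
    have := (mul_eq_zero.1 h1).resolve_left b.hγ0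
    linear_combination this
  choose C hC using key
  refine Nat.card_le_card_of_injective C ?_
  intro φ1 φ2 h
  apply Subtype.ext
  rw [hC, hC, h]
end

section
variable {F U K V : Type*} [Field F] [Fintype F] [Field K] [Algebra F K] [FiniteDimensional F K] [AddCommGroup V] [Module F V]
  [FiniteDimensional F V] [AddCommGroup U] [Module F U] [FiniteDimensional F U] {B : LinearMap.BilinForm F V} {y : V ≃ₗ[F] V}

theorem PP_lower (β : LinearMap.BilinForm F U) (l : U ≃ₗ[F] U) {ν : K} (hν : Algebra.adjoin F {ν} = ⊤)
    (h : ∀ f ∈ MM β B l y, ∃ ψ : K →ₗ[F] V, (f, ψ) ∈ PP β B l ν y) :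
    Nat.card (MM β B l y) * (Nat.card K - 1) ≤ Nat.card (PP β B l ν y) := by
  have := finite_of_fd F K
  rw [← Nat.card_units, ← Nat.card_prod]
  choose! Ψ hΨ using h
  refine Nat.card_le_card_of_injective (fun p => ⟨(p.1.1, Ψ p.1.1 ∘ₗ LinearMap.mulLeft F (p.2 : K)), ?_⟩) ?_
  · obtain ⟨h1, h2, h3, h4⟩ := hΨ p.1.1 p.1.2
    refine ⟨h1, ?_, ?_, ?_⟩
    · intro h0
      apply h2
      ext a
      have := congrArg (fun f : K →ₗ[F] V => f ((p.2 : K)⁻¹ * a)) h0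
      simpa using this
    · intro a
      simp only [LinearMap.comp_apply, LinearMap.mulLeft_apply, h3]
      congr 1; ring
    · intro a b; exact h4 _ _
  · rintro ⟨⟨f, hf⟩, a⟩ ⟨⟨f', hf'⟩, a'⟩ h
    simp only [Subtype.mk.injEq, Prod.mk.injEq] at h
    obtain ⟨rfl, h⟩ := h
    have h1 := congrArg (fun f : K →ₗ[F] V => f 1) h
    simp only [LinearMap.comp_apply, LinearMap.mulLeft_apply, mul_one] at h1
    obtain ⟨-, h2, h3, -⟩ := hΨ f hf
    rw [Units.ext (eqv_inj hν h2 h3 h1)]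
end

section
variable {F V ι : Type*} [Field F] [Fintype F] [AddCommGroup V] [Module F V] [FiniteDimensional F V]
    [Fintype ι] [DecidableEq ι] {K : ι → Type*} [∀ i, Field (K i)] [∀ i, Algebra F (K i)]
    [∀ i, FiniteDimensional F (K i)] {B : LinearMap.BilinForm F V}

theorem B_inv {K K' : Type*} [Field K] [Algebra F K] [Field K'] [Algebra F K'] [FiniteDimensional F K] [FiniteDimensional F K'] {y : V ≃ₗ[F] V} (hy : y ∈ Sp B) {d : ℕ}
    {μ : K} {ν : K'} (hμ : μ ^ (Fintype.card F ^ d + 1) = 1) (hne : minpoly F μ ≠ minpoly F ν) {φ : K →ₗ[F] V} {ψ : K' →ₗ[F] V}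
    (h1 : ∀ a, y (φ a) = φ (μ * a)) (h2 : ∀ a, y (ψ a) = ψ (ν * a)) (a : K) (b : K') : B (φ a) (ψ b) = 0 :=
  orth_of_minpoly (β := B.compl₁₂ φ ψ) hμ (fun a b => by
    simp only [LinearMap.compl₁₂_apply, ← h1, ← h2]; exact hy _ _) hne a b

theorem step1 (hVa : B.IsAlt) (hV : B.Nondegenerate) (hodd : Odd (Fintype.card F)) {d : ι → ℕ} {γ μ : ∀ i, K i}
    (b : ∀ i, BD F (d i) (γ i) (μ i)) (hne : ∀ i j, i ≠ j → minpoly F (μ i) ≠ minpoly F (μ j))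
    (hdim : ∑ i, 2 * d i ≤ finrank F V) (k : ℕ) (hk : ∀ i, k ≤ d i) [Fintype (Sp B)] :
    |∑ y : Sp B, ∏ i, (if Nat.card (MB B (d i) (γ i) (b i).hμ y.1) = 0 then (0 : ℝ) else 1) -
      Fintype.card (Sp B) * ∏ i, (1 / ((Fintype.card F : ℝ) ^ d i + 1))| ≤
      Fintype.card ι * (2 / 2 ^ k) * (Fintype.card (Sp B) * ∏ i, (1 / ((Fintype.card F : ℝ) ^ d i + 1))) := by
  classical
  set q := Fintype.card F with hq
  have hq2 : 2 ≤ q := Fintype.one_lt_card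
  set M : ι → Sp B → ℕ := fun i y => Nat.card (MB B (d i) (γ i) (b i).hμ y.1) with hM
  let L := fun i => mulE F (μ i) (T_ne (b i).hμ)
  let β := fun i => hform (F := F) (d i) (γ i)
  have hβa : ∀ i, (β i).IsAlt := fun i => hform_alt (b i).hK hodd (b i).hγ
  have hβn : ∀ i, (β i).Nondegenerate := fun i => hform_nd (b i).hK hodd (b i).hγ (b i).hγ0
  have hprod : ∀ y : Sp B, Nat.card (MM (pform β) B (LinearEquiv.piCongrRight L) y.1) = ∏ i, M i y := fun y =>
    MM_pi β L y.1 (fun i j hij f hf g hg => B_inv y.2 (b i).hμ (hne i j hij) hf.2 hg.2)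
  have hmass : ∑ y : Sp B, ∏ i, M i y = Fintype.card (Sp B) := by
    rw [← Nat.card_eq_fintype_card, ← MM_mass (β := pform β) hVa hV (LinearEquiv.piCongrRight L) ?_ (pform_alt hβa) (pform_nd hβa hβn) ?_]
    · exact Finset.sum_congr rfl fun y _ => (hprod y).symm
    · intro a c
      rw [pform_apply, pform_apply]
      exact Finset.sum_congr rfl fun i _ => hform_T (b i).hμ _ _
    · rw [Module.finrank_pi_fintype]
      exact le_trans (le_of_eq (Finset.sum_congr rfl fun i _ => (b i).hK)) hdim
  -- extra
  have hex : ∀ i, ∀ y : Sp B, (if q ^ d i + 1 < M i y then ∏ j, M j y else 0) * (q ^ (2 * d i) - 1) ≤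
      Nat.card (PP (pform β) B (LinearEquiv.piCongrRight L) (μ i) y.1) := by
    intro i y
    split_ifs with h
    · rw [← hprod, ← card_E (b i).hK]
      apply PP_lower _ _ (b i).gen
      intro f hf
      have hfj : ∀ j, f ∘ₗ LinearMap.single F K j ∈ MB B (d j) (γ j) (b j).hμ y.1 := by
        intro j
        refine ⟨fun a c => ?_, fun a => ?_⟩
        · rw [LinearMap.comp_apply, LinearMap.comp_apply, hf.1, pform_apply, Finset.sum_eq_single j]
          · simp [β]
          · intro i _ hi; simp [Pi.single_eq_of_ne hi]
          · simp
        · rw [LinearMap.comp_apply, LinearMap.comp_apply, hf.2]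
          congr 1
          funext i
          by_cases hi : i = j
          · subst hi; simp [L]
          · simp [Pi.single_eq_of_ne hi]
      obtain ⟨ψ, h1, h2, h3⟩ := MB_extra (b i) hodd y.2 h (hfj i)
      refine ⟨ψ, hf, h1, h2, fun a c => ?_⟩
      have hc : c = ∑ j, LinearMap.single F K j (c j) := by
        simp only [LinearMap.coe_single]; exact (Finset.univ_sum_single c).symm
      change B (ψ a) (f c) = 0
      rw [hc, map_sum, map_sum]
      refine Finset.sum_eq_zero fun j _ => ?_
      by_cases hj : j = i
      · subst hj; exact h3 a (c j)
      · exact B_inv y.2 (b i).hμ (hne i j (Ne.symm hj)) h2 (hfj j).2 a (c j)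
    · simp
  have hsum : ∀ i, (∑ y : Sp B, (if q ^ d i + 1 < M i y then ∏ j, M j y else 0)) * (q ^ (2 * d i) - 1) ≤
      q ^ d i * Fintype.card (Sp B) := by
    intro i
    rw [Finset.sum_mul]
    refine (Finset.sum_le_sum fun y _ => hex i y).trans ?_
    refine (PP_mass hVa hV _ (pform_nd hβa hβn) (b i).gen (T_ne (b i).hμ)).trans ?_
    rw [Nat.card_eq_fintype_card (α := Sp B)]
    exact Nat.mul_le_mul_right _ (Inv_card_T (b i).hK (by have := (b i).hd; omega) (b i).gen (b i).hμ)
  -- real version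
  set Q : ℝ := ∏ i, ((q : ℝ) ^ d i + 1) with hQ
  have hQ0 : 0 < Q := Finset.prod_pos fun i _ => by positivity
  have hQi : ∏ i, (1 / ((q : ℝ) ^ d i + 1)) = 1 / Q := by
    rw [hQ, Finset.prod_div_distrib, Finset.prod_const_one]
  set J : Sp B → ℝ := fun y => ∏ i, (if M i y = 0 then (0 : ℝ) else 1) with hJ
  have hX : ∀ i, (∑ y : Sp B, (if q ^ d i + 1 < M i y then ∏ j, (M j y : ℝ) else 0)) ≤ 2 / 2 ^ k * Fintype.card (Sp B) := by
    intro i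
    have h1 := hsum i
    have hpos : 2 ≤ q ^ d i := le_trans hq2 (Nat.le_self_pow (by have := (b i).hd; omega) q)
    have h2 : 1 ≤ q ^ (2 * d i) := Nat.one_le_pow _ _ (by omega)
    have h3 : ((∑ y : Sp B, (if q ^ d i + 1 < M i y then ∏ j, (M j y : ℝ) else 0))) * ((q : ℝ) ^ (2 * d i) - 1) ≤
        (q : ℝ) ^ d i * Fintype.card (Sp B) := by
      have := (Nat.cast_le (α := ℝ)).2 h1
      push_cast [Nat.cast_sub h2] at this
      exact this
    have h4 : (2 : ℝ) ≤ (q : ℝ) ^ d i := by exact_mod_cast hpos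
    have h5 : (2 : ℝ) ^ k ≤ (q : ℝ) ^ d i :=
      (pow_le_pow_right₀ (by norm_num) (hk i)).trans (pow_le_pow_left₀ (by norm_num) (by exact_mod_cast hq2) _)
    rw [mul_comm 2 (d i), pow_mul] at h3
    set x : ℝ := (q : ℝ) ^ d i
    have hg : (0 : ℝ) ≤ Fintype.card (Sp B) := by positivity
    have h6 : (∑ y : Sp B, (if q ^ d i + 1 < M i y then ∏ j, (M j y : ℝ) else 0)) ≤ x * Fintype.card (Sp B) / (x ^ 2 - 1) := by
      rw [le_div_iff₀ (by nlinarith)]; exact h3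
    refine h6.trans ?_
    rw [div_le_iff₀ (by nlinarith), div_mul_eq_mul_div, div_mul_eq_mul_div, le_div_iff₀ (by positivity)]
    have : x * 2 ^ k ≤ 2 * (x ^ 2 - 1) := by nlinarith
    calc x * (Fintype.card (Sp B) : ℝ) * 2 ^ k = (x * 2 ^ k) * Fintype.card (Sp B) := by ring
      _ ≤ (2 * (x ^ 2 - 1)) * Fintype.card (Sp B) := mul_le_mul_of_nonneg_right this hg
      _ = _ := by ring
  have hlow : ∀ y, J y * Q ≤ ∏ i, (M i y : ℝ) := by
    intro y
    rw [hJ, hQ]; simp only; rw [← Finset.prod_mul_distrib]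
    refine Finset.prod_le_prod (fun i _ => by split_ifs <;> positivity) fun i _ => ?_
    split_ifs with h
    · rw [zero_mul]; positivity
    · rw [one_mul]; exact_mod_cast MB_card (b i) hodd h
  have hup : ∀ y, ∏ i, (M i y : ℝ) ≤ J y * Q + ∑ i, (if q ^ d i + 1 < M i y then ∏ j, (M j y : ℝ) else 0) := by
    intro y
    have hnn : ∀ i ∈ Finset.univ, 0 ≤ (if q ^ d i + 1 < M i y then ∏ j, (M j y : ℝ) else 0) := by
      intro i _; split_ifs <;> positivity
    have hJ0 : 0 ≤ J y * Q := mul_nonneg (Finset.prod_nonneg fun i _ => by split_ifs <;> positivity) hQ0.le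
    by_cases h : ∃ i, q ^ d i + 1 < M i y
    · obtain ⟨i, hi⟩ := h
      have := Finset.single_le_sum hnn (Finset.mem_univ i)
      rw [if_pos hi] at this
      linarith
    · push Not at h
      have : ∏ i, (M i y : ℝ) ≤ J y * Q := by
        rw [hJ, hQ]; simp only; rw [← Finset.prod_mul_distrib]
        refine Finset.prod_le_prod (fun i _ => by positivity) fun i _ => ?_
        split_ifs with h0
        · rw [h0]; simp
        · rw [one_mul]; exact_mod_cast h i
      linarith [Finset.sum_nonneg hnn]
  have hmassR : ∑ y : Sp B, ∏ i, (M i y : ℝ) = Fintype.card (Sp B) := by exact_mod_cast hmass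
  have s1 : (∑ y, J y) * Q ≤ Fintype.card (Sp B) := by
    rw [← hmassR, Finset.sum_mul]; exact Finset.sum_le_sum fun y _ => hlow y
  have s2 : (Fintype.card (Sp B) : ℝ) ≤ (∑ y, J y) * Q + Fintype.card ι * (2 / 2 ^ k) * Fintype.card (Sp B) := by
    nth_rewrite 1 [← hmassR]
    refine (Finset.sum_le_sum fun y _ => hup y).trans ?_
    rw [Finset.sum_add_distrib, ← Finset.sum_mul, Finset.sum_comm]
    have := Finset.sum_le_sum (fun i (_ : i ∈ (Finset.univ : Finset ι)) => hX i)
    rw [Finset.sum_const, nsmul_eq_mul, Finset.card_univ] at this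
    linarith
  rw [hQi]
  have e1 : (∑ y, J y) = ((∑ y, J y) * Q) * (1 / Q) := by field_simp
  change |(∑ y, J y) - _| ≤ _
  rw [e1, ← sub_mul, abs_mul, abs_of_pos (by positivity : (0 : ℝ) < 1 / Q), ← mul_assoc]
  apply mul_le_mul_of_nonneg_right _ (by positivity)
  rw [abs_le]
  have : (0 : ℝ) ≤ Fintype.card ι * (2 / 2 ^ k) * Fintype.card (Sp B) := by positivity
  constructor <;> linarith
end
end SpGen

namespace SpGen
open Module

/-- subsets of size at most two -/
def X2 {A : Type*} [DecidableEq A] (P : Finset A) : Finset (Finset A) :=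
  (Finset.range 3).biUnion fun j => P.powersetCard j

theorem mem_X2 {A : Type*} [DecidableEq A] {P x : Finset A} : x ∈ X2 P ↔ x ⊆ P ∧ x.card ≤ 2 := by
  simp only [X2, Finset.mem_biUnion, Finset.mem_range, Finset.mem_powersetCard]
  constructor
  · rintro ⟨j, h1, h2, rfl⟩; exact ⟨h2, by omega⟩
  · rintro ⟨h1, h2⟩; exact ⟨_, by omega, h1, rfl⟩

theorem sum_X2 {A : Type*} [DecidableEq A] (P : Finset A) (f : Finset A → ℝ) :
    ∑ x ∈ X2 P, f x = ∑ x ∈ P.powersetCard 0, f x + ∑ x ∈ P.powersetCard 1, f x + ∑ x ∈ P.powersetCard 2, f x := by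
  rw [X2, Finset.sum_biUnion]
  · simp [Finset.sum_range_succ]
  · intro i _ j _ hij
    exact Finset.pairwise_disjoint_powersetCard P hij

theorem sum_X2_const {A : Type*} [DecidableEq A] (P : Finset A) (w s : ℝ) :
    ∑ x ∈ X2 P, s ^ x.card * w ^ x.card = 1 + s * w * P.card + (s * w) ^ 2 * (P.card * (P.card - 1) / 2) := by
  have h : ∀ j, ∑ x ∈ P.powersetCard j, s ^ x.card * w ^ x.card = (P.card.choose j) * (s * w) ^ j := by
    intro j
    rw [← Finset.card_powersetCard, ← nsmul_eq_mul, ← Finset.sum_const]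
    refine Finset.sum_congr rfl fun x hx => ?_
    rw [(Finset.mem_powersetCard.1 hx).2, mul_pow]
  rw [sum_X2, h, h, h, Nat.cast_choose_two]
  simp; ring

theorem sum_X2_ind {A : Type*} [DecidableEq A] (P : Finset A) (g : A → ℝ) (hg : ∀ a, g a = 0 ∨ g a = 1) :
    (if ∀ a ∈ P, g a = 0 then (1 : ℝ) else 0) ≤ ∑ x ∈ X2 P, (-1) ^ x.card * ∏ a ∈ x, g a := by
  classical
  set N := (P.filter fun a => g a = 1).card with hN
  have h : ∀ j, ∑ x ∈ P.powersetCard j, (-1) ^ x.card * ∏ a ∈ x, g a = (-1) ^ j * (N.choose j : ℝ) := by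
    intro j
    rw [hN, ← Finset.card_powersetCard]
    have e : (P.filter fun a => g a = 1).powersetCard j = (P.powersetCard j).filter fun x => ∀ a ∈ x, g a = 1 := by
      ext x
      simp only [Finset.mem_powersetCard, Finset.mem_filter, Finset.subset_iff]
      constructor
      · rintro ⟨h1, h2⟩; exact ⟨⟨fun a ha => (h1 ha).1, h2⟩, fun a ha => (h1 ha).2⟩
      · rintro ⟨⟨h1, h2⟩, h3⟩; exact ⟨fun a ha => ⟨h1 ha, h3 a ha⟩, h2⟩
    rw [e, ← Finset.sum_boole, Finset.mul_sum]
    refine Finset.sum_congr rfl fun x hx => ?_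
    rw [(Finset.mem_powersetCard.1 hx).2]
    congr 1
    split_ifs with h
    · exact Finset.prod_eq_one h
    · push Not at h
      obtain ⟨a, ha, h1⟩ := h
      exact Finset.prod_eq_zero ha ((hg a).resolve_right h1)
  rw [sum_X2, h, h, h, Nat.cast_choose_two]
  have hN0 : (∀ a ∈ P, g a = 0) ↔ N = 0 := by
    rw [hN, Finset.card_eq_zero, Finset.filter_eq_empty_iff]
    constructor
    · intro h a ha; rw [h a ha]; norm_num
    · intro h a ha; exact (hg a).resolve_right (h ha)
  simp only [hN0]
  split_ifs with h0
  · rw [h0]; simp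
  · simp only [pow_zero, Nat.choose_zero_right, Nat.choose_one_right, pow_one]
    rcases Nat.lt_or_ge N 2 with h2 | h2
    · have : N = 1 := by omega
      rw [this]; norm_num
    · have : (2 : ℝ) ≤ N := by exact_mod_cast h2
      push_cast
      nlinarith

theorem bonf {Ω ι : Type*} [Fintype Ω] [Fintype ι] [DecidableEq ι] {A : ι → Type*} [∀ i, DecidableEq (A i)]
    (P : ∀ i, Finset (A i)) (J : ∀ i, A i → Ω → ℝ) (hJ : ∀ i a ω, J i a ω = 0 ∨ J i a ω = 1)
    (w : ι → ℝ) (hw : ∀ i, 0 ≤ w i) (hw1 : ∀ i, (P i).card * w i ≤ 1) (ε : ℝ) (hε : 0 ≤ ε)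
    (H : ∀ x : ∀ i, Finset (A i), (∀ i, x i ⊆ P i) → (∀ i, (x i).card ≤ 2) →
      |∑ ω, ∏ i, ∏ a ∈ x i, J i a ω - Fintype.card Ω * ∏ i, w i ^ (x i).card| ≤
        ε * (Fintype.card Ω * ∏ i, w i ^ (x i).card)) :
    (Nat.card {ω // ∀ i, ∀ a ∈ P i, J i a ω = 0} : ℝ) ≤
      Fintype.card Ω * (∏ i, (1 - (P i).card * w i + ((P i).card * w i) ^ 2 / 2) +
        ε * ∏ i, (1 + (P i).card * w i + ((P i).card * w i) ^ 2 / 2)) := by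
  classical
  have e1 : (Nat.card {ω // ∀ i, ∀ a ∈ P i, J i a ω = 0} : ℝ) = ∑ ω, ∏ i, (if ∀ a ∈ P i, J i a ω = 0 then (1 : ℝ) else 0) := by
    rw [Nat.card_eq_fintype_card, Fintype.card_subtype, ← Finset.sum_boole]
    refine Finset.sum_congr rfl fun ω _ => ?_
    rw [Finset.prod_ite_zero]
    simp
  rw [e1]
  have e2 : ∀ ω, ∏ i, (if ∀ a ∈ P i, J i a ω = 0 then (1 : ℝ) else 0) ≤
      ∑ x ∈ Fintype.piFinset fun i => X2 (P i), (∏ i, (-1 : ℝ) ^ (x i).card) * ∏ i, ∏ a ∈ x i, J i a ω := by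
    intro ω
    simp only [← Finset.prod_mul_distrib]
    rw [← Finset.prod_univ_sum (fun i => X2 (P i)) (fun i x => (-1 : ℝ) ^ x.card * ∏ a ∈ x, J i a ω)]
    refine Finset.prod_le_prod (fun i _ => by split_ifs <;> norm_num) fun i _ => sum_X2_ind _ _ fun a => hJ i a ω
  refine (Finset.sum_le_sum fun ω _ => e2 ω).trans ?_
  rw [Finset.sum_comm]
  simp only [← Finset.mul_sum]
  have e3 : ∀ x ∈ Fintype.piFinset fun i => X2 (P i), (∏ i, (-1 : ℝ) ^ (x i).card) * ∑ ω, ∏ i, ∏ a ∈ x i, J i a ω ≤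
      Fintype.card Ω * ∏ i, ((-1 : ℝ) ^ (x i).card * w i ^ (x i).card) +
        ε * (Fintype.card Ω * ∏ i, ((1 : ℝ) ^ (x i).card * w i ^ (x i).card)) := by
    intro x hx
    have hx' := fun i => mem_X2.1 (Fintype.mem_piFinset.1 hx i)
    have h := H x (fun i => (hx' i).1) (fun i => (hx' i).2)
    simp only [one_pow, one_mul, Finset.prod_mul_distrib]
    have hs : (∏ i, (-1 : ℝ) ^ (x i).card) = 1 ∨ (∏ i, (-1 : ℝ) ^ (x i).card) = -1 := by
      rw [Finset.prod_pow_eq_pow_sum]; exact neg_one_pow_eq_or ℝ _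
    rw [abs_le] at h
    rcases hs with hs | hs <;> rw [hs] <;> linarith [h.1, h.2]
  refine (Finset.sum_le_sum e3).trans ?_
  rw [Finset.sum_add_distrib, ← Finset.mul_sum, ← Finset.mul_sum, ← Finset.mul_sum,
    ← Finset.prod_univ_sum (fun i => X2 (P i)) (fun i x => (-1 : ℝ) ^ x.card * w i ^ x.card),
    ← Finset.prod_univ_sum (fun i => X2 (P i)) (fun i x => (1 : ℝ) ^ x.card * w i ^ x.card)]
  simp only [sum_X2_const]
  rw [mul_add, mul_left_comm ε]
  have hc : (0 : ℝ) ≤ Fintype.card Ω := by positivity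
  have key : ∀ i, (w i) ^ 2 * (P i).card * (P i).card / 2 ≥ (w i) ^ 2 * ((P i).card * ((P i).card - 1) / 2) := by
    intro i
    have : 0 ≤ (w i) ^ 2 * (P i).card := by positivity
    nlinarith
  apply add_le_add
  · apply mul_le_mul_of_nonneg_left _ hc
    refine Finset.prod_le_prod (fun i _ => ?_) fun i _ => ?_
    · rcases Nat.eq_zero_or_pos (P i).card with h | h
      · rw [h]; simp
      · have h1 : (1 : ℝ) ≤ (P i).card := by exact_mod_cast h
        have := hw1 i
        have h2 : 0 ≤ (w i) ^ 2 * ((P i).card * (((P i).card : ℝ) - 1) / 2) := by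
          have : (0 : ℝ) ≤ (P i).card - 1 := by linarith
          positivity
        nlinarith
    · have := key i; nlinarith
  · apply mul_le_mul_of_nonneg_left _ hc
    apply mul_le_mul_of_nonneg_left _ hε
    refine Finset.prod_le_prod (fun i _ => ?_) fun i _ => ?_
    · rcases Nat.eq_zero_or_pos (P i).card with h | h
      · rw [h]; simp
      · have h1 : (1 : ℝ) ≤ (P i).card := by exact_mod_cast h
        have : (0 : ℝ) ≤ (P i).card - 1 := by linarith
        have := hw i
        positivity
    · have := key i; nlinarith
end SpGen

namespace SpGen
open Module

theorem gen_of_ord {F K : Type*} [Field F] [Fintype F] [Field K] [Algebra F K] [FiniteDimensional F K] {d r : ℕ}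
    (hK : finrank F K = 2 * d) (hd : 1 ≤ d) (hr : ∀ i, r ∣ Fintype.card F ^ i - 1 → 2 * d ∣ i) {μ : K} (hμ0 : μ ≠ 0)
    (hμ : r ∣ orderOf μ) : Algebra.adjoin F {μ} = ⊤ := by
  have hfin := finite_of_fd F K
  set L := IntermediateField.adjoin F {μ} with hL
  have hLfin := finite_of_fd F L
  have hc : Nat.card L = Fintype.card F ^ finrank F L := by
    rw [Module.natCard_eq_pow_finrank (K := F), Nat.card_eq_fintype_card]
  let ν : L := ⟨μ, IntermediateField.mem_adjoin_simple_self F μ⟩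
  have hν0 : ν ≠ 0 := fun h => hμ0 (congrArg Subtype.val h)
  have hν : ν ^ (Nat.card L - 1) = 1 := by
    have := Fintype.ofFinite L
    rw [Nat.card_eq_fintype_card]
    exact FiniteField.pow_card_sub_one_eq_one ν hν0
  have hμ1 : μ ^ (Nat.card L - 1) = 1 := congrArg Subtype.val hν
  have h1 := hr (finrank F L) (by rw [← hc]; exact hμ.trans (orderOf_dvd_of_pow_eq_one hμ1))
  have h2 : finrank F L ∣ 2 * d := by rw [← hK, ← Module.finrank_mul_finrank F L K]; exact dvd_mul_right _ _
  have h3 : finrank F L = finrank F K := by rw [hK]; exact Nat.dvd_antisymm h2 h1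
  have h4 : L = ⊤ := IntermediateField.eq_of_le_of_finrank_eq le_top (by rw [h3]; exact IntermediateField.finrank_top'.symm)
  have h5 := IntermediateField.adjoin_simple_toSubalgebra_of_isAlgebraic (F := F) (α := μ) (Algebra.IsAlgebraic.isAlgebraic μ)
  rw [← h5, ← hL, h4]; rfl

/-- parameter data -/
structure PD (F : Type*) {K : Type*} [Field F] [Fintype F] [Field K] [Algebra F K] (d r : ℕ) (γ : K) (P : Finset K) : Prop where
  hK : finrank F K = 2 * d
  hd : 2 ≤ d
  hγ : bar F d γ = -γ
  hγ0 : γ ≠ 0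
  rp : r.Prime
  ro : ∀ i, r ∣ Fintype.card F ^ i - 1 → 2 * d ∣ i
  hμ : ∀ μ ∈ P, μ ^ (Fintype.card F ^ d + 1) = 1
  ord : ∀ μ ∈ P, r ∣ orderOf μ
  inj : ∀ μ ∈ P, ∀ μ' ∈ P, minpoly F μ = minpoly F μ' → μ = μ'
  up : P.card * (2 * d) ≤ Fintype.card F ^ d + 1
  low : Fintype.card F ^ d + 1 ≤ P.card * (2 * d + 1)

/-- existence of a block embedding -/
def EX {F K V : Type*} [Field F] [Fintype F] [Field K] [Algebra F K] [AddCommGroup V] [Module F V]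
    (B : LinearMap.BilinForm F V) (d : ℕ) (γ μ : K) (y : V ≃ₗ[F] V) : Prop :=
  ∃ φ : K →ₗ[F] V, (∀ a c, B (φ a) (φ c) = hform (F := F) d γ a c) ∧ ∀ a, y (φ a) = φ (μ * a)

section
variable {F V : Type*} [Field F] [Fintype F] [AddCommGroup V] [Module F V] [FiniteDimensional F V]
  {B : LinearMap.BilinForm F V}

theorem PD.bd {K : Type*} [Field K] [Algebra F K] [FiniteDimensional F K] {d r : ℕ} {γ : K} {P : Finset K}
    (p : PD F d r γ P) {μ : K} (h : μ ∈ P) : BD F d γ μ :=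
  ⟨p.hK, p.hd, p.hγ, p.hγ0, p.hμ μ h, gen_of_ord p.hK (by have := p.hd; omega) p.ro (T_ne (p.hμ μ h)) (p.ord μ h)⟩

theorem MB_EX {K : Type*} [Field K] [Algebra F K] [FiniteDimensional F K] {d : ℕ} {γ μ : K} (hμ : μ ^ (Fintype.card F ^ d + 1) = 1) (y : V ≃ₗ[F] V) :
    Nat.card (MB B d γ hμ y) = 0 ↔ ¬ EX B d γ μ y := by
  have := finite_of_fd F (K →ₗ[F] V)
  rw [Nat.card_eq_zero, or_iff_left (not_infinite_iff_finite.2 inferInstance), isEmpty_subtype]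
  constructor
  · rintro h ⟨φ, h1, h2⟩; exact h φ ⟨h1, fun a => by rw [mulE_apply]; exact h2 a⟩
  · rintro h φ ⟨h1, h2⟩; exact h ⟨φ, h1, fun a => by have := h2 a; rwa [mulE_apply] at this⟩

theorem step2 (hVa : B.IsAlt) (hV : B.Nondegenerate) (hodd : Odd (Fintype.card F)) (D : Finset ℕ)
    {K : ℕ → Type*} [∀ i, Field (K i)] [∀ i, Algebra F (K i)] [∀ i, FiniteDimensional F (K i)]
    {r : ℕ → ℕ} {γ : ∀ i, K i} {P : ∀ i, Finset (K i)} (p : ∀ d ∈ D, PD F d (r d) (γ d) (P d))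
    (hdim : ∑ d ∈ D, 4 * d ≤ finrank F V) (k : ℕ) (hk : ∀ d ∈ D, k ≤ d) [Fintype (Sp B)] :
    (Nat.card {y : Sp B // ∀ d ∈ D, ∀ μ ∈ P d, ¬ EX B d (γ d) μ y.1} : ℝ) ≤
      Fintype.card (Sp B) * (∏ d ∈ D, (1 - 1 / (4 * (d : ℝ))) + (2 * D.card) * (2 / 2 ^ k) * ∏ d ∈ D, (1 + 1 / (d : ℝ))) := by
  classical
  set q := Fintype.card F with hq
  have hb := bonf (Ω := Sp B) (ι := D) (A := fun i => K i.1) (fun i => P i.1)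
    (fun i μ y => if EX B i.1 (γ i.1) μ y.1 then 1 else 0) (fun i a ω => by split_ifs <;> simp)
    (fun i => 1 / ((q : ℝ) ^ i.1 + 1)) (fun i => by positivity)
    (fun i => by
      have h1 := (p i.1 i.2).up
      have h2 := (p i.1 i.2).hd
      rw [mul_one_div, div_le_one (by positivity)]
      have : (P i.1).card ≤ q ^ i.1 + 1 := le_trans (Nat.le_mul_of_pos_right _ (by omega)) h1
      exact_mod_cast this) ((2 * D.card) * (2 / 2 ^ k)) (by positivity) ?_
  · have e : ∀ y : Sp B, (∀ d ∈ D, ∀ μ ∈ P d, ¬ EX B d (γ d) μ y.1) ↔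
      (∀ i : D, ∀ a ∈ P i.1, (if EX B i.1 (γ i.1) a y.1 then (1 : ℝ) else 0) = 0) := by
      intro y
      simp
    simp only [e]
    refine hb.trans ?_
    apply mul_le_mul_of_nonneg_left _ (by positivity)
    rw [← Finset.prod_coe_sort D, ← Finset.prod_coe_sort D]
    have lam : ∀ i : D, 1 / (2 * (i.1 : ℝ) + 1) ≤ (P i.1).card * (1 / ((q : ℝ) ^ i.1 + 1)) ∧
      (P i.1).card * (1 / ((q : ℝ) ^ i.1 + 1)) ≤ 1 / (2 * (i.1 : ℝ)) := by
      intro i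
      have h1 := (p i.1 i.2).up
      have h0 := (p i.1 i.2).low
      have h2 := (p i.1 i.2).hd
      have h2' : (2 : ℝ) ≤ i.1 := by exact_mod_cast h2
      have h1' : ((P i.1).card : ℝ) * (2 * i.1) ≤ (q : ℝ) ^ i.1 + 1 := by exact_mod_cast h1
      have h0' : (q : ℝ) ^ i.1 + 1 ≤ ((P i.1).card : ℝ) * (2 * i.1 + 1) := by exact_mod_cast h0
      rw [mul_one_div, div_le_div_iff₀ (by positivity) (by positivity), div_le_div_iff₀ (by positivity) (by positivity)]
      constructor <;> linarith
    have bd : ∀ i : D, (2 : ℝ) ≤ i.1 := fun i => by exact_mod_cast (p i.1 i.2).hd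
    apply add_le_add
    · refine Finset.prod_le_prod (fun i _ => by nlinarith [sq_nonneg ((P i.1).card * (1 / ((q : ℝ) ^ i.1 + 1)) - 1)]) fun i _ => ?_
      obtain ⟨l1, l2⟩ := lam i
      have := bd i
      set l := (P i.1).card * (1 / ((q : ℝ) ^ i.1 + 1))
      have l3 : l ≤ 1 / 4 := l2.trans (by rw [div_le_div_iff₀] <;> linarith)
      have l0 : 0 ≤ l := le_trans (by positivity) l1
      have l4 : 1 / (4 * (i.1 : ℝ)) ≤ 7 / 8 * (1 / (2 * (i.1 : ℝ) + 1)) := by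
        rw [mul_one_div, div_le_div_iff₀] <;> linarith
      nlinarith
    · apply mul_le_mul_of_nonneg_left _ (by positivity)
      have l0 : ∀ i : D, 0 ≤ (P i.1).card * (1 / ((q : ℝ) ^ i.1 + 1)) := fun i => by positivity
      refine Finset.prod_le_prod (fun i _ => by have := l0 i; positivity) fun i _ => ?_
      obtain ⟨l1, l2⟩ := lam i
      have := bd i
      have l0 := l0 i
      set l := (P i.1).card * (1 / ((q : ℝ) ^ i.1 + 1))
      have l3 : l ≤ 1 / 4 := l2.trans (by rw [div_le_div_iff₀] <;> linarith)
      have l4 : 1 / (2 * (i.1 : ℝ)) = 1 / 2 * (1 / (i.1 : ℝ)) := by field_simp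
      nlinarith
  · intro x hx hx2
    have hs := step1 (ι := Σ i : D, {μ // μ ∈ x i}) (K := fun s => K s.1.1) hVa hV hodd (d := fun s => s.1.1)
      (γ := fun s => γ s.1.1) (μ := fun s => s.2.1) (fun s => (p _ s.1.2).bd (hx _ s.2.2)) ?_ ?_ k (fun s => hk _ s.1.2)
    · simp only [MB_EX, ite_not, Fintype.prod_sigma] at hs
      have e1 : ∀ y : Sp B, ∏ i : D, ∏ μ : {μ // μ ∈ x i}, (if EX B i.1 (γ i.1) μ.1 y.1 then (1 : ℝ) else 0) =
        ∏ i : D, ∏ μ ∈ x i, (if EX B i.1 (γ i.1) μ y.1 then (1 : ℝ) else 0) := fun y =>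
          Finset.prod_congr rfl fun i _ => Finset.prod_coe_sort (x i) (fun μ => if EX B i.1 (γ i.1) μ y.1 then (1 : ℝ) else 0)
      simp only [e1, Finset.prod_const, Finset.card_univ, Fintype.card_coe] at hs
      refine hs.trans ?_
      apply mul_le_mul_of_nonneg_right _ (by positivity)
      apply mul_le_mul_of_nonneg_right _ (by positivity)
      rw [Fintype.card_sigma]
      have : ∑ i : D, Fintype.card {μ // μ ∈ x i} ≤ ∑ i : D, 2 := Finset.sum_le_sum fun i _ => by rw [Fintype.card_coe]; exact hx2 i
      rw [Finset.sum_const, Finset.card_univ, Fintype.card_coe, smul_eq_mul, mul_comm] at this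
      exact_mod_cast this
    · rintro ⟨⟨d, hd⟩, μ, hμ⟩ ⟨⟨d', hd'⟩, μ', hμ'⟩ hne he
      apply hne
      have key : ∀ d (hd : d ∈ D), ∀ μ ∈ P d, (minpoly F μ).natDegree = 2 * d := by
        intro d hd μ hμ
        rw [← (p d hd).hK]
        have g := ((p d hd).bd hμ).gen
        have hi : IsIntegral F μ := IsIntegral.of_finite F μ
        rw [← IntermediateField.adjoin.finrank hi]
        have h5 := IntermediateField.adjoin_simple_toSubalgebra_of_isAlgebraic (F := F) (α := μ) (Algebra.IsAlgebraic.isAlgebraic μ)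
        rw [g] at h5
        have : IntermediateField.adjoin F {μ} = ⊤ := by
          rw [← IntermediateField.toSubalgebra_inj, h5]; rfl
        rw [this]; exact IntermediateField.finrank_top'
      have h1 := key d hd μ (hx ⟨d, hd⟩ hμ)
      have h2 := key d' hd' μ' (hx ⟨d', hd'⟩ hμ')
      simp only at he
      rw [he, h2] at h1
      obtain rfl : d' = d := by omega
      have := (p d' hd').inj μ (hx ⟨d', hd'⟩ hμ) μ' (hx ⟨d', hd'⟩ hμ') he
      subst this
      rfl
    · rw [Fintype.sum_sigma]
      refine le_trans ?_ hdim
      rw [← Finset.sum_coe_sort D]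
      refine Finset.sum_le_sum fun i _ => ?_
      simp only [Finset.sum_const, Finset.card_univ, Fintype.card_coe, smul_eq_mul]
      have := Nat.mul_le_mul_right (2 * i.1) (hx2 i)
      linarith
end
end SpGen

namespace SpGen
open Module

theorem zsig {q d : ℕ} (hq : 3 ≤ q) (hodd : Odd q) (hd : 2 ≤ d) : ∃ r : ℕ, r.Prime ∧ orderOf (q : ZMod r) = 2 * d := by
  by_contra! hno
  set n := 2 * d with hn
  set A := ((Polynomial.cyclotomic n ℤ).eval (q : ℤ)).natAbs with hAdef
  have hbig : (q - 1) ^ Nat.totient n < A := Polynomial.sub_one_pow_totient_lt_natAbs_cyclotomic_eval (by omega) (by omega)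
  have hA0 : A ≠ 0 := by omega
  have hdv : ∀ e ∈ n.properDivisors, (q ^ e - 1) * A ∣ q ^ n - 1 := by
    intro e he
    have h1 := map_dvd (Polynomial.evalRingHom (q : ℤ)) (Polynomial.X_pow_sub_one_mul_cyclotomic_dvd_X_pow_sub_one_of_dvd ℤ he)
    simp only [map_mul, map_sub, map_pow, map_one, Polynomial.coe_evalRingHom, Polynomial.eval_X] at h1
    have h2 := Int.natAbs_dvd_natAbs.2 h1
    rw [Int.natAbs_mul] at h2
    have e1 : ∀ i, ((q : ℤ) ^ i - 1).natAbs = q ^ i - 1 := by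
      intro i
      have : 1 ≤ q ^ i := Nat.one_le_pow _ _ (by omega)
      have h3 : ((q : ℤ) ^ i - 1) = ((q ^ i - 1 : ℕ) : ℤ) := by push_cast [Nat.cast_sub this]; rfl
      rw [h3, Int.natAbs_natCast]
    rw [e1, e1] at h2
    exact h2
  have hne : ∀ i, i ≠ 0 → q ^ i - 1 ≠ 0 := by
    intro i hi
    have := Nat.one_lt_pow hi (show 1 < q by omega)
    omega
  have hval : ∀ e ∈ n.properDivisors, ∀ r, r.Prime → padicValNat r (q ^ e - 1) + padicValNat r A ≤ padicValNat r (q ^ n - 1) := by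
    intro e he r hr
    have : Fact r.Prime := ⟨hr⟩
    have he0 : e ≠ 0 := by
      rintro rfl
      have := (Nat.mem_properDivisors.1 he).1
      rw [zero_dvd_iff] at this; omega
    rw [← padicValNat.mul (hne e he0) hA0]
    exact (padicValNat_dvd_iff_le (hne n (by omega))).1 (pow_padicValNat_dvd.trans (hdv e he))
  -- primes of A divide n
  have hpr : ∀ r, r.Prime → r ∣ A → r ∣ n := by
    intro r hr hrA
    by_contra hrn
    have hf : Fact r.Prime := ⟨hr⟩
    have : NeZero (n : ZMod r) := NeZero.of_not_dvd (ZMod r) hrn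
    have hroot : Polynomial.IsRoot (Polynomial.cyclotomic n (ZMod r)) (q : ZMod r) := by
      rw [Polynomial.IsRoot.def, ← Polynomial.map_cyclotomic_int n (ZMod r), Polynomial.eval_map]
      have h1 : Int.castRingHom (ZMod r) (q : ℤ) = (q : ZMod r) := by simp
      rw [← h1, Polynomial.eval₂_hom, Int.coe_castRingHom, ZMod.intCast_zmod_eq_zero_iff_dvd]
      exact Int.dvd_natAbs.1 (by exact_mod_cast hrA)
    exact hno r hr (Polynomial.isRoot_cyclotomic_iff.mp hroot).eq_orderOf.symm
  have hcop : ∀ r, r.Prime → r ∣ A → ¬ r ∣ q := by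
    intro r hr hrA h
    have h1 : r ∣ q ^ n - 1 := (hrA.trans (dvd_mul_left _ _)).trans (hdv 1 (by rw [Nat.mem_properDivisors]; exact ⟨one_dvd _, by omega⟩))
    have h2 : r ∣ q ^ n := h.trans (dvd_pow_self _ (by omega))
    have h3 : 1 ≤ q ^ n := Nat.one_le_pow _ _ (by omega)
    have := (Nat.dvd_sub h2 h1)
    rw [Nat.sub_sub_self h3] at this
    exact hr.one_lt.ne' (Nat.dvd_one.1 this)
  have h2q : ¬ 2 ∣ q := fun h => (Nat.not_even_iff_odd.2 hodd) (even_iff_two_dvd.2 h)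
  have hsq : ∀ r, r.Prime → r ∣ A → padicValNat r A ≤ 1 := by
    intro r hr hrA
    have hf : Fact r.Prime := ⟨hr⟩
    obtain ⟨e, he⟩ := hpr r hr hrA
    have he0 : e ≠ 0 := by rintro rfl; omega
    have hep : e ∈ n.properDivisors := by
      rw [Nat.mem_properDivisors]
      exact ⟨⟨r, by rw [he, mul_comm]⟩, by rw [he]; have := hr.two_le; nlinarith [Nat.pos_of_ne_zero he0]⟩
    have hv := hval e hep r hr
    rcases hr.eq_two_or_odd' with rfl | hro
    · obtain rfl : e = d := by omega
      rcases Nat.even_or_odd e with hev | hod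
      · have h1 := padicValNat.pow_two_sub_one (x := q) (by omega) h2q he0 hev
        have h2 := padicValNat.pow_two_sub_one (x := q) (n := n) (by omega) h2q (by omega) (by rw [hn]; exact even_two_mul e)
        have h3 : padicValNat 2 n = 1 + padicValNat 2 e := by
          rw [hn, padicValNat.mul (by norm_num) he0]; simp
        omega
      · have hv := hval 2 (by rw [Nat.mem_properDivisors]; exact ⟨⟨e, hn⟩, by omega⟩) 2 hr
        have h1 := padicValNat.pow_two_sub_one (x := q) (n := 2) (by omega) h2q (by norm_num) even_two
        have h2 := padicValNat.pow_two_sub_one (x := q) (n := n) (by omega) h2q (by omega) (by rw [hn]; exact even_two_mul e)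
        have h3 : padicValNat 2 n = 1 + padicValNat 2 e := by
          rw [hn, padicValNat.mul (by norm_num) he0]; simp
        have h4 : padicValNat 2 e = 0 := padicValNat.eq_zero_of_not_dvd (by rw [← even_iff_two_dvd]; exact Nat.not_even_iff_odd.2 hod)
        have h5 : padicValNat 2 2 = 1 := by simp
        omega
    · have hq1 : r ∣ q ^ e - 1 := by
        have h1 : r ∣ q ^ n - 1 := (hrA.trans (dvd_mul_left _ _)).trans (hdv e hep)
        have hge : ∀ i, 1 ≤ q ^ i := fun i => Nat.one_le_pow _ _ (by omega)
        rw [← CharP.cast_eq_zero_iff (ZMod r) r] at h1 ⊢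
        rw [Nat.cast_sub (hge _)] at h1 ⊢
        push_cast at h1 ⊢
        rw [he, mul_comm, pow_mul, ZMod.pow_card] at h1
        exact h1
      have h1 := padicValNat.pow_sub_pow (p := r) hro (x := q ^ e) (y := 1) (Nat.one_lt_pow he0 (by omega)) hq1
        (fun h => hcop r hr hrA (hr.dvd_of_dvd_pow h)) (n := r) hr.ne_zero
      rw [one_pow, ← pow_mul, mul_comm e r, ← he, padicValNat_self] at h1
      omega
  have hodd0 : Odd d → padicValNat 2 A = 0 := by
    intro hod
    have hv := hval 2 (by rw [Nat.mem_properDivisors]; exact ⟨⟨d, hn⟩, by omega⟩) 2 Nat.prime_two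
    have h1 := padicValNat.pow_two_sub_one (x := q) (n := 2) (by omega) h2q (by norm_num) even_two
    have h2 := padicValNat.pow_two_sub_one (x := q) (n := n) (by omega) h2q (by omega) (by rw [hn]; exact even_two_mul d)
    have h3 : padicValNat 2 n = 1 + padicValNat 2 d := by
      rw [hn, padicValNat.mul (by norm_num) (by omega)]; simp
    have h4 : padicValNat 2 d = 0 := padicValNat.eq_zero_of_not_dvd (by rw [← even_iff_two_dvd]; exact Nat.not_even_iff_odd.2 hod)
    have h5 : padicValNat 2 2 = 1 := by simp
    omega
  obtain ⟨f, n', hn', hdn⟩ := Nat.exists_eq_two_pow_mul_odd (n := d) (by omega)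
  have hdvd : ∀ M, (∀ r, r.Prime → r ∣ A → r ∣ M) → A ∣ M := by
    intro M hM
    rw [Nat.dvd_iff_prime_pow_dvd_dvd]
    intro r k hr hk
    have hf : Fact r.Prime := ⟨hr⟩
    rcases k with _ | _ | k
    · simp
    · rw [zero_add, pow_one] at hk ⊢; exact hM r hr hk
    · exfalso
      have h1 : r ∣ A := (dvd_pow_self r (by omega)).trans hk
      have h2 := hsq r hr h1
      have h3 := (padicValNat_dvd_iff_le hA0).1 hk
      omega
  have hn'0 : 0 < n' := hn'.pos
  have eul : n' + 1 ≤ 2 ^ Nat.totient n' := by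
    have h1 := Nat.ModEq.pow_totient (Nat.coprime_two_left.2 hn')
    have h2 : 1 ≤ 2 ^ Nat.totient n' := Nat.one_le_pow _ _ (by norm_num)
    have h3 := (Nat.modEq_iff_dvd' h2).1 h1.symm
    have h4 : 2 ≤ 2 ^ Nat.totient n' := Nat.le_self_pow (Nat.totient_pos.2 hn'0).ne' 2
    have := Nat.le_of_dvd (by omega) h3
    omega
  have htot : Nat.totient n = 2 ^ f * Nat.totient n' := by
    have : n = 2 ^ (f + 1) * n' := by rw [hn, hdn, pow_succ]; ring
    rw [this, Nat.totient_mul ((Nat.coprime_two_left.2 hn').pow_left _), Nat.totient_prime_pow Nat.prime_two (by omega)]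
    simp
  have hbig2 : 2 ^ Nat.totient n < A := lt_of_le_of_lt (Nat.pow_le_pow_left (by omega) _) hbig
  rcases Nat.eq_zero_or_pos f with rfl | hf
  · rw [pow_zero, one_mul] at hdn htot
    have : A ∣ n' := hdvd n' fun r hr hrA => by
      have h1 := hpr r hr hrA
      rw [hn, hdn] at h1
      rcases (Nat.Prime.dvd_mul hr).1 h1 with h | h
      · obtain rfl := (Nat.prime_dvd_prime_iff_eq hr Nat.prime_two).1 h
        have := hodd0 (by rwa [hdn])
        have := (padicValNat_dvd_iff_le (p := 2) (n := 1) hA0).1 (by simpa using hrA)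
        omega
      · exact h
    have := Nat.le_of_dvd hn'0 this
    rw [htot] at hbig2
    omega
  · have : A ∣ 2 * n' := hdvd _ fun r hr hrA => by
      have h1 := hpr r hr hrA
      rw [hn, hdn] at h1
      rcases (Nat.Prime.dvd_mul hr).1 h1 with h | h
      · exact h.trans (dvd_mul_right _ _)
      · rcases (Nat.Prime.dvd_mul hr).1 h with h | h
        · exact (hr.dvd_of_dvd_pow h).trans (dvd_mul_right _ _)
        · exact h.trans (dvd_mul_left _ _)
    have h1 := Nat.le_of_dvd (by omega) this
    have h2 : 2 * Nat.totient n' ≤ Nat.totient n := by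
      rw [htot]; exact Nat.mul_le_mul_right _ (Nat.le_self_pow hf.ne' 2)
    have h3 : (n' + 1) ^ 2 ≤ 2 ^ Nat.totient n := by
      calc (n' + 1) ^ 2 ≤ (2 ^ Nat.totient n') ^ 2 := Nat.pow_le_pow_left eul 2
        _ = 2 ^ (2 * Nat.totient n') := by rw [← pow_mul, mul_comm]
        _ ≤ _ := Nat.pow_le_pow_right (by norm_num) h2
    nlinarith

theorem zsig' {q d : ℕ} (hq : 3 ≤ q) (hodd : Odd q) (hd : 2 ≤ d) :
    ∃ r : ℕ, r.Prime ∧ 2 * d + 1 ≤ r ∧ r ∣ q ^ d + 1 ∧ ∀ i, r ∣ q ^ i - 1 → 2 * d ∣ i := by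
  obtain ⟨r, hr, ho⟩ := zsig hq hodd hd
  have hf : Fact r.Prime := ⟨hr⟩
  have hge : ∀ i, 1 ≤ q ^ i := fun i => Nat.one_le_pow _ _ (by omega)
  have hiff : ∀ i, r ∣ q ^ i - 1 ↔ 2 * d ∣ i := by
    intro i
    rw [← ho, orderOf_dvd_iff_pow_eq_one, ← CharP.cast_eq_zero_iff (ZMod r) r, Nat.cast_sub (hge _), sub_eq_zero]
    push_cast; rfl
  refine ⟨r, hr, ?_, ?_, fun i => (hiff i).1⟩
  · have hq0 : (q : ZMod r) ≠ 0 := by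
      intro h
      rw [h, orderOf_zero] at ho
      omega
    have := ZMod.orderOf_dvd_card_sub_one hq0
    rw [ho] at this
    have h1 := Nat.le_of_dvd (by have := hr.two_le; omega) this
    have := hr.two_le
    omega
  · have h1 := (hiff (2 * d)).2 dvd_rfl
    have h2 : q ^ (2 * d) - 1 = (q ^ d + 1) * (q ^ d - 1) := by
      rw [mul_comm 2 d, pow_mul, ← Nat.sq_sub_sq, one_pow]
    rw [h2] at h1
    rcases (Nat.Prime.dvd_mul hr).1 h1 with h | h
    · exact h
    · have := Nat.le_of_dvd (by omega) ((hiff d).1 h)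
      omega
end SpGen

namespace SpGen
open Module

theorem exists_PD {F K : Type*} [Field F] [Fintype F] [Field K] [Algebra F K] [FiniteDimensional F K] {d : ℕ}
    (hK : finrank F K = 2 * d) (hd : 2 ≤ d) (hodd : Odd (Fintype.card F)) :
    ∃ r γ, ∃ P : Finset K, PD F d r γ P := by
  classical
  set q := Fintype.card F with hq
  have hq3 : 3 ≤ q := by
    have h1 : 1 < q := Fintype.one_lt_card
    obtain ⟨k, hk⟩ := hodd
    omega
  obtain ⟨γ, hγ, hγ0⟩ := exists_gamma hK (by omega)
  obtain ⟨r, hr, hr1, ⟨u, hu⟩, hro⟩ := zsig' hq3 hodd hd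
  set S := (TT F K d).filter fun μ => r ∣ orderOf μ with hS
  have hu0 : 0 < u := by rcases Nat.eq_zero_or_pos u with h | h; · rw [h] at hu; omega
                         · exact h
  have hSc : (r - 1) * u ≤ S.card := by
    have h1 := Finset.card_filter_add_card_filter_not (s := TT F K d) (fun μ => r ∣ orderOf μ)
    rw [card_TT hK, ← hS, ← hq, hu] at h1
    have h2 : ((TT F K d).filter fun μ => ¬ r ∣ orderOf μ).card ≤ u := by
      refine le_trans (Finset.card_le_card ?_) (show (Polynomial.nthRootsFinset u (1 : K)).card ≤ u from by
        rw [Polynomial.nthRootsFinset]; exact (Multiset.toFinset_card_le _).trans (Polynomial.card_nthRoots u (1 : K)))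
      intro μ hμ
      obtain ⟨h3, h4⟩ := Finset.mem_filter.1 hμ
      rw [mem_TT, ← hq, hu] at h3
      rw [Polynomial.mem_nthRootsFinset hu0]
      rw [← orderOf_dvd_iff_pow_eq_one]
      have h5 := orderOf_dvd_of_pow_eq_one h3
      exact (Nat.Coprime.dvd_mul_left ((Nat.coprime_comm.1 ((Nat.Prime.coprime_iff_not_dvd hr).2 h4)))).1 h5
    rw [Nat.sub_mul, one_mul]
    omega
  have hex : ∀ f : Polynomial F, ∃ μ : K, (∃ ν ∈ S, minpoly F ν = f) → μ ∈ S ∧ minpoly F μ = f := by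
    intro f
    by_cases h : ∃ ν ∈ S, minpoly F ν = f
    · obtain ⟨ν, h1, h2⟩ := h; exact ⟨ν, fun _ => ⟨h1, h2⟩⟩
    · exact ⟨0, fun h' => absurd h' h⟩
  choose rep hrep using hex
  set P := S.image fun μ => rep (minpoly F μ) with hP
  have hPS : ∀ μ ∈ P, μ ∈ S ∧ rep (minpoly F μ) = μ := by
    intro μ hμ
    obtain ⟨ν, hν, rfl⟩ := Finset.mem_image.1 hμ
    have := hrep (minpoly F ν) ⟨ν, hν, rfl⟩
    exact ⟨this.1, by rw [this.2]⟩
  have hgen : ∀ μ ∈ S, Algebra.adjoin F {μ} = ⊤ := by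
    intro μ hμ
    obtain ⟨h3, h4⟩ := Finset.mem_filter.1 hμ
    exact gen_of_ord hK (by omega) hro (T_ne (mem_TT.1 h3)) h4
  have hinj : ∀ μ ∈ P, ∀ μ' ∈ P, minpoly F μ = minpoly F μ' → μ = μ' := by
    intro μ h μ' h' e
    rw [← (hPS μ h).2, ← (hPS μ' h').2, e]
  have hbi : ∀ i, Function.Injective (bar F i : K →ₐ[F] K) := fun i => (bar F i : K →ₐ[F] K).injective
  have hbm : ∀ i (μ : K), minpoly F (bar F i μ) = minpoly F μ := fun i μ => minpoly.algHom_eq (bar F i) (hbi i) μ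
  refine ⟨r, γ, P, hK, hd, hγ, hγ0, hr, hro, fun μ hμ => mem_TT.1 (Finset.mem_filter.1 (hPS μ hμ).1).1,
    fun μ hμ => (Finset.mem_filter.1 (hPS μ hμ).1).2, hinj, ?_, ?_⟩
  · rw [← card_TT hK, ← Finset.card_range (2 * d), ← Finset.card_product]
    refine Finset.card_le_card_of_injOn (fun p => bar F p.2 p.1) ?_ ?_
    · rintro ⟨μ, i⟩ h
      have h := Finset.mem_product.1 h
      have h1 := mem_TT.1 (Finset.mem_filter.1 (hPS μ h.1).1).1
      show bar F i μ ∈ _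
      rw [Finset.mem_coe, mem_TT, ← map_pow (bar F i), h1, map_one]
    · rintro ⟨μ, i⟩ h ⟨μ', j⟩ h' e
      have h := Finset.mem_product.1 h
      have h' := Finset.mem_product.1 h'
      simp only [Finset.mem_range] at h h'
      simp only at e
      have e1 := congrArg (minpoly F) e
      rw [hbm, hbm] at e1
      have e2 := hinj μ h.1 μ' h'.1 e1
      subst e2
      have := bar_order (hgen μ (hPS μ h.1).1) e
      rw [hK] at this
      rw [Nat.ModEq.eq_of_lt_of_lt this h.2 h'.2]
  · have h1 : S.card ≤ P.card * (2 * d) := by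
      rw [← Finset.card_range (2 * d), ← Finset.card_product]
      refine le_trans (Finset.card_le_card ?_) (Finset.card_image_le (f := fun p : K × ℕ => bar F p.2 p.1))
      intro ν hν
      have h := hrep (minpoly F ν) ⟨ν, hν, rfl⟩
      obtain ⟨i, hi, e⟩ := conj_pow (ν := rep (minpoly F ν)) (ν' := ν) (by rw [h.2]; exact minpoly.aeval F ν)
      rw [Finset.mem_image]
      refine ⟨(rep (minpoly F ν), i), ?_, e.symm⟩
      rw [Finset.mem_product, Finset.mem_range, ← hK]
      exact ⟨Finset.mem_image.2 ⟨ν, hν, rfl⟩, hi⟩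
    have h2 := hSc.trans h1
    rw [← hq, hu]
    obtain ⟨r, rfl⟩ : ∃ r', r = r' + 1 := ⟨r - 1, by omega⟩
    rw [Nat.add_sub_cancel] at h2
    by_contra! h
    nlinarith [Nat.mul_le_mul_right (2 * d + 1) h2, Nat.mul_le_mul_right u (show 2 * d ≤ r by omega)]
end SpGen

namespace SpGen
open Module

/-- a block together with an orthogonal equivariant copy of `K'` -/
def Bad {F K V : Type*} [Field F] [Fintype F] [Field K] [Algebra F K] [AddCommGroup V] [Module F V]
    (B : LinearMap.BilinForm F V) (d : ℕ) (γ μ : K) (K' : Type*) [Field K'] [Algebra F K'] (y : V ≃ₗ[F] V) : Prop :=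
  ∃ φ : K →ₗ[F] V, ((∀ a c, B (φ a) (φ c) = hform (F := F) d γ a c) ∧ ∀ a, y (φ a) = φ (μ * a)) ∧
    ∃ ν : K', Algebra.adjoin F {ν} = ⊤ ∧ ∃ ψ : K' →ₗ[F] V, ψ ≠ 0 ∧ (∀ a, y (ψ a) = ψ (ν * a)) ∧ ∀ a c, B (ψ a) (φ c) = 0

section
variable {F K K' V : Type*} [Field F] [Fintype F] [AddCommGroup V] [Module F V] [FiniteDimensional F V]
  {B : LinearMap.BilinForm F V} [Field K] [Algebra F K] [FiniteDimensional F K] [Field K'] [Algebra F K'] [FiniteDimensional F K']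
  {d e : ℕ} {γ μ : K} {y : V ≃ₗ[F] V}

theorem PP_lower2 (b : BD F d γ μ) (hodd : Odd (Fintype.card F)) {ν : K'} (hν : Algebra.adjoin F {ν} = ⊤) {φ : K →ₗ[F] V} {ψ : K' →ₗ[F] V}
    (h : (φ, ψ) ∈ PP (hform (F := F) d γ) B (mulE F μ (T_ne b.hμ)) ν y) :
    (Fintype.card F ^ d + 1) * (Nat.card K' - 1) ≤ Nat.card (PP (hform (F := F) d γ) B (mulE F μ (T_ne b.hμ)) ν y) := by
  have := finite_of_fd F K'
  have := finite_of_fd F (K' →ₗ[F] V)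
  have := finite_of_fd F (K →ₗ[F] V)
  obtain ⟨h1, h2, h3, h4⟩ := h
  rw [← Nat.card_units, ← card_TT b.hK, ← Nat.card_eq_finsetCard, ← Nat.card_prod]
  refine Nat.card_le_card_of_injective (fun p => ⟨(φ ∘ₗ LinearMap.mulLeft F p.1.1, ψ ∘ₗ LinearMap.mulLeft F (p.2 : K')), ?_⟩) ?_
  · refine ⟨MB_T b h1 (mem_TT.1 p.1.2), ?_, ?_, ?_⟩
    · intro h0
      apply h2
      ext a
      have := congrArg (fun f : K' →ₗ[F] V => f ((p.2 : K')⁻¹ * a)) h0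
      simpa using this
    · intro a
      simp only [LinearMap.comp_apply, LinearMap.mulLeft_apply, h3]
      congr 1; ring
    · intro a b; exact h4 _ _
  · rintro ⟨t, a⟩ ⟨t', a'⟩ h
    have h5 := (Prod.ext_iff.1 (Subtype.ext_iff.1 h)).1
    have h6 := (Prod.ext_iff.1 (Subtype.ext_iff.1 h)).2
    simp only at h5 h6
    have e1 := congrArg (fun f : K →ₗ[F] V => f 1) h5
    have e2 := congrArg (fun f : K' →ₗ[F] V => f 1) h6
    simp only [LinearMap.comp_apply, LinearMap.mulLeft_apply, mul_one] at e1 e2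
    rw [Units.ext (eqv_inj hν h2 h3 e2), Subtype.ext (iso_inj (hform_nd b.hK hodd b.hγ b.hγ0) φ h1.1 e1)]

theorem bad_lower (b : BD F d γ μ) (hodd : Odd (Fintype.card F)) (h : Bad B d γ μ K' y) (G : Finset K')
    (hG : ∀ ν, ν ∈ G ↔ Algebra.adjoin F {ν} = ⊤ ∧ ν ≠ 0) :
    finrank F K' * ((Fintype.card F ^ d + 1) * (Nat.card K' - 1)) ≤
      ∑ ν ∈ G, Nat.card (PP (hform (F := F) d γ) B (mulE F μ (T_ne b.hμ)) ν y) := by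
  classical
  have := finite_of_fd F K'
  obtain ⟨φ, ⟨h1, h2⟩, ν, hν, ψ, h3, h4, h5⟩ := h
  have hν0 : ν ≠ 0 := by
    rintro rfl
    apply h3
    ext a
    have := h4 a
    rw [zero_mul, map_zero] at this
    simpa using this
  have hfin := Fintype.ofFinite (K' ≃ₐ[F] K')
  have hinj : Function.Injective fun σ : K' ≃ₐ[F] K' => σ.symm ν := by
    intro σ τ h
    have : (σ.symm : K' →ₐ[F] K') = τ.symm := AlgHom.ext_of_adjoin_eq_top hν (by intro x hx; rw [Set.mem_singleton_iff.1 hx]; exact h)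
    have h' : σ.symm = τ.symm := AlgEquiv.ext fun x => congrArg (fun f : K' →ₐ[F] K' => f x) this
    rw [← AlgEquiv.symm_symm σ, h', AlgEquiv.symm_symm]
  have hgen : ∀ σ : K' ≃ₐ[F] K', Algebra.adjoin F {σ.symm ν} = ⊤ := by
    intro σ
    have := AlgHom.map_adjoin (σ.symm : K' →ₐ[F] K') {ν}
    rw [hν, Algebra.map_top, Set.image_singleton] at this
    rw [AlgEquiv.coe_toAlgHom] at this
    rw [← this]
    exact (AlgHom.range_eq_top _).2 σ.symm.surjective
  have hsub : (Finset.univ.image fun σ : K' ≃ₐ[F] K' => σ.symm ν) ⊆ G := by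
    intro x hx
    obtain ⟨σ, -, rfl⟩ := Finset.mem_image.1 hx
    exact (hG _).2 ⟨hgen σ, by simpa using hν0⟩
  refine le_trans ?_ (Finset.sum_le_sum_of_subset hsub)
  rw [Finset.sum_image (fun σ _ τ _ h => hinj h)]
  have hcard : Fintype.card (K' ≃ₐ[F] K') = finrank F K' := by
    rw [← Nat.card_eq_fintype_card]; exact IsGalois.card_aut_eq_finrank F K'
  rw [← hcard, ← Finset.card_univ, ← smul_eq_mul, ← Finset.sum_const]
  refine Finset.sum_le_sum fun σ _ => ?_
  refine PP_lower2 b hodd (hgen σ) (φ := φ) (ψ := ψ ∘ₗ σ.toLinearMap) ⟨⟨h1, fun a => by rw [mulE_apply]; exact h2 a⟩, ?_, ?_, ?_⟩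
  · intro h0
    apply h3
    ext a
    have := congrArg (fun f : K' →ₗ[F] V => f (σ.symm a)) h0
    simpa using this
  · intro a
    simp only [LinearMap.comp_apply, AlgEquiv.toLinearMap_apply, h4, map_mul, AlgEquiv.apply_symm_apply]
  · intro a c; exact h5 _ _

theorem bad_card (hVa : B.IsAlt) (hV : B.Nondegenerate) (b : BD F d γ μ) (hodd : Odd (Fintype.card F))
    (he : finrank F K' = 2 * e) (he1 : 1 ≤ e) [Fintype (Sp B)] :
    Nat.card {y : Sp B // Bad B d γ μ K' y.1} * (2 * e * (Fintype.card F ^ d + 1)) ≤ 4 * Fintype.card (Sp B) := by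
  classical
  have hfin := finite_of_fd F K'
  have := Fintype.ofFinite K'
  set q := Fintype.card F with hq
  have hq2 : 2 ≤ q := Fintype.one_lt_card
  set G := (Finset.univ : Finset K').filter fun ν => Algebra.adjoin F {ν} = ⊤ ∧ ν ≠ 0 with hG
  have hGm : ∀ ν, ν ∈ G ↔ Algebra.adjoin F {ν} = ⊤ ∧ ν ≠ 0 := fun ν => by simp [hG]
  have hx2 : 2 ≤ q ^ e := le_trans hq2 (Nat.le_self_pow (by omega) q)
  have hcK : Nat.card K' = q ^ e * q ^ e := by rw [card_E he, two_mul, pow_add]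
  have h1 : Nat.card {y : Sp B // Bad B d γ μ K' y.1} * (2 * e * ((q ^ d + 1) * (Nat.card K' - 1))) ≤
      ∑ y : Sp B, ∑ ν ∈ G, Nat.card (PP (hform (F := F) d γ) B (mulE F μ (T_ne b.hμ)) ν y.1) := by
    rw [Nat.card_eq_fintype_card, Fintype.card_subtype, ← smul_eq_mul, ← Finset.sum_const]
    refine le_trans ?_ (Finset.sum_le_sum_of_subset (Finset.filter_subset (fun y : Sp B => Bad B d γ μ K' y.1) _))
    refine Finset.sum_le_sum fun y hy => ?_
    rw [← he]
    exact bad_lower b hodd (Finset.mem_filter.1 hy).2 G hGm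
  have h2 : ∑ ν ∈ G, Nat.card (Inv (F := F) ν) ≤ 4 * (Nat.card K' - 1) := by
    have h3 : ∀ ν ∈ G, Nat.card (Inv (F := F) ν) ≤ (if ν ∈ TT F K' e then q ^ e else 0) + 1 := by
      intro ν hν
      obtain ⟨hg, h0⟩ := (hGm ν).1 hν
      split_ifs with ht
      · exact (Inv_card_T he he1 hg (mem_TT.1 ht)).trans (Nat.le_succ _)
      · exact (Inv_card_nT he he1 hg h0 (fun h => ht (mem_TT.2 h)))
    refine (Finset.sum_le_sum h3).trans ?_
    refine (Finset.sum_le_sum_of_subset (Finset.subset_univ G)).trans ?_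
    rw [Finset.sum_add_distrib, Finset.sum_ite_mem, Finset.univ_inter, Finset.sum_const, Finset.sum_const, card_TT he,
      Finset.card_univ, ← Nat.card_eq_fintype_card (α := K'), hcK, ← hq]
    simp only [smul_eq_mul]
    obtain ⟨x, hx⟩ : ∃ x, q ^ e = x + 2 := ⟨q ^ e - 2, by omega⟩
    rw [hx]
    have : (x + 2) * (x + 2) - 1 = x * x + 4 * x + 3 := by
      have : (x + 2) * (x + 2) = x * x + 4 * x + 3 + 1 := by ring
      omega
    rw [this]
    nlinarith
  have h3 : ∑ y : Sp B, ∑ ν ∈ G, Nat.card (PP (hform (F := F) d γ) B (mulE F μ (T_ne b.hμ)) ν y.1) ≤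
      4 * (Nat.card K' - 1) * Fintype.card (Sp B) := by
    rw [Finset.sum_comm]
    refine le_trans (Finset.sum_le_sum fun ν hν => PP_mass hVa hV _ (hform_nd b.hK hodd b.hγ b.hγ0) ((hGm ν).1 hν).1 ((hGm ν).1 hν).2) ?_
    rw [← Finset.sum_mul, Nat.card_eq_fintype_card (α := Sp B)]
    exact Nat.mul_le_mul_right _ h2
  have h4 := h1.trans h3
  have h5 : 0 < Nat.card K' - 1 := by
    rw [hcK]
    have := Nat.mul_le_mul hx2 hx2
    omega
  refine Nat.le_of_mul_le_mul_right (c := Nat.card K' - 1) ?_ h5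
  calc _ = Nat.card {y : Sp B // Bad B d γ μ K' y.1} * (2 * e * ((q ^ d + 1) * (Nat.card K' - 1))) := by ring
    _ ≤ _ := h4
    _ = _ := by ring
end
end SpGen

namespace SpGen
open Module

theorem exists_root {F K : Type*} [Field F] [Fintype F] [Field K] [Algebra F K] [FiniteDimensional F K]
    {f : Polynomial F} (hf : Irreducible f) (hd : f.natDegree = finrank F K) :
    ∃ ν : K, Algebra.adjoin F {ν} = ⊤ ∧ ∀ g : Polynomial F, Polynomial.aeval ν g = 0 ↔ f ∣ g := by
  have := finite_of_fd F K
  have := Fintype.ofFinite K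
  have h1 : f ∣ Polynomial.X ^ Fintype.card K - Polynomial.X := by
    have h := (hf.natDegree_dvd_iff_dvd_X_pow_card_pow_sub_X (n := finrank F K)).1 (by rw [hd])
    rwa [← Module.natCard_eq_pow_finrank (K := F) (V := K), Nat.card_eq_fintype_card] at h
  have h2 := (FiniteField.isSplittingField_sub K F).splits
  have h3 := h2.of_dvd (by
    rw [Polynomial.map_ne_zero_iff (algebraMap F K).injective]
    exact FiniteField.X_pow_card_sub_X_ne_zero F Fintype.one_lt_card) (Polynomial.map_dvd (algebraMap F K) h1)
  obtain ⟨ν, hν⟩ := h3.exists_eval_eq_zero (by rw [Polynomial.degree_map]; exact (Polynomial.degree_pos_of_irreducible hf).ne')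
  rw [Polynomial.eval_map_algebraMap] at hν
  have hint : IsIntegral F ν := IsIntegral.of_finite F ν
  have hass : Associated (minpoly F ν) f := (minpoly.irreducible hint).associated_of_dvd hf (minpoly.dvd F ν hν)
  refine ⟨ν, ?_, fun g => ?_⟩
  · have h3 : finrank F (IntermediateField.adjoin F {ν}) = finrank F K := by
      rw [IntermediateField.adjoin.finrank hint, ← hd]
      exact Polynomial.natDegree_eq_of_degree_eq (Polynomial.degree_eq_degree_of_associated hass)
    have h4 : IntermediateField.adjoin F {ν} = ⊤ := IntermediateField.eq_of_le_of_finrank_eq le_top (by rw [h3]; exact IntermediateField.finrank_top'.symm)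
    have h5 := IntermediateField.adjoin_simple_toSubalgebra_of_isAlgebraic (F := F) (α := ν) (Algebra.IsAlgebraic.isAlgebraic ν)
    rw [← h5, h4]; rfl
  · rw [← hass.dvd_iff_dvd_left, minpoly.dvd_iff]

theorem psi_of_ker {F K W : Type*} [Field F] [Field K] [Algebra F K] [AddCommGroup W] [Module F W]
    {T : W →ₗ[F] W} {f : Polynomial F} {w : W} (hw : w ≠ 0) (hfw : Polynomial.aeval T f w = 0) {ν : K}
    (hν : Algebra.adjoin F {ν} = ⊤) (hker : ∀ g : Polynomial F, Polynomial.aeval ν g = 0 → f ∣ g) :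
    ∃ ψ : K →ₗ[F] W, ψ ≠ 0 ∧ ∀ a, T (ψ a) = ψ (ν * a) := by
  have hsurj : Function.Surjective (Polynomial.aeval ν : Polynomial F →ₐ[F] K).toLinearMap := by
    intro a
    have : a ∈ Algebra.adjoin F {ν} := by rw [hν]; trivial
    rw [Algebra.adjoin_singleton_eq_range_aeval] at this
    exact this
  obtain ⟨s, hs⟩ := LinearMap.exists_rightInverse_of_surjective _ (LinearMap.range_eq_top.2 hsurj)
  have hs' : ∀ a, Polynomial.aeval ν (s a) = a := fun a => LinearMap.congr_fun hs a
  have hz : ∀ g g' : Polynomial F, Polynomial.aeval ν g = Polynomial.aeval ν g' → Polynomial.aeval T g w = Polynomial.aeval T g' w := by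
    intro g g' h
    obtain ⟨c, hc⟩ := hker (g - g') (by rw [map_sub, h, sub_self])
    have : Polynomial.aeval T (g - g') w = 0 := by
      rw [hc, mul_comm, map_mul, Module.End.mul_apply, hfw, map_zero]
    rw [map_sub, LinearMap.sub_apply, sub_eq_zero] at this
    exact this
  refine ⟨(LinearMap.applyₗ w ∘ₗ (Polynomial.aeval T : Polynomial F →ₐ[F] Module.End F W).toLinearMap) ∘ₗ s, ?_, ?_⟩
  · intro h0
    have h1 := LinearMap.congr_fun h0 1
    have h2 := hz (s 1) 1 (by rw [hs', map_one])
    apply hw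
    have h2' : Polynomial.aeval T (s 1) w = w := by rw [h2, map_one (Polynomial.aeval T)]; rfl
    exact h2'.symm.trans h1
  · intro a
    have h2 := hz (Polynomial.X * s a) (s (ν * a)) (by rw [map_mul, hs', hs', Polynomial.aeval_X])
    rw [map_mul, Polynomial.aeval_X] at h2
    exact h2

theorem ker_of_factor {F W : Type*} [Field F] [AddCommGroup W] [Module F W] [FiniteDimensional F W]
    {T : Module.End F W} {f : Polynomial F} (hf : Irreducible f) (hd : f ∣ minpoly F T) :
    ∃ w : W, w ≠ 0 ∧ Polynomial.aeval T f w = 0 := by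
  by_contra! h
  obtain ⟨g, hg⟩ := hd
  have h0 : minpoly F T ≠ 0 := minpoly.ne_zero (Algebra.IsIntegral.isIntegral T)
  have h1 : Polynomial.aeval T g = 0 := by
    ext w
    by_contra hw
    apply h (Polynomial.aeval T g w) hw
    rw [← Module.End.mul_apply, ← map_mul, ← hg, minpoly.aeval]; rfl
  have h2 := minpoly.dvd F T h1
  have hg0 : g ≠ 0 := by rintro rfl; rw [mul_zero] at hg; exact h0 hg
  rw [hg] at h2
  exact hf.not_isUnit (isUnit_of_mul_isUnit_left (isUnit_of_dvd_one (by
    have : f * g ∣ 1 * g := by rwa [one_mul]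
    exact (mul_dvd_mul_iff_right hg0).1 this) |> fun h => (show IsUnit (f * 1) by rwa [mul_one])))

theorem dvd_pow_of_factors {F : Type*} [Field F] (g : Polynomial F) (M : Polynomial F) (hM : M ≠ 0)
    (h : ∀ f, Irreducible f → f ∣ M → f ∣ g) : ∃ n, M ∣ g ^ n := by
  induction M using UniqueFactorizationMonoid.induction_on_prime with
  | h₁ => exact absurd rfl hM
  | h₂ x hx => exact ⟨0, hx.dvd⟩
  | h₃ a p ha hp ih =>
    obtain ⟨n, hn⟩ := ih ha fun f hf hd => h f hf (hd.trans (dvd_mul_left _ _))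
    refine ⟨n + 1, ?_⟩
    rw [pow_succ, mul_comm p]
    exact mul_dvd_mul hn (h p hp.irreducible (dvd_mul_right _ _))

/-- the power trick -/
theorem pow_trick {F W : Type*} [Field F] [Fintype F] [AddCommGroup W] [Module F W] [FiniteDimensional F W]
    (T : Module.End F W) (hT : Function.Injective T) (r : ℕ) (hr : r.Prime) (hrq : ¬ r ∣ Fintype.card F)
    (h : ∀ f : Polynomial F, Irreducible f → f ∣ minpoly F T → ¬ r ∣ Fintype.card F ^ f.natDegree - 1) :
    ∃ N, ¬ r ∣ N ∧ T ^ N = 1 := by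
  classical
  set q := Fintype.card F with hq
  have hq2 : 2 ≤ q := Fintype.one_lt_card
  obtain ⟨p, hp⟩ := CharP.exists F
  have hpp : p.Prime := (CharP.char_is_prime_or_zero F p).resolve_right (CharP.char_ne_zero_of_finite F p)
  have : Fact p.Prime := ⟨hpp⟩
  obtain ⟨e, -, hqe⟩ := FiniteField.card F p
  have hrp : ¬ r ∣ p := fun h => hrq (h.trans (by rw [hq, hqe]; exact dvd_pow_self p e.pos.ne'))
  set M := minpoly F T
  have hM0 : M ≠ 0 := minpoly.ne_zero (Algebra.IsIntegral.isIntegral T)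
  set I := (Finset.range (M.natDegree + 1)).filter fun n => ¬ r ∣ q ^ n - 1 with hI
  set L := ∏ n ∈ I, (q ^ n - 1) with hL
  have hLr : ¬ r ∣ L := by
    rw [hL, Prime.dvd_finsetProd_iff hr.prime]
    rintro ⟨n, hn, h⟩
    exact (Finset.mem_filter.1 hn).2 h
  obtain ⟨n, hn⟩ := dvd_pow_of_factors (Polynomial.X ^ L - 1) M hM0 (by
    intro f hf hd
    have h1 := h f hf hd
    have h2 : f ∣ Polynomial.X ^ (q ^ f.natDegree - 1) - 1 := by
      have h3 := (hf.natDegree_dvd_iff_dvd_X_pow_card_pow_sub_X (n := f.natDegree)).1 dvd_rfl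
      rw [Nat.card_eq_fintype_card, ← hq] at h3
      have h4 : (Polynomial.X ^ q ^ f.natDegree - Polynomial.X : Polynomial F) = Polynomial.X * (Polynomial.X ^ (q ^ f.natDegree - 1) - 1) := by
        rw [mul_sub, mul_one, ← pow_succ', Nat.sub_add_cancel (Nat.one_le_pow _ _ (by omega))]
      rw [h4] at h3
      rcases hf.prime.dvd_or_dvd h3 with h5 | h5
      · exfalso
        obtain ⟨w, hw, hw0⟩ := ker_of_factor hf hd
        obtain ⟨c, hc⟩ := (hf.associated_of_dvd Polynomial.irreducible_X h5).symm.dvd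
        have h6 : Polynomial.aeval T (Polynomial.X : Polynomial F) w = 0 := by
          have : (Polynomial.X : Polynomial F) ∣ f := ⟨c, hc⟩
          obtain ⟨c', hc'⟩ := h5
          rw [hc', mul_comm, map_mul, Module.End.mul_apply, hw0, map_zero]
        rw [Polynomial.aeval_X] at h6
        exact hw (hT (by rw [h6, map_zero]))
      · exact h5
    refine h2.trans ?_
    have h7 : q ^ f.natDegree - 1 ∣ L := Finset.dvd_prod_of_mem _ (by
      rw [hI, Finset.mem_filter, Finset.mem_range]
      exact ⟨Nat.lt_succ_of_le (Polynomial.natDegree_le_of_dvd hd hM0), h1⟩)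
    obtain ⟨c, hc⟩ := h7
    rw [hc, pow_mul]
    exact sub_one_dvd_pow_sub_one _ c)
  refine ⟨L * p ^ n, ?_, ?_⟩
  · intro h
    rcases (Nat.Prime.dvd_mul hr).1 h with h | h
    · exact hLr h
    · exact hrp (hr.dvd_of_dvd_pow h)
  · have h1 : M ∣ Polynomial.X ^ (L * p ^ n) - 1 := by
      have : (Polynomial.X ^ (L * p ^ n) - 1 : Polynomial F) = (Polynomial.X ^ L - 1) ^ p ^ n := by
        rw [sub_pow_char_pow, one_pow, pow_mul]
      rw [this]
      exact hn.trans (pow_dvd_pow _ (Nat.lt_pow_self hpp.one_lt).le)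
    have h2 := (minpoly.dvd_iff).1 h1
    rw [map_sub, map_pow, Polynomial.aeval_X, map_one, sub_eq_zero] at h2
    exact h2

section
variable {F K V : Type*} [Field F] [Fintype F] [AddCommGroup V] [Module F V] [FiniteDimensional F V]
  {B : LinearMap.BilinForm F V} [Field K] [Algebra F K] [FiniteDimensional F K]
  {KJ : ℕ → Type*} [∀ j, Field (KJ j)] [∀ j, Algebra F (KJ j)] [∀ j, FiniteDimensional F (KJ j)]

theorem exists_blk {d r : ℕ} {γ μ : K} {P : Finset K} {y : V ≃ₗ[F] V} (hy : y ∈ Sp B) (p : PD F d r γ P) (hμ : μ ∈ P) (hJ : ∀ j, 1 ≤ j → finrank F (KJ j) = j)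
    (hE : EX B d γ μ y) (hno : ∀ t, 1 ≤ t → 2 * (d * t) ≤ finrank F V → ¬ Bad B d γ μ (KJ (2 * (d * t))) y) :
    ∃ (N : ℕ) (μ' : K) (φ : K →ₗ[F] V), Blk B (y ^ N) d γ μ' φ ∧ Algebra.adjoin F {μ'} = ⊤ := by
  obtain ⟨φ, h1, h2⟩ := hE
  have hd := p.hd
  have hμT := p.hμ μ hμ
  have hμ0 := T_ne hμT
  let W : Submodule F V :=
    { carrier := {x | ∀ a, B x (φ a) = 0}
      add_mem' := fun {x x'} hx hx' a => by rw [map_add, LinearMap.add_apply, hx a, hx' a, add_zero]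
      zero_mem' := fun a => by rw [map_zero, LinearMap.zero_apply]
      smul_mem' := fun c x hx a => by rw [map_smul, LinearMap.smul_apply, hx a, smul_zero] }
  have hW : ∀ x ∈ W, (y : V →ₗ[F] V) x ∈ W := by
    intro x hx a
    have : φ a = y (φ (μ⁻¹ * a)) := by rw [h2, mul_inv_cancel_left₀ hμ0]
    rw [this]
    exact (hy _ _).trans (hx _)
  let T : Module.End F W := (y : V →ₗ[F] V).restrict hW
  have hTc : ∀ w : W, ((T w : W) : V) = y w.1 := fun w => rfl
  have hTi : Function.Injective T := by
    intro a b h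
    have := congrArg Subtype.val h
    rw [hTc, hTc] at this
    exact Subtype.ext (y.injective this)
  have hrq : ¬ r ∣ Fintype.card F := by
    intro h
    have h3 : r ∣ Fintype.card F ^ d + 1 := (p.ord μ hμ).trans (orderOf_dvd_of_pow_eq_one hμT)
    have h4 : r ∣ Fintype.card F ^ d := h.trans (dvd_pow_self _ (by omega))
    exact p.rp.one_lt.ne' (Nat.dvd_one.1 ((Nat.dvd_add_right h4).1 h3))
  obtain ⟨N, hN, hTN⟩ := pow_trick T hTi r p.rp hrq (by
    intro f hf hfd hr
    obtain ⟨t, ht⟩ := p.ro _ hr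
    rw [mul_assoc] at ht
    have hfp := Irreducible.natDegree_pos hf
    have ht1 : 1 ≤ t := by
      rcases Nat.eq_zero_or_pos t with rfl | h
      · simp at ht; omega
      · exact h
    have hJ' := hJ (2 * (d * t)) (by omega)
    obtain ⟨w, hw, hw0⟩ := ker_of_factor hf hfd
    obtain ⟨ν, hν, hk⟩ := exists_root (K := KJ (2 * (d * t))) hf (by rw [hJ', ht])
    obtain ⟨ψ, hψ, hψe⟩ := psi_of_ker hw hw0 hν (fun g => (hk g).1)
    have hinj := eqv_inj (y := LinearEquiv.ofInjectiveEndo T hTi) hν hψ (fun a => by rw [← hψe]; rfl)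
    refine hno t ht1 ?_ ⟨φ, ⟨h1, h2⟩, ν, hν, W.subtype ∘ₗ ψ, ?_, fun a => ?_, fun a c => (ψ a).2 c⟩
    · rw [← hJ']
      exact (LinearMap.finrank_le_finrank_of_injective hinj).trans (Submodule.finrank_le W)
    · intro h0
      apply hψ
      ext a
      have := LinearMap.congr_fun h0 a
      simpa using this
    · have := congrArg Subtype.val (hψe a)
      exact this)
  have hord : r ∣ orderOf (μ ^ N) := by
    by_contra h
    have h3 : μ ^ (N * orderOf (μ ^ N)) = 1 := by rw [pow_mul, pow_orderOf_eq_one]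
    rcases (Nat.Prime.dvd_mul p.rp).1 ((p.ord μ hμ).trans (orderOf_dvd_of_pow_eq_one h3)) with h | h'
    · exact hN h
    · exact h h'
  have hTp : ∀ n, ∀ w : W, (((T ^ n) w : W) : V) = (y ^ n) w.1 := by
    intro n
    induction n with
    | zero => intro w; rfl
    | succ n ih => intro w; rw [pow_succ, pow_succ, Module.End.mul_apply, ih]; rfl
  refine ⟨N, μ ^ N, φ, ⟨p.hK, hd, p.hγ, p.hγ0, by rw [← pow_mul, mul_comm, pow_mul, hμT, one_pow], ?_, h1, ?_, ?_⟩, ?_⟩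
  · intro h
    rw [h, orderOf_one] at hord
    exact p.rp.one_lt.ne' (Nat.dvd_one.1 hord)
  · intro a
    have : ∀ n a, (y ^ n) (φ a) = φ (μ ^ n * a) := by
      intro n
      induction n with
      | zero => intro a; rw [pow_zero, pow_zero, one_mul]; rfl
      | succ n ih =>
        intro a
        rw [pow_succ, pow_succ, mul_assoc, ← ih, ← h2]; rfl
    exact this N a
  · intro x hx
    have := hTp N ⟨x, hx⟩
    rw [hTN] at this
    exact this.symm
  · exact gen_of_ord p.hK (by omega) p.ro (pow_ne_zero _ hμ0) hord
end
end SpGen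

namespace SpGen
open Module

def HB {F K V : Type*} [Field F] [Fintype F] [Field K] [Algebra F K] [FiniteDimensional F K] [AddCommGroup V] [Module F V]
    (B : LinearMap.BilinForm F V) (d : ℕ) (γ : K) (y : V ≃ₗ[F] V) : Prop :=
  ∃ (N : ℕ) (μ' : K) (φ : K →ₗ[F] V), Blk B (y ^ N) d γ μ' φ ∧ Algebra.adjoin F {μ'} = ⊤

variable {F V : Type*} [Field F] [Fintype F] [AddCommGroup V] [Module F V] [FiniteDimensional F V]
  {B : LinearMap.BilinForm F V} {KJ : ℕ → Type*} [∀ i, Field (KJ i)] [∀ i, Algebra F (KJ i)] [∀ i, FiniteDimensional F (KJ i)]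
  {r : ℕ → ℕ} {γ : ∀ d, KJ (2 * d)} {P : ∀ d, Finset (KJ (2 * d))}

open Classical in
theorem bad_sum (hVa : B.IsAlt) (hV : B.Nondegenerate) (hodd : Odd (Fintype.card F)) (D : Finset ℕ)
    (p : ∀ d ∈ D, PD F d (r d) (γ d) (P d)) (hJ : ∀ j, 1 ≤ j → finrank F (KJ j) = j) (m : ℕ) [Fintype (Sp B)] :
    ((Finset.univ.filter fun y : Sp B => ∃ d ∈ D, ∃ μ ∈ P d, ∃ t ∈ Finset.Icc 1 m,
      Bad B d (γ d) μ (KJ (2 * (d * t))) y.1).card : ℝ) ≤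
      Fintype.card (Sp B) * ∑ d ∈ D, ∑ t ∈ Finset.Icc 1 m, 1 / ((d : ℝ) ^ 2 * t) := by
  have hsub : (Finset.univ.filter fun y : Sp B => ∃ d ∈ D, ∃ μ ∈ P d, ∃ t ∈ Finset.Icc 1 m,
      Bad B d (γ d) μ (KJ (2 * (d * t))) y.1) ⊆ D.biUnion fun d => (P d).biUnion fun μ => (Finset.Icc 1 m).biUnion fun t =>
        Finset.univ.filter fun y : Sp B => Bad B d (γ d) μ (KJ (2 * (d * t))) y.1 := by
    intro y hy
    simpa using hy
  have h1 := (Finset.card_le_card hsub).trans Finset.card_biUnion_le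
  refine le_trans (Nat.cast_le.2 h1) ?_
  push_cast
  rw [Finset.mul_sum]
  apply Finset.sum_le_sum
  intro d hd
  have hd2 := (p d hd).hd
  have hdr : (0 : ℝ) < d := by exact_mod_cast (by omega : 0 < d)
  refine le_trans (Nat.cast_le.2 Finset.card_biUnion_le) ?_
  push_cast
  have key : ∀ μ ∈ P d, (((Finset.Icc 1 m).biUnion fun t =>
        Finset.univ.filter fun y : Sp B => Bad B d (γ d) μ (KJ (2 * (d * t))) y.1).card : ℝ) ≤
        ∑ t ∈ Finset.Icc 1 m, 2 * Fintype.card (Sp B) / ((d : ℝ) * t * ((Fintype.card F : ℝ) ^ d + 1)) := by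
    intro μ hμ
    refine le_trans (Nat.cast_le.2 Finset.card_biUnion_le) ?_
    push_cast
    apply Finset.sum_le_sum
    intro t ht
    have ht1 := (Finset.mem_Icc.1 ht).1
    have htr : (0 : ℝ) < t := by exact_mod_cast ht1
    have h1 : 1 ≤ d * t := Nat.one_le_iff_ne_zero.2 (Nat.mul_ne_zero (by omega) (by omega))
    have h := bad_card (K' := KJ (2 * (d * t))) hVa hV ((p d hd).bd hμ) hodd (hJ _ (by omega)) h1
    rw [Nat.card_eq_fintype_card, Fintype.card_subtype] at h
    have h' : (((Finset.univ.filter fun y : Sp B => Bad B d (γ d) μ (KJ (2 * (d * t))) y.1).card : ℝ)) * (2 * (d * t) * ((Fintype.card F : ℝ) ^ d + 1)) ≤ 4 * Fintype.card (Sp B) := by exact_mod_cast h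
    rw [le_div_iff₀ (by positivity)]
    linarith
  refine le_trans (Finset.sum_le_sum key) ?_
  rw [Finset.sum_const, nsmul_eq_mul, Finset.mul_sum, Finset.mul_sum]
  apply Finset.sum_le_sum
  intro t ht
  have ht1 := (Finset.mem_Icc.1 ht).1
  have htr : (0 : ℝ) < t := by exact_mod_cast ht1
  have hup : ((P d).card : ℝ) * (2 * d) ≤ (Fintype.card F : ℝ) ^ d + 1 := by exact_mod_cast (p d hd).up
  rw [← mul_div_assoc, mul_one_div, div_le_div_iff₀ (by positivity) (by positivity)]
  have := mul_le_mul_of_nonneg_left hup (by positivity : 0 ≤ (Fintype.card (Sp B) : ℝ) * d * t)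
  nlinarith

theorem fail_card (hVa : B.IsAlt) (hV : B.Nondegenerate) (hodd : Odd (Fintype.card F)) (D : Finset ℕ)
    (p : ∀ d ∈ D, PD F d (r d) (γ d) (P d)) (hJ : ∀ j, 1 ≤ j → finrank F (KJ j) = j) (m : ℕ) (hm : finrank F V = 2 * m)
    (hdim : ∑ d ∈ D, 4 * d ≤ finrank F V) (k : ℕ) (hk : ∀ d ∈ D, k ≤ d)
    (S : Finset ℕ) (Q : ℕ → Finset ℕ) (hQ : ∀ s ∈ S, Q s ⊆ D) [Fintype (Sp B)] :
    (Nat.card {y : Sp B // ∃ s ∈ S, ∀ d ∈ Q s, ¬ HB B d (γ d) y.1} : ℝ) ≤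
      Fintype.card (Sp B) * (∑ s ∈ S, (∏ d ∈ Q s, (1 - 1 / (4 * (d : ℝ))) + (2 * (Q s).card) * (2 / 2 ^ k) * ∏ d ∈ Q s, (1 + 1 / (d : ℝ)))
        + ∑ d ∈ D, ∑ t ∈ Finset.Icc 1 m, 1 / ((d : ℝ) ^ 2 * t)) := by
  classical
  rw [mul_add, Finset.mul_sum]
  have hsub : (Finset.univ.filter fun y : Sp B => ∃ s ∈ S, ∀ d ∈ Q s, ¬ HB B d (γ d) y.1) ⊆
     (S.biUnion fun s => Finset.univ.filter fun y : Sp B => ∀ d ∈ Q s, ∀ μ ∈ P d, ¬ EX B d (γ d) μ y.1) ∪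
     (Finset.univ.filter fun y : Sp B => ∃ d ∈ D, ∃ μ ∈ P d, ∃ t ∈ Finset.Icc 1 m,
      Bad B d (γ d) μ (KJ (2 * (d * t))) y.1) := by
    intro y hy
    obtain ⟨s, hs, h⟩ := (Finset.mem_filter.1 hy).2
    by_contra hc
    rw [Finset.mem_union, not_or] at hc
    obtain ⟨hc1, hc2⟩ := hc
    simp only [Finset.mem_biUnion, Finset.mem_filter, Finset.mem_univ, true_and, not_exists, not_and, not_forall, not_not] at hc1 hc2
    obtain ⟨d, hd, μ, hμ, hE⟩ := hc1 s hs
    have hdD := hQ s hs hd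
    apply h d hd
    refine exists_blk y.2 (p d hdD) hμ hJ hE ?_
    intro t ht h2
    refine hc2 d hdD μ hμ t (Finset.mem_Icc.2 ⟨ht, ?_⟩)
    have hd2 := (p d hdD).hd
    have : t ≤ d * t := Nat.le_mul_of_pos_left t (by omega)
    omega
  rw [Nat.card_eq_fintype_card, Fintype.card_subtype]
  refine le_trans (Nat.cast_le.2 ((Finset.card_le_card hsub).trans (Finset.card_union_le _ _))) ?_
  push_cast
  refine add_le_add ?_ (bad_sum hVa hV hodd D p hJ m)
  refine le_trans (Nat.cast_le.2 Finset.card_biUnion_le) ?_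
  push_cast
  apply Finset.sum_le_sum
  intro s hs
  have h := step2 hVa hV hodd (Q s) (K := fun d => KJ (2 * d)) (fun d hd => p d (hQ s hs hd))
    ((Finset.sum_le_sum_of_subset (hQ s hs)).trans hdim) k (fun d hd => hk d (hQ s hs hd))
  rwa [Nat.card_eq_fintype_card, Fintype.card_subtype] at h

end SpGen

namespace SpGen
open Module

theorem pair_prod (g : ℕ → ℝ) (j L : ℕ) (h : j ≤ L) :
    ∏ d ∈ Finset.Ico (2 * j) (2 * L), g d = ∏ e ∈ Finset.Ico j L, g (2 * e) * g (2 * e + 1) := by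
  induction L, h using Nat.le_induction with
  | base => simp
  | succ n hn ih =>
    rw [Finset.prod_Ico_succ_top hn, ← ih, show 2 * (n + 1) = 2 * n + 1 + 1 by ring,
      Finset.prod_Ico_succ_top (by omega), Finset.prod_Ico_succ_top (by omega), mul_assoc]

theorem tele_prod (j L : ℕ) (hj : 1 ≤ j) (h : j ≤ L) : ∏ e ∈ Finset.Ico j L, (1 + 1 / (e : ℝ)) = L / j := by
  have hj0 : (j : ℝ) ≠ 0 := by exact_mod_cast (by omega : j ≠ 0)
  induction L, h using Nat.le_induction with
  | base => simp [hj0]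
  | succ n hn ih =>
    have hn0 : (n : ℝ) ≠ 0 := by exact_mod_cast (by omega : n ≠ 0)
    rw [Finset.prod_Ico_succ_top hn, ih]; push_cast; field_simp

theorem sq_sum (j L : ℕ) (hj : 1 ≤ j) (h : j + 1 ≤ L) : ∑ d ∈ Finset.Ico (j + 1) L, 1 / (d : ℝ) ^ 2 ≤ 1 / j - 1 / ((L : ℝ) - 1) := by
  induction L, h using Nat.le_induction with
  | base => simp
  | succ n hn ih =>
    have hn0 : (2 : ℝ) ≤ n := by exact_mod_cast (by omega : 2 ≤ n)
    rw [Finset.sum_Ico_succ_top hn]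
    have : 1 / (n : ℝ) ^ 2 ≤ 1 / ((n : ℝ) - 1) - 1 / n := by
      rw [div_sub_div _ _ (by linarith) (by linarith), div_le_div_iff₀ (by positivity) (by nlinarith)]
      nlinarith
    push_cast
    rw [add_sub_cancel_right]
    linarith

theorem main_prod (Q : Finset ℕ) (j L : ℕ) (hj : 1 ≤ j) (h : j ≤ L) (hQ : Q ⊆ Finset.Ico (2 * j) (2 * L))
    (hp : ∀ e ∈ Finset.Ico j L, 2 * e ∈ Q ∨ 2 * e + 1 ∈ Q) :
    0 ≤ ∏ d ∈ Q, (1 - 1 / (4 * (d : ℝ))) ∧ (∏ d ∈ Q, (1 - 1 / (4 * (d : ℝ)))) ^ 16 ≤ j / L := by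
  classical
  set g : ℕ → ℝ := fun d => if d ∈ Q then 1 - 1 / (4 * (d : ℝ)) else 1 with hg
  have hg0 : ∀ d, 1 ≤ d → 0 ≤ g d ∧ g d ≤ 1 := by
    intro d hd
    have : (1 : ℝ) ≤ d := by exact_mod_cast hd
    have h2 : 1 / (4 * (d : ℝ)) ≤ 1 := by rw [div_le_one (by positivity)]; linarith
    have h3 : 0 ≤ 1 / (4 * (d : ℝ)) := by positivity
    simp only [hg]; split_ifs <;> constructor <;> linarith
  have e1 : ∏ d ∈ Q, (1 - 1 / (4 * (d : ℝ))) = ∏ d ∈ Finset.Ico (2 * j) (2 * L), g d := by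
    rw [hg, Finset.prod_ite_mem, Finset.inter_eq_right.2 hQ]
  rw [e1]
  refine ⟨Finset.prod_nonneg fun d hd => (hg0 d (by have := Finset.mem_Ico.1 hd; omega)).1, ?_⟩
  rw [pair_prod g j L h, ← Finset.prod_pow]
  have e2 : (j : ℝ) / L = ∏ e ∈ Finset.Ico j L, (1 + 1 / (e : ℝ))⁻¹ := by
    rw [Finset.prod_inv_distrib, tele_prod j L hj h, inv_div]
  rw [e2]
  apply Finset.prod_le_prod
  · intro e he
    have := (Finset.mem_Ico.1 he).1
    have := (hg0 (2 * e) (by omega)).1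
    have := (hg0 (2 * e + 1) (by omega)).1
    positivity
  intro e he
  have he1 := (Finset.mem_Ico.1 he).1
  have her : (1 : ℝ) ≤ e := by exact_mod_cast (by omega : 1 ≤ e)
  obtain ⟨a0, a1⟩ := hg0 (2 * e) (by omega)
  obtain ⟨b0, b1⟩ := hg0 (2 * e + 1) (by omega)
  set x : ℝ := 1 / (8 * e + 4) with hx
  have hx0 : 0 ≤ x := by positivity
  have hx1 : x ≤ 1 := by rw [hx, div_le_one (by positivity)]; linarith
  have hle : g (2 * e) * g (2 * e + 1) ≤ 1 - x := by
    rcases hp e he with h' | h'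
    · have : g (2 * e) ≤ 1 - x := by
        simp only [hg, if_pos h', hx]
        push_cast
        have : 1 / (8 * (e : ℝ) + 4) ≤ 1 / (4 * (2 * e)) := one_div_le_one_div_of_le (by positivity) (by linarith)
        linarith
      nlinarith
    · have : g (2 * e + 1) ≤ 1 - x := by
        simp only [hg, if_pos h', hx]
        push_cast
        have : (8 * (e : ℝ) + 4) = (4 * (2 * e + 1)) := by ring
        rw [this]
      nlinarith
  have h3 : (g (2 * e) * g (2 * e + 1)) ^ 16 ≤ (1 - x) ^ 16 := pow_le_pow_left₀ (by positivity) hle 16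
  refine h3.trans ?_
  have h4 := one_add_mul_le_pow (by linarith : (-2 : ℝ) ≤ x) 16
  have h5 : 1 + 1 / (e : ℝ) ≤ (1 + x) ^ 16 := by
    refine le_trans ?_ h4
    have : 1 / (e : ℝ) ≤ 16 * x := by
      rw [hx, mul_one_div, div_le_div_iff₀ (by positivity) (by positivity)]; linarith
    push_cast; linarith
  have h6 : (1 - x) ^ 16 * (1 + x) ^ 16 ≤ 1 := by
    rw [← mul_pow]; apply pow_le_one₀ <;> nlinarith
  have hpos : 0 < 1 + 1 / (e : ℝ) := by positivity
  rw [← one_div, le_div_iff₀ hpos]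
  exact (mul_le_mul_of_nonneg_left h5 (pow_nonneg (by linarith) 16)).trans h6

theorem four_pow (j : ℕ) (hj : 8 ≤ j) : 8 * j ^ 4 ≤ 4 ^ j := by
  induction j, hj using Nat.le_induction with
  | base => norm_num
  | succ n hn ih =>
    have : (n + 1) ^ 4 ≤ 4 * n ^ 4 := by
      have h1 : (n + 1) ^ 2 ≤ 2 * n ^ 2 := by nlinarith
      have := Nat.mul_le_mul h1 h1
      nlinarith
    have h4 : 4 ^ (n + 1) = 4 * 4 ^ n := by rw [pow_succ, mul_comm]
    rw [h4]; linarith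

/-- one test -/
theorem test_bound (Q : Finset ℕ) (j : ℕ) (hj : 8 ≤ j) (hQ : Q ⊆ Finset.Ico (2 * j) (2 * j ^ 2))
    (hp : ∀ e ∈ Finset.Ico j (j ^ 2), 2 * e ∈ Q ∨ 2 * e + 1 ∈ Q) :
    ∏ d ∈ Q, (1 - 1 / (4 * (d : ℝ))) + (2 * Q.card) * (2 / 2 ^ (2 * j)) * ∏ d ∈ Q, (1 + 1 / (d : ℝ)) ≤ 2 * (j : ℝ) ^ (-(1 : ℝ) / 16) := by
  have hjr : (8 : ℝ) ≤ j := by exact_mod_cast hj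
  have hjj : j ≤ j ^ 2 := by nlinarith
  obtain ⟨h0, h1⟩ := main_prod Q j (j ^ 2) (by omega) hjj hQ hp
  have e : ((j : ℝ) ^ (-(1 : ℝ) / 16)) ^ 16 = 1 / j := by
    rw [← Real.rpow_natCast, ← Real.rpow_mul (by positivity)]
    norm_num
    rw [Real.rpow_neg_one]
  have a1 : ∏ d ∈ Q, (1 - 1 / (4 * (d : ℝ))) ≤ (j : ℝ) ^ (-(1 : ℝ) / 16) := by
    apply le_of_pow_le_pow_left₀ (n := 16) (by norm_num) (by positivity)
    rw [e]
    refine h1.trans (le_of_eq ?_)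
    push_cast; field_simp
  have a2 : ∏ d ∈ Q, (1 + 1 / (d : ℝ)) ≤ j := by
    have h2 := Finset.prod_sdiff (f := fun d : ℕ => 1 + 1 / (d : ℝ)) hQ
    have h3 := tele_prod (2 * j) (2 * j ^ 2) (by omega) (by omega)
    have h4 : ∏ d ∈ Finset.Ico (2 * j) (2 * j ^ 2) \ Q, (1 + 1 / (d : ℝ)) ≥ ∏ d ∈ Finset.Ico (2 * j) (2 * j ^ 2) \ Q, (1 : ℝ) :=
      Finset.prod_le_prod (fun _ _ => zero_le_one) fun d _ => by
        have : 0 ≤ 1 / (d : ℝ) := by positivity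
        linarith
    rw [Finset.prod_const_one] at h4
    have h5 : 0 ≤ ∏ d ∈ Q, (1 + 1 / (d : ℝ)) := Finset.prod_nonneg fun d _ => by positivity
    have h6 : ((2 * j ^ 2 : ℕ) : ℝ) / (2 * j : ℕ) = j := by push_cast; field_simp
    rw [h6] at h3
    rw [h3] at h2
    nlinarith
  have a3 : (Q.card : ℝ) ≤ 2 * j ^ 2 := by
    have := Finset.card_le_card hQ
    rw [Nat.card_Ico] at this
    exact_mod_cast this.trans (Nat.sub_le _ _)
  have a4 : (8 : ℝ) * j ^ 4 ≤ 2 ^ (2 * j) := by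
    rw [pow_mul]; norm_num; exact_mod_cast four_pow j hj
  have a5 : (2 * (Q.card : ℝ)) * (2 / 2 ^ (2 * j)) * ∏ d ∈ Q, (1 + 1 / (d : ℝ)) ≤ 1 / j := by
    calc (2 * (Q.card : ℝ)) * (2 / 2 ^ (2 * j)) * ∏ d ∈ Q, (1 + 1 / (d : ℝ)) ≤ (2 * (2 * (j : ℝ) ^ 2)) * (2 / (8 * j ^ 4)) * j := by
          gcongr
      _ = 1 / j := by field_simp; norm_num
  have a6 : 1 / (j : ℝ) ≤ (j : ℝ) ^ (-(1 : ℝ) / 16) := by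
    rw [one_div, ← Real.rpow_neg_one]
    exact Real.rpow_le_rpow_of_exponent_le (by linarith) (by norm_num)
  linarith

theorem bad_bound (m j : ℕ) (hj : 8 ≤ j) :
    ∑ d ∈ Finset.Ico (2 * j) (2 * j ^ 2), ∑ t ∈ Finset.Icc 1 m, 1 / ((d : ℝ) ^ 2 * t) ≤ (1 + Real.log m) / j := by
  have hjr : (8 : ℝ) ≤ j := by exact_mod_cast hj
  have h1 : ∑ t ∈ Finset.Icc 1 m, 1 / (t : ℝ) ≤ 1 + Real.log m := by
    have := harmonic_le_one_add_log m
    rw [harmonic_eq_sum_Icc] at this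
    push_cast at this
    simpa using this
  have h2 : ∑ d ∈ Finset.Ico (2 * j) (2 * j ^ 2), 1 / (d : ℝ) ^ 2 ≤ 1 / (j : ℝ) := by
    have h := sq_sum (2 * j - 1) (2 * j ^ 2) (by omega) (by nlinarith [Nat.sub_le (2 * j) 1])
    rw [Nat.sub_add_cancel (by omega)] at h
    rw [Nat.cast_sub (by omega)] at h
    push_cast at h
    have h3 : 0 ≤ 1 / (2 * (j : ℝ) ^ 2 - 1) := by apply div_nonneg zero_le_one; nlinarith
    have h4 : 1 / (2 * (j : ℝ) - 1) ≤ 1 / j := one_div_le_one_div_of_le (by linarith) (by linarith)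
    linarith
  have e : ∑ d ∈ Finset.Ico (2 * j) (2 * j ^ 2), ∑ t ∈ Finset.Icc 1 m, 1 / ((d : ℝ) ^ 2 * t) =
      (∑ d ∈ Finset.Ico (2 * j) (2 * j ^ 2), 1 / (d : ℝ) ^ 2) * ∑ t ∈ Finset.Icc 1 m, 1 / (t : ℝ) := by
    rw [Finset.sum_mul_sum]
    refine Finset.sum_congr rfl fun d _ => Finset.sum_congr rfl fun t _ => ?_
    rw [one_div_mul_one_div]
  rw [e]
  have h5 : 0 ≤ ∑ t ∈ Finset.Icc 1 m, 1 / (t : ℝ) := Finset.sum_nonneg fun t _ => by positivity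
  calc _ ≤ 1 / (j : ℝ) * (1 + Real.log m) := by gcongr
    _ = _ := by ring

theorem num_bound (m j : ℕ) (hj : 8 ≤ j) (h1 : j ^ 6 ≤ m) (h2 : m < (j + 1) ^ 6) :
    ((Nat.log 2 m + 1 : ℕ) : ℝ) * (2 * (j : ℝ) ^ (-(1 : ℝ) / 16)) + (1 + Real.log m) / j ≤ 2010 * (m : ℝ) ^ (-(1 : ℝ) / 200) := by
  have hjr : (8 : ℝ) ≤ j := by exact_mod_cast hj
  have hm1 : 1 ≤ m := le_trans (Nat.one_le_pow _ _ (by omega)) h1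
  have hmr : (1 : ℝ) ≤ m := by exact_mod_cast hm1
  set a := (j : ℝ) ^ (-(1 : ℝ) / 16) with ha
  have ha0 : 0 < a := by positivity
  have a6 : 1 / (j : ℝ) ≤ a := by
    rw [one_div, ← Real.rpow_neg_one]
    exact Real.rpow_le_rpow_of_exponent_le (by linarith) (by norm_num)
  have hl0 : 0 ≤ Real.log m := Real.log_nonneg hmr
  have hlog : (Nat.log 2 m : ℝ) ≤ 2 * Real.log m := by
    have h3 : (2 : ℝ) ^ Nat.log 2 m ≤ m := by exact_mod_cast Nat.pow_log_le_self 2 (by omega)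
    have h4 := Real.log_le_log (by positivity) h3
    rw [Real.log_pow] at h4
    have := Real.log_two_gt_d9
    nlinarith [(Nat.cast_nonneg (Nat.log 2 m) : (0 : ℝ) ≤ _)]
  have hl : 1 + Real.log m ≤ 201 * (m : ℝ) ^ ((1 : ℝ) / 200) := by
    have h3 := Real.log_le_rpow_div (x := m) (by linarith) (by norm_num : (0 : ℝ) < 1 / 200)
    have h4 := Real.one_le_rpow hmr (by norm_num : (0 : ℝ) ≤ 1 / 200)
    rw [div_eq_mul_inv, show ((1 : ℝ) / 200)⁻¹ = 200 by norm_num] at h3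
    linarith
  have hb : a ≤ 2 * (m : ℝ) ^ (-(1 : ℝ) / 100) := by
    have h3 : (m : ℝ) ≤ (2 * j) ^ 6 := by
      have : m ≤ (2 * j) ^ 6 := h2.le.trans (Nat.pow_le_pow_left (by omega) 6)
      exact_mod_cast this
    have h4 : (m : ℝ) ^ (1 / 96 : ℝ) ≤ ((2 * (j : ℝ)) ^ 6) ^ (1 / 96 : ℝ) := Real.rpow_le_rpow (by linarith) h3 (by norm_num)
    have h5 : ((2 * (j : ℝ)) ^ 6) ^ (1 / 96 : ℝ) ≤ 2 * (j : ℝ) ^ (1 / 16 : ℝ) := by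
      rw [← Real.rpow_natCast, ← Real.rpow_mul (by positivity)]
      norm_num
      rw [Real.mul_rpow (by norm_num) (by positivity)]
      gcongr
      calc (2 : ℝ) ^ (1 / 16 : ℝ) ≤ 2 ^ (1 : ℝ) := Real.rpow_le_rpow_of_exponent_le (by norm_num) (by norm_num)
        _ = 2 := by norm_num
    have h6 : (m : ℝ) ^ (1 / 100 : ℝ) ≤ (m : ℝ) ^ (1 / 96 : ℝ) := Real.rpow_le_rpow_of_exponent_le hmr (by norm_num)
    have h7 : (m : ℝ) ^ (1 / 100 : ℝ) ≤ 2 * (j : ℝ) ^ (1 / 16 : ℝ) := h6.trans (h4.trans h5)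
    rw [ha, neg_div, neg_div, Real.rpow_neg (by positivity), Real.rpow_neg (by positivity), ← div_eq_mul_inv, inv_eq_one_div,
      div_le_div_iff₀ (by positivity) (by positivity)]
    linarith
  have e : (m : ℝ) ^ ((1 : ℝ) / 200) * (m : ℝ) ^ (-(1 : ℝ) / 100) = (m : ℝ) ^ (-(1 : ℝ) / 200) := by
    rw [← Real.rpow_add (by linarith)]; norm_num
  have hd : (1 + Real.log m) / j ≤ (1 + Real.log m) * a := by
    rw [div_eq_mul_one_div]; gcongr
  push_cast
  calc _ ≤ (2 * Real.log m + 1) * (2 * a) + (1 + Real.log m) * a := by gcongr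
    _ ≤ 5 * ((1 + Real.log m) * a) := by nlinarith
    _ ≤ 5 * ((201 * (m : ℝ) ^ ((1 : ℝ) / 200)) * (2 * (m : ℝ) ^ (-(1 : ℝ) / 100))) := by gcongr
    _ = 2010 * (m : ℝ) ^ (-(1 : ℝ) / 200) := by rw [← e]; ring

end SpGen

namespace SpGen
open Module

theorem HB.conj {F K V : Type*} [Field F] [Fintype F] [Field K] [Algebra F K] [FiniteDimensional F K] [AddCommGroup V] [Module F V]
    {B : LinearMap.BilinForm F V} {d : ℕ} {γ : K} {y g : V ≃ₗ[F] V} (hg : g ∈ Sp B) (h : HB B d γ y) : HB B d γ (g * y * g⁻¹) := by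
  obtain ⟨N, μ, φ, b, ht⟩ := h
  have hc : (g * y * g⁻¹) ^ N = g * y ^ N * g⁻¹ := _root_.conj_pow
  have hgi : ∀ x, g⁻¹ (g x) = x := fun x => by rw [← LinearEquiv.mul_apply, inv_mul_cancel]; rfl
  have hig : ∀ x, g (g⁻¹ x) = x := fun x => by rw [← LinearEquiv.mul_apply, mul_inv_cancel]; rfl
  refine ⟨N, μ, (g : V →ₗ[F] V) ∘ₗ φ, ⟨b.hK, b.hd2, b.hγ, b.hγ0, b.hμ, b.hμ1, ?_, ?_, ?_⟩, ht⟩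
  · intro a c
    rw [← b.iso]
    exact hg _ _
  · intro a
    rw [hc]
    show g ((y ^ N) (g⁻¹ (g (φ a)))) = g (φ (μ * a))
    rw [hgi, b.eqv]
  · intro x hx
    rw [hc]
    show g ((y ^ N) (g⁻¹ x)) = x
    rw [b.fix, hig]
    intro a
    rw [← hx a, ← hg]
    show B (g (g⁻¹ x)) (g (φ a)) = B x (g (φ a))
    rw [hig]

theorem finrank_sup_sum {F V ι : Type*} [Field F] [AddCommGroup V] [Module F V] [FiniteDimensional F V] (S : Finset ι)
    (f : ι → Submodule F V) : finrank F (S.sup f : Submodule F V) ≤ ∑ i ∈ S, finrank F (f i) := by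
  classical
  induction S using Finset.induction_on with
  | empty => simp
  | insert a s ha ih =>
    rw [Finset.sup_insert, Finset.sum_insert ha]
    exact (Submodule.finrank_add_le_finrank_add_finrank _ _).trans (by omega)

def QQ (m j s : ℕ) : Finset ℕ :=
  (Finset.Ico (2 * j) (2 * j ^ 2)).filter fun d => if s = 2 then d % 2 ≠ m % 2 else ¬ s ∣ d

theorem QQ_pair {m j s : ℕ} (hs : s.Prime) (e : ℕ) (he : e ∈ Finset.Ico j (j ^ 2)) : 2 * e ∈ QQ m j s ∨ 2 * e + 1 ∈ QQ m j s := by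
  have h := Finset.mem_Ico.1 he
  have h1 : 2 * e ∈ Finset.Ico (2 * j) (2 * j ^ 2) := Finset.mem_Ico.2 (by omega)
  have h2 : 2 * e + 1 ∈ Finset.Ico (2 * j) (2 * j ^ 2) := Finset.mem_Ico.2 (by omega)
  simp only [QQ, Finset.mem_filter, h1, h2, true_and]
  split_ifs with h3
  · omega
  · by_contra hc
    rw [not_or, not_not, not_not] at hc
    have := (Nat.dvd_add_right hc.1).1 hc.2
    exact hs.one_lt.ne' (Nat.dvd_one.1 this)

theorem card_tests (m : ℕ) (hm : m ≠ 0) : (insert 2 m.primeFactors).card ≤ Nat.log 2 m + 1 := by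
  refine (Finset.card_insert_le _ _).trans (Nat.add_le_add_right ?_ 1)
  apply Nat.le_log_of_pow_le (by norm_num)
  calc 2 ^ m.primeFactors.card ≤ ∏ p ∈ m.primeFactors, p := Finset.pow_card_le_prod _ _ _ fun p hp => (Nat.prime_of_mem_primeFactors hp).two_le
    _ ≤ m := Nat.le_of_dvd (Nat.pos_of_ne_zero hm) (Nat.prod_primeFactors_dvd m)

variable {F E : Type*} [Field F] [Fintype F] [Field E] [Algebra F E] [FiniteDimensional F E]
  {KJ : ℕ → Type*} [∀ i, Field (KJ i)] [∀ i, Algebra F (KJ i)] [∀ i, FiniteDimensional F (KJ i)]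
  {γ' : ∀ d, KJ (2 * d)} {m : ℕ} {γ : E} {H : Subgroup (E ≃ₗ[F] E)}

theorem gen_of_tests (hd : finrank F E = 2 * m) (hodd : Odd (Fintype.card F)) (hγ : bar F m γ = -γ) (hγ0 : γ ≠ 0)
    (hT : ∀ s : E, ∀ hs : s ^ (Fintype.card F ^ m + 1) = 1, mulE F s (T_ne hs) ∈ H) (j : ℕ) (hj : 8 ≤ j)
    (hm : 40 * ((Nat.log 2 m + 1) * (4 * j ^ 2)) ^ 2 + 40 ≤ m) {y : E ≃ₗ[F] E} (hyH : y ∈ H) (hy : y ∈ Sp (hform (F := F) m γ))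
    (ht : ∀ s ∈ insert 2 m.primeFactors, ∃ d ∈ QQ m j s, HB (hform (F := F) m γ) d (γ' d) y) :
    Sp (hform (F := F) m γ) ≤ H := by
  choose! d hdQ hHB using ht
  choose! N μ φ hb ha using hHB
  set S := insert 2 m.primeFactors with hS
  set Y : Submodule F E := S.sup fun s => barS m (Wc (y ^ N s)) with hY
  have hYle : ∀ s ∈ S, barS m (Wc (y ^ N s)) ≤ Y := fun s hs => Finset.le_sup (f := fun s => barS m (Wc (y ^ N s))) hs
  have h2S : 2 ∈ S := Finset.mem_insert_self _ _
  have hinj : Function.Injective (bar F m : E →ₐ[F] E) := (bar F m : E →ₐ[F] E).toRingHom.injective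
  have hdlt : ∀ s ∈ S, d s < 2 * j ^ 2 := fun s hs => (Finset.mem_Ico.1 (Finset.mem_filter.1 (hdQ s hs)).1).2
  have hgood : ∀ s ∈ S, Good m γ H Y (y ^ N s) := fun s hs =>
    ⟨H.pow_mem hyH _, Subgroup.pow_mem _ hy _, (hb s hs).Einj hodd, hYle s hs⟩
  have c : Ctx m γ H Y ((Nat.log 2 m + 1) * (4 * j ^ 2)) := by
    refine ⟨hd, hodd, hγ, hγ0, hT, ?_, ?_, ?_, hm⟩
    · refine (finrank_sup_sum S _).trans ?_
      refine (Finset.sum_le_card_nsmul S _ (4 * j ^ 2) fun s hs => ?_).trans ?_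
      · refine (finrank_barS_le _).trans ?_
        rw [(hb s hs).rank hodd]
        have := hdlt s hs
        omega
      · rw [smul_eq_mul]
        exact Nat.mul_le_mul_right _ (card_tests m (by omega))
    · intro h0
      have h1 := hYle 2 h2S
      rw [h0] at h1
      have h1 : Wc (y ^ N 2) = ⊥ := (Submodule.eq_bot_iff _).2 fun w hw =>
        (map_eq_zero_iff (bar F m) hinj).1 ((Submodule.mem_bot F).1 (h1 (mem_barS hw)))
      have h2 := (hb 2 h2S).rank hodd
      rw [h1, finrank_bot] at h2
      have := (hb 2 h2S).hd2
      omega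
    · have : 1 ≤ Nat.log 2 m + 1 := by omega
      nlinarith
  refine gen_main c ?_ (hb 2 h2S) (ha 2 h2S) (H.pow_mem hyH _) (Subgroup.pow_mem _ hy _) (hYle 2 h2S) ?_
  · intro p hp hp2 hpm
    have hpS : p ∈ S := Finset.mem_insert_of_mem (Nat.mem_primeFactors.2 ⟨hp, hpm, by omega⟩)
    refine ⟨d p, ⟨_, hgood p hpS, (hb p hpS).rank hodd⟩, ?_⟩
    have := (Finset.mem_filter.1 (hdQ p hpS)).2
    rwa [if_neg hp2] at this
  · have := (Finset.mem_filter.1 (hdQ 2 h2S)).2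
    rwa [if_pos rfl] at this

end SpGen

namespace SpGen
open Module

theorem InvGen_of_equiv {G G' : Type*} [Group G] [Group G'] (e : G ≃* G') {x y : G} (h : InvGen (e x) (e y)) : InvGen x y := by
  intro a b
  have h1 := h (e a) (e b)
  have h2 : (Subgroup.closure {a * x * a⁻¹, b * y * b⁻¹}).map e.toMonoidHom = ⊤ := by
    rw [MonoidHom.map_closure, Set.image_pair, ← h1]
    simp
  rw [eq_top_iff]
  intro z _
  have : e z ∈ (Subgroup.closure {a * x * a⁻¹, b * y * b⁻¹}).map e.toMonoidHom := by rw [h2]; trivial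
  obtain ⟨w, hw, hwz⟩ := this
  rwa [← e.injective hwz]

/-- large `j` -/
theorem eventually_j : ∃ j0, ∀ j, j0 ≤ j → ∀ m, j ^ 6 ≤ m → m < (j + 1) ^ 6 →
    40 * ((Nat.log 2 m + 1) * (4 * j ^ 2)) ^ 2 + 40 ≤ m := by
  refine ⟨40000, fun j hj m h1 h2 => ?_⟩
  set l := Nat.log 2 (j + 1) with hl
  have h3 : Nat.log 2 m + 1 ≤ 6 * (l + 1) := by
    have : m < 2 ^ (6 * (l + 1)) := by
      refine h2.trans ?_
      rw [mul_comm, pow_mul]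
      exact Nat.pow_lt_pow_left (Nat.lt_pow_succ_log_self (by norm_num) _) (by norm_num)
    have h0 : 0 < j ^ 6 := Nat.pow_pos (by omega)
    exact Nat.log_lt_of_lt_pow (by omega) this
  have h4 : ∀ l : ℕ, 15 ≤ l → 306 * (l + 1) ≤ 2 ^ l - 1 := by
    intro l hl
    induction l, hl using Nat.le_induction with
    | base => norm_num
    | succ n hn ih => rw [pow_succ]; omega
  have h5 : 15 ≤ l := Nat.le_log_of_pow_le (by norm_num) (by omega)
  have h6 : 2 ^ l ≤ j + 1 := Nat.pow_log_le_self 2 (by omega)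
  have h7 : 306 * (l + 1) ≤ j := (h4 l h5).trans (by omega)
  refine le_trans ?_ h1
  have h8 : 51 * (Nat.log 2 m + 1) ≤ j := by omega
  have h9 := Nat.pow_le_pow_left h8 2
  have h10 := Nat.mul_le_mul_right (j ^ 4) h9
  have h11 : 1 ≤ j ^ 4 := Nat.one_le_pow _ _ (by omega)
  have h12 : 1 ≤ (Nat.log 2 m + 1) ^ 2 := Nat.one_le_pow _ _ (by omega)
  have h13 : 1 ≤ (Nat.log 2 m + 1) ^ 2 * j ^ 4 := Nat.mul_le_mul h12 h11
  have e1 : (51 * (Nat.log 2 m + 1)) ^ 2 * j ^ 4 = 2601 * ((Nat.log 2 m + 1) ^ 2 * j ^ 4) := by ring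
  have e2 : 40 * ((Nat.log 2 m + 1) * (4 * j ^ 2)) ^ 2 = 640 * ((Nat.log 2 m + 1) ^ 2 * j ^ 4) := by ring
  have e3 : j ^ 2 * j ^ 4 = j ^ 6 := by ring
  rw [e1, e3] at h10
  rw [e2]
  omega

theorem sixth (m : ℕ) : ∃ j, j ^ 6 ≤ m ∧ m < (j + 1) ^ 6 := by
  refine ⟨Nat.findGreatest (fun j => j ^ 6 ≤ m) m, Nat.findGreatest_spec (P := fun j => j ^ 6 ≤ m) (Nat.zero_le m) (by simp), ?_⟩
  by_contra h
  push Not at h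
  have h1 : Nat.findGreatest (fun j => j ^ 6 ≤ m) m + 1 ≤ m := (Nat.le_self_pow (by norm_num) _).trans h
  have := Nat.le_findGreatest (P := fun j => j ^ 6 ≤ m) h1 h
  omega

variable {F E : Type*} [Field F] [Fintype F] [Field E] [Algebra F E] [FiniteDimensional F E]
  {KJ : ℕ → Type*} [∀ i, Field (KJ i)] [∀ i, Algebra F (KJ i)] [∀ i, FiniteDimensional F (KJ i)]

theorem invgen_of_tests {γ' : ∀ d, KJ (2 * d)} {m : ℕ} {γ : E} (hd : finrank F E = 2 * m) (hodd : Odd (Fintype.card F)) (hγ : bar F m γ = -γ) (hγ0 : γ ≠ 0)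
    (j : ℕ) (hj : 8 ≤ j) (hm : 40 * ((Nat.log 2 m + 1) * (4 * j ^ 2)) ^ 2 + 40 ≤ m)
    {ζ : E} (hζ : IsPrimitiveRoot ζ (Fintype.card F ^ m + 1)) (y : Sp (hform (F := F) m γ))
    (ht : ∀ s ∈ insert 2 m.primeFactors, ∃ d ∈ QQ m j s, HB (hform (F := F) m γ) d (γ' d) y.1) :
    InvGen (⟨mulE F ζ (T_ne hζ.pow_eq_one), mulE_mem hζ.pow_eq_one⟩ : Sp (hform (F := F) m γ)) y := by
  intro g h
  set x : Sp (hform (F := F) m γ) := ⟨mulE F ζ (T_ne hζ.pow_eq_one), mulE_mem hζ.pow_eq_one⟩ with hx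
  set H0 := Subgroup.closure {g * x * g⁻¹, h * y * h⁻¹} with hH0
  set H1 := H0.comap (MulAut.conj g).toMonoidHom with hH1
  have hx1 : x ∈ H1 := Subgroup.mem_comap.2 (Subgroup.subset_closure (Set.mem_insert _ _))
  have hy1 : (g⁻¹ * h) * y * (g⁻¹ * h)⁻¹ ∈ H1 := by
    apply Subgroup.mem_comap.2
    have : (MulAut.conj g).toMonoidHom ((g⁻¹ * h) * y * (g⁻¹ * h)⁻¹) = h * y * h⁻¹ := by
      show g * ((g⁻¹ * h) * y * (g⁻¹ * h)⁻¹) * g⁻¹ = _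
      group
    rw [this]
    exact Subgroup.subset_closure (Set.mem_insert_of_mem _ rfl)
  have key : Sp (hform (F := F) m γ) ≤ H1.map (Sp (hform (F := F) m γ)).subtype := by
    refine gen_of_tests (γ' := γ') hd hodd hγ hγ0 ?_ j hj hm (y := (((g⁻¹ * h) * y * (g⁻¹ * h)⁻¹ : Sp (hform (F := F) m γ)) : E ≃ₗ[F] E))
      ⟨_, hy1, rfl⟩ (Subtype.mem _) ?_
    · intro s hs
      obtain ⟨i, _, hi⟩ := hζ.eq_pow_of_pow_eq_one hs
      refine ⟨x ^ i, H1.pow_mem hx1 i, ?_⟩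
      have : ∀ i : ℕ, ∀ a : E, ((x ^ i : Sp (hform (F := F) m γ)) : E ≃ₗ[F] E) a = ζ ^ i * a := by
        intro i
        induction i with
        | zero => intro a; simp
        | succ n ih =>
          intro a
          rw [pow_succ, Subgroup.coe_mul, LinearEquiv.mul_apply, ih]
          show ζ ^ n * (ζ * a) = _
          ring
      ext a
      show ((x ^ i : Sp (hform (F := F) m γ)) : E ≃ₗ[F] E) a = mulE F s (T_ne hs) a
      rw [this, mulE_apply, hi]
    · intro s hs
      obtain ⟨d, hd, hB⟩ := ht s hs
      exact ⟨d, hd, hB.conj (g := ((g⁻¹ * h : Sp (hform (F := F) m γ)) : E ≃ₗ[F] E)) (Subtype.mem _)⟩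
  rw [eq_top_iff]
  intro z _
  obtain ⟨w, hw, hwz⟩ := key (g⁻¹ * z * g).2
  have hw2 : w = g⁻¹ * z * g := Subtype.ext hwz
  rw [hw2] at hw
  have h3 : g * (g⁻¹ * z * g) * g⁻¹ ∈ H0 := Subgroup.mem_comap.1 hw
  have h4 : g * (g⁻¹ * z * g) * g⁻¹ = z := by group
  rwa [h4] at h3

theorem big_case {m j : ℕ} (hd : finrank F E = 2 * m) (hodd : Odd (Fintype.card F)) (hj : 8 ≤ j) (h1 : j ^ 6 ≤ m) (h2 : m < (j + 1) ^ 6)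
    (hm : 40 * ((Nat.log 2 m + 1) * (4 * j ^ 2)) ^ 2 + 40 ≤ m) (hJ : ∀ j, 1 ≤ j → finrank F (KJ j) = j) :
    ∃ x : Matrix.symplecticGroup (Fin m) F,
            (Nat.card {y : Matrix.symplecticGroup (Fin m) F // InvGen x y} : ℝ) ≥
              (1 - 2010 * (m : ℝ) ^ (-(1 : ℝ) / 200)) * Nat.card (Matrix.symplecticGroup (Fin m) F) := by
  classical
  obtain ⟨γ, hγ, hγ0⟩ := exists_gamma hd (by omega)
  obtain ⟨ζ, hζ⟩ := exists_primRoot hd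
  have hVa := hform_alt hd hodd hγ
  have hV := hform_nd hd hodd hγ hγ0
  set B := hform (F := F) m γ with hB
  obtain ⟨e⟩ := symp_equiv hVa hV m hd
  have hfinE := finite_of_fd F E
  have : Finite (E ≃ₗ[F] E) := Finite.of_injective (fun g : E ≃ₗ[F] E => (g : E → E)) DFunLike.coe_injective
  have := Fintype.ofFinite (Sp B)
  have hPD : ∀ d, ∃ r, ∃ γ', ∃ P : Finset (KJ (2 * d)), 2 ≤ d → PD F d r γ' P := by
    intro d
    by_cases h : 2 ≤ d
    · obtain ⟨r, γ', P, p⟩ := exists_PD (hJ (2 * d) (by omega)) h hodd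
      exact ⟨r, γ', P, fun _ => p⟩
    · exact ⟨0, 0, ∅, fun h' => absurd h' h⟩
  choose r γ' P hPD using hPD
  set D := Finset.Ico (2 * j) (2 * j ^ 2) with hD
  have hDmem : ∀ d ∈ D, 2 * j ≤ d ∧ d < 2 * j ^ 2 := fun d hd => Finset.mem_Ico.1 hd
  have hdim : ∑ d ∈ D, 4 * d ≤ finrank F E := by
    refine (Finset.sum_le_card_nsmul D _ (8 * j ^ 2) fun d hd => by have := hDmem d hd; omega).trans ?_
    rw [Nat.card_Ico, smul_eq_mul, hd]
    have a1 : (2 * j ^ 2 - 2 * j) * (8 * j ^ 2) ≤ 2 * j ^ 2 * (8 * j ^ 2) := Nat.mul_le_mul_right _ (Nat.sub_le _ _)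
    have a2 : 8 ≤ j ^ 2 := by nlinarith
    have a3 := Nat.mul_le_mul_right (j ^ 4) a2
    nlinarith
  have hcard : ∀ s ∈ insert 2 m.primeFactors, s.Prime := by
    intro s hs
    rcases Finset.mem_insert.1 hs with h | h
    · rw [h]; exact Nat.prime_two
    · exact Nat.prime_of_mem_primeFactors h
  have hf := fail_card hVa hV hodd D (fun d hd => hPD d (by have := hDmem d hd; omega)) hJ m hd hdim (2 * j)
    (fun d hd => (hDmem d hd).1) (insert 2 m.primeFactors) (QQ m j) (fun s _ => Finset.filter_subset _ _)
  have hnum : ∑ s ∈ insert 2 m.primeFactors, (∏ d ∈ QQ m j s, (1 - 1 / (4 * (d : ℝ))) + (2 * (QQ m j s).card) * (2 / 2 ^ (2 * j)) * ∏ d ∈ QQ m j s, (1 + 1 / (d : ℝ)))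
        + ∑ d ∈ D, ∑ t ∈ Finset.Icc 1 m, 1 / ((d : ℝ) ^ 2 * t) ≤ 2010 * (m : ℝ) ^ (-(1 : ℝ) / 200) := by
    refine le_trans (add_le_add ?_ (bad_bound m j hj)) (num_bound m j hj h1 h2)
    refine (Finset.sum_le_card_nsmul _ _ (2 * (j : ℝ) ^ (-(1 : ℝ) / 16)) fun s hs =>
      test_bound _ j hj (Finset.filter_subset _ _) (QQ_pair (hcard s hs))).trans ?_
    rw [nsmul_eq_mul]
    gcongr
    exact card_tests m (by omega)
  set x : Sp B := ⟨mulE F ζ (T_ne hζ.pow_eq_one), mulE_mem hζ.pow_eq_one⟩ with hx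
  refine ⟨e.symm x, ?_⟩
  have hG : Nat.card (Matrix.symplecticGroup (Fin m) F) = Fintype.card (Sp B) := by
    rw [Nat.card_congr e.toEquiv, Nat.card_eq_fintype_card]
  have hinv : Nat.card {y : Sp B // ¬ ∃ s ∈ insert 2 m.primeFactors, ∀ d ∈ QQ m j s, ¬ HB B d (γ' d) y.1} ≤
      Nat.card {y : Matrix.symplecticGroup (Fin m) F // InvGen (e.symm x) y} := by
    have : Finite (Matrix.symplecticGroup (Fin m) F) := Finite.of_equiv _ e.symm.toEquiv
    refine Nat.card_le_card_of_injective (fun y => ⟨e.symm y.1, ?_⟩) ?_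
    · apply InvGen_of_equiv e
      rw [e.apply_symm_apply, e.apply_symm_apply]
      refine invgen_of_tests (γ' := γ') hd hodd hγ hγ0 j hj hm hζ y.1 ?_
      intro s hs
      by_contra hc
      push Not at hc
      exact y.2 ⟨s, hs, hc⟩
    · intro a b hab
      exact Subtype.ext (e.symm.injective (congrArg Subtype.val hab))
  have hcompl : Nat.card {y : Sp B // ∃ s ∈ insert 2 m.primeFactors, ∀ d ∈ QQ m j s, ¬ HB B d (γ' d) y.1} +
      Nat.card {y : Sp B // ¬ ∃ s ∈ insert 2 m.primeFactors, ∀ d ∈ QQ m j s, ¬ HB B d (γ' d) y.1} = Fintype.card (Sp B) := by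
    rw [← Nat.card_sum, ← Nat.card_eq_fintype_card]
    exact Nat.card_congr (Equiv.sumCompl _)
  have hf2 := hf.trans (mul_le_mul_of_nonneg_left hnum (Nat.cast_nonneg _))
  rw [hG]
  have h5 : (Nat.card {y : Sp B // ¬ ∃ s ∈ insert 2 m.primeFactors, ∀ d ∈ QQ m j s, ¬ HB B d (γ' d) y.1} : ℝ) ≤ 
      Nat.card {y : Matrix.symplecticGroup (Fin m) F // InvGen (e.symm x) y} := by exact_mod_cast hinv
  have h6 := congrArg (Nat.cast : ℕ → ℝ) hcompl
  push_cast at h6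
  linarith

end SpGen

theorem stmt_12 :
    ∃ C : ℝ, 0 < C ∧
      ∀ m : ℕ, 1 ≤ m →
        ∀ (F : Type) [Field F] [Fintype F], Odd (Fintype.card F) →
          ∃ x : Matrix.symplecticGroup (Fin m) F,
            (Nat.card {y : Matrix.symplecticGroup (Fin m) F // InvGen x y} : ℝ) ≥
              (1 - C * (m : ℝ) ^ (-(1 : ℝ) / 200)) *
                Nat.card (Matrix.symplecticGroup (Fin m) F) := by
  obtain ⟨j0, hj0⟩ := SpGen.eventually_j
  refine ⟨2010 + ((j0 + 9 : ℕ) : ℝ) ^ 6, by positivity, ?_⟩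
  intro m hm F _ _ hodd
  have hmr : (1 : ℝ) ≤ m := by exact_mod_cast hm
  obtain ⟨j, h1, h2⟩ := SpGen.sixth m
  have hp : 0 ≤ (m : ℝ) ^ (-(1 : ℝ) / 200) := by positivity
  by_cases hj : j0 + 8 ≤ j
  · obtain ⟨p, hc⟩ := CharP.exists F
    have : Fact p.Prime := ⟨CharP.char_is_prime F p⟩
    obtain ⟨x, hx⟩ := SpGen.big_case (F := F) (E := FiniteField.Extension F p (2 * m - 1 + 1))
      (KJ := fun j => FiniteField.Extension F p (j - 1 + 1)) (by rw [FiniteField.finrank_extension]; omega) hodd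
      (by omega) h1 h2 (hj0 j (by omega) m h1 h2)
      (fun j hj => by rw [FiniteField.finrank_extension]; omega)
    refine ⟨x, ge_trans hx ?_⟩
    apply mul_le_mul_of_nonneg_right _ (Nat.cast_nonneg _)
    have : 0 ≤ ((j0 + 9 : ℕ) : ℝ) ^ 6 * (m : ℝ) ^ (-(1 : ℝ) / 200) := by positivity
    linarith
  · refine ⟨1, ?_⟩
    have h3 : (m : ℝ) ≤ ((j0 + 9 : ℕ) : ℝ) ^ 6 := by
      exact_mod_cast h2.le.trans (Nat.pow_le_pow_left (by omega) 6)
    have h4 : (m : ℝ) ^ (-(1 : ℝ)) ≤ (m : ℝ) ^ (-(1 : ℝ) / 200) := Real.rpow_le_rpow_of_exponent_le hmr (by norm_num)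
    rw [Real.rpow_neg_one] at h4
    have h5 : 1 ≤ ((j0 + 9 : ℕ) : ℝ) ^ 6 * (m : ℝ) ^ (-(1 : ℝ) / 200) := by
      calc (1 : ℝ) = m * (m : ℝ)⁻¹ := by rw [mul_inv_cancel₀ (by linarith)]
        _ ≤ _ := by gcongr
    have h6 : (1 - (2010 + ((j0 + 9 : ℕ) : ℝ) ^ 6) * (m : ℝ) ^ (-(1 : ℝ) / 200)) ≤ 0 := by linarith
    have h7 : (0 : ℝ) ≤ Nat.card (Matrix.symplecticGroup (Fin m) F) := Nat.cast_nonneg _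
    have h8 := mul_nonpos_of_nonpos_of_nonneg h6 h7
    exact le_trans h8 (Nat.cast_nonneg _)
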